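/- Let χ be a Dirichlet character of order 3 modulo a prime f, and let ω be a complex cube root of unity with ω ≠ 1. Let r, h, u, v be positive integers, where u = u₁u₂⋯u_k is a product of pairwise distinct primes u_i < h, and v = v₁v₂⋯v_ℓ is a product of pairwise distinct primes satisfying h ≤ v_i < f. Let H ∈ (0,f) be a real number and set X = H/h. Suppose r ≤ 9h, 3ℓ < h, X/u ≥ 1, E_u(X) > 0, and (1/E_u(X))·(π²/6)·(σ(u)/φ(u))·u·h·f^{1/2}·(2h/(h−3ℓ))^{2r}·W(f,h,r)/H² < 1. Then there exists a positive integer m ≤ H satisfying gcd(m, uv) = 1 and χ(m) = ω. -/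

import Mathlib

/-- The quantity `d_r(h)` from the paper. -/
noncomputable def dFun (r h : ℕ) : ℝ :=
  (1 / ((r.factorial : ℝ) * (h : ℝ) ^ r)) *
    ∑ n ∈ Finset.range (r / 3 + 1),
      ((r.factorial : ℝ) / ((n.factorial : ℝ) * 6 ^ n)) ^ 2 *
        (h : ℝ) ^ (r - n) / ((r - 3 * n).factorial : ℝ)

/-- The quantity `W(f,h,r) = 2r - 1 + (f^{1/2}/h^r) · r! · d_r(h)`. -/
noncomputable def WFun (f h r : ℕ) : ℝ :=
  (2 * r - 1 : ℝ) + (Real.sqrt f / (h : ℝ) ^ r) * (r.factorial : ℝ) * dFun r h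

/-- Sum-of-divisors function `σ(u)`. -/
def sigmaFun (u : ℕ) : ℕ := ∑ d ∈ u.divisors, d

/-- The quantity `E_u(X) = 1 - (π²/6)·σ(u)·(σ(u)/4 + φ(u)/u + φ(u)/X)/X`. -/
noncomputable def EFun (u : ℕ) (X : ℝ) : ℝ :=
  1 - (Real.pi ^ 2 / 6) * (sigmaFun u : ℝ) *
    ((sigmaFun u : ℝ) / 4 + (Nat.totient u : ℝ) / u + (Nat.totient u : ℝ) / X) / X

section PartA1
theorem stepanov_exponent_inj (k e : ℕ) (he : e = 1 ∨ e = 2) (i i' j j' l l' : ℕ)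
    (hj : j < 3) (hj' : j' < 3) (hl : l + 1 < k) (hl' : l' + 1 < k)
    (h : l + i * (3 * k + 1) + e * (k * j) = l' + i' * (3 * k + 1) + e * (k * j')) :
    i = i' ∧ j = j' ∧ l = l' := by
  have key2 : i = i' ∨ i * (3 * k + 1) + (3 * k + 1) = i' * (3 * k + 1) ∨
      i' * (3 * k + 1) + (3 * k + 1) = i * (3 * k + 1) ∨
      i * (3 * k + 1) + 2 * (3 * k + 1) ≤ i' * (3 * k + 1) ∨
      i' * (3 * k + 1) + 2 * (3 * k + 1) ≤ i * (3 * k + 1) := by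
    rcases lt_trichotomy i i' with h | h | h
    · right
      rcases Nat.lt_or_ge (i + 1) i' with h2 | h2
      · right; right; left; nlinarith
      · left
        have : i' = i + 1 := by omega
        rw [this]; ring
    · left; exact h
    · right
      rcases Nat.lt_or_ge (i' + 1) i with h2 | h2
      · right; right; right; nlinarith
      · right; left
        have : i = i' + 1 := by omega
        rw [this]; ring
  have hAA : i = i' → i * (3 * k + 1) = i' * (3 * k + 1) := by rintro rfl; rfl
  generalize i * (3 * k + 1) = A at *
  generalize i' * (3 * k + 1) = A' at *
  rcases he with rfl | rfl <;> interval_cases j <;> interval_cases j' <;> omega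

set_option maxHeartbeats 1000000 in

open Polynomial in
/-- The Stepanov auxiliary polynomial argument. -/
theorem stepanov_count {E : Type*} [Field E] [Fintype E] [DecidableEq E] (p a k : ℕ) [Fact p.Prime]
    [CharP E p] (hP : p ^ a = 3 * k + 1) (hcard : Fintype.card E = (3 * k + 1) ^ 2)
    (hk : 4 ≤ k) (e : ℕ) (he : e = 1 ∨ e = 2) (g1 : E[X]) (hg1 : g1.coeff 0 ≠ 0)
    (c : E) (hc : c ≠ 0) (d : ℕ) (hd : (X ^ e * g1).natDegree = d) :
    (Finset.univ.filter (fun x : E => (X ^ e * g1).eval x ^ (k * (3 * k + 2)) = c)).card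
      ≤ 2 * k * d + (k + d) * (3 * k + 1) + k := by
  classical
  set g : E[X] := X ^ e * g1 with hg
  set P : ℕ := 3 * k + 1 with hPdef
  set I : ℕ := k + d + 1 with hI
  set m : ℕ := k - 1 with hm
  set N : ℕ := 2 * k * d + P * (m - 1) + I with hN
  have hQ : ∀ y : E, y ^ (P * P) = y := by
    intro y
    have := FiniteField.pow_card y
    rwa [hcard, pow_two] at this
  -- the vectors
  let v : Fin I × Fin 3 × Fin m → E[X] := fun t =>
    C (c ^ (t.2.1 : ℕ)) * g ^ (k * (2 - (t.2.1 : ℕ))) * X ^ ((t.2.2 : ℕ) * P + (t.1 : ℕ))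
  have hvdeg : ∀ t, v t ∈ degreeLT E N := by
    intro t
    rw [mem_degreeLT]
    refine lt_of_le_of_lt degree_le_natDegree ?_
    rw [Nat.cast_lt]
    refine lt_of_le_of_lt natDegree_mul_le ?_
    have h1 : (C (c ^ (t.2.1 : ℕ)) * g ^ (k * (2 - (t.2.1 : ℕ)))).natDegree ≤ 2 * k * d := by
      refine (natDegree_C_mul_le _ _).trans ?_
      refine natDegree_pow_le.trans ?_
      rw [hd]
      have : 2 - (t.2.1 : ℕ) ≤ 2 := Nat.sub_le _ _
      nlinarith [Nat.mul_le_mul_left (k*d) this]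
    rw [natDegree_X_pow]
    have h2 : (t.2.2 : ℕ) ≤ m - 1 := by have := t.2.2.2; omega
    have h3 : (t.1 : ℕ) < I := t.1.2
    have h4 : (t.2.2 : ℕ) * P ≤ P * (m - 1) := by rw [mul_comm]; exact Nat.mul_le_mul_left _ h2
    omega
  have hlt : Module.finrank E (degreeLT E N) < Fintype.card (Fin I × Fin 3 × Fin m) := by
    have : Module.finrank E (degreeLT E N) = N := by
      rw [LinearEquiv.finrank_eq (degreeLTEquiv E N)]; simp
    rw [this]
    simp only [Fintype.card_prod, Fintype.card_fin]
    obtain ⟨k', rfl⟩ : ∃ k', k = k' + 4 := ⟨k - 4, by omega⟩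
    have e1 : m = k' + 3 := by omega
    rw [hN, e1, hI, hPdef]
    have : k' + 3 - 1 = k' + 2 := rfl
    rw [this]
    nlinarith
  have hdep : ¬ LinearIndependent E (fun t => (⟨v t, hvdeg t⟩ : degreeLT E N)) := by
    intro hli
    have : Module.Finite E (degreeLT E N) := Module.Finite.equiv (degreeLTEquiv E N).symm
    exact absurd hli.fintype_card_le_finrank (not_le.mpr hlt)
  rw [Fintype.not_linearIndependent_iff] at hdep
  obtain ⟨b, hb0, t0, ht0⟩ := hdep
  have hb : ∑ t, b t • v t = 0 := by
    have := congrArg (Submodule.subtype _) hb0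
    simpa using this
  -- the auxiliary polynomial
  let Θ : E[X] := ∑ t : Fin I × Fin 3 × Fin m,
    C (b t ^ P) * (g ^ (k * (t.2.1 : ℕ)) * X ^ ((t.2.2 : ℕ) + (t.1 : ℕ) * P))
  let ν : Fin I × Fin 3 × Fin m → ℕ := fun t =>
    (t.2.2 : ℕ) + (t.1 : ℕ) * P + e * (k * (t.2.1 : ℕ))
  have hterm : ∀ t, C (b t ^ P) * (g ^ (k * (t.2.1 : ℕ)) * X ^ ((t.2.2 : ℕ) + (t.1 : ℕ) * P))
      = X ^ (ν t) * (C (b t ^ P) * g1 ^ (k * (t.2.1 : ℕ))) := by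
    intro t
    simp only [ν, hg]
    rw [mul_pow, ← pow_mul]
    ring
  have hνinj : Function.Injective ν := by
    rintro ⟨⟨i, hi⟩, ⟨j, hj⟩, ⟨l, hl⟩⟩ ⟨⟨i', hi'⟩, ⟨j', hj'⟩, ⟨l', hl'⟩⟩ h
    simp only [ν] at h
    simp only [Prod.mk.injEq, Fin.mk.injEq]
    exact stepanov_exponent_inj k e he i i' j j' l l' hj hj' (by omega) (by omega) h
  have hΘ : Θ ≠ 0 := by
    have hne : (Finset.univ.filter (fun t => b t ≠ 0)).Nonempty := ⟨t0, by simp [ht0]⟩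
    obtain ⟨t1, ht1, hmin⟩ := Finset.exists_min_image _ ν hne
    have ht1' : b t1 ≠ 0 := by simpa using ht1
    intro h0
    have hco : Θ.coeff (ν t1) = b t1 ^ P * (g1.coeff 0) ^ (k * (t1.2.1 : ℕ)) := by
      simp only [Θ]
      rw [finset_sum_coeff]
      rw [Finset.sum_eq_single t1]
      · rw [hterm, coeff_X_pow_mul', if_pos le_rfl, Nat.sub_self, coeff_C_mul]
        rw [coeff_zero_eq_eval_zero, eval_pow, ← coeff_zero_eq_eval_zero]
      · intro t _ hne
        rw [hterm, coeff_X_pow_mul']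
        split_ifs with hle
        · by_cases hbt : b t = 0
          · have : P ≠ 0 := by omega
            simp [hbt, this]
          · have := hmin t (by simp [hbt])
            exact absurd (hνinj (le_antisymm hle this)) hne
        · rfl
      · simp
    rw [h0, coeff_zero] at hco
    have := mul_ne_zero (pow_ne_zero P ht1') (pow_ne_zero (k * (t1.2.1 : ℕ)) hg1)
    exact this hco.symm
  have hfrob : ∀ (s : Finset (Fin I × Fin 3 × Fin m)) (F : Fin I × Fin 3 × Fin m → E),
      (∑ t ∈ s, F t) ^ P = ∑ t ∈ s, F t ^ P := by
    intro s F
    rw [← hP]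
    exact sum_pow_char_pow p a s F
  have hroot : ∀ x : E, g.eval x ^ (k * (3 * k + 2)) = c → Θ.eval x = 0 := by
    intro x hx
    have hgx : g.eval x ≠ 0 := by
      intro h0
      rw [h0, zero_pow (by positivity)] at hx
      exact hc hx.symm
    have h1 : Θ.eval x ^ P * g.eval x ^ (2 * k) = (∑ t, b t • v t).eval x := by
      simp only [Θ, v, eval_finset_sum]
      rw [hfrob, Finset.sum_mul]
      refine Finset.sum_congr rfl fun t _ => ?_
      simp only [eval_mul, eval_C, eval_pow, eval_X, eval_smul, smul_eq_mul]
      rw [mul_pow, ← pow_mul, hQ, mul_pow, ← pow_mul, ← pow_mul, add_mul, mul_assoc (t.1 : ℕ), ← hx]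
      rw [pow_add x, mul_comm (t.1 : ℕ), pow_mul x (P * P), hQ]
      have hj : (t.2.1 : ℕ) ≤ 2 := by have := t.2.1.2; omega
      have hexp : k * (t.2.1 : ℕ) * P + 2 * k = (k * (3 * k + 2)) * (t.2.1 : ℕ) + k * (2 - (t.2.1 : ℕ)) := by
        obtain ⟨w, hw⟩ := Nat.exists_eq_add_of_le hj
        have : 2 - (t.2.1 : ℕ) = w := by omega
        rw [this, hPdef]
        have : 2 * k = ((t.2.1 : ℕ) + w) * k := by rw [← hw]
        rw [this]; ring
      rw [← pow_mul (eval x g), pow_add x]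
      have : eval x g ^ (k * (t.2.1 : ℕ) * P) * eval x g ^ (2 * k) =
          eval x g ^ (k * (3 * k + 2) * (t.2.1 : ℕ)) * eval x g ^ (k * (2 - (t.2.1 : ℕ))) := by
        rw [← pow_add, ← pow_add, hexp]
      linear_combination (b t * (x ^ ((t.2.2 : ℕ) * P)) * x ^ (t.1 : ℕ)) * this
    rw [hb, eval_zero] at h1
    have h2 := (mul_eq_zero.mp h1).resolve_right (pow_ne_zero _ hgx)
    exact pow_eq_zero_iff (by omega) |>.mp h2
  have hsub : (Finset.univ.filter (fun x : E => g.eval x ^ (k * (3 * k + 2)) = c)) ⊆ Θ.roots.toFinset := by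
    intro x hx
    rw [Multiset.mem_toFinset, mem_roots hΘ]
    exact hroot x (by simpa using hx)
  refine (Finset.card_le_card hsub).trans ((Multiset.toFinset_card_le _).trans ((card_roots' _).trans ?_))
  refine natDegree_sum_le_of_forall_le _ _ fun t _ => ?_
  refine (natDegree_C_mul_le _ _).trans (natDegree_mul_le.trans ?_)
  rw [natDegree_X_pow]
  have h1 : (g ^ (k * (t.2.1 : ℕ))).natDegree ≤ 2 * k * d := by
    refine natDegree_pow_le.trans ?_
    rw [hd]
    have : (t.2.1 : ℕ) ≤ 2 := by have := t.2.1.2; omega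
    nlinarith [Nat.mul_le_mul_left (k*d) this]
  have h2 : (t.2.2 : ℕ) ≤ k := by have := t.2.2.2; omega
  have h3 : (t.1 : ℕ) * P ≤ (k + d) * P := Nat.mul_le_mul_right _ (by have := t.1.2; omega)
  omega

end PartA1

section PartA2
open Polynomial

section LFun

variable {K : Type*} [Field K] [Fintype K]

theorem monicDeg_finite (K : Type*) [Field K] [Fintype K] (n : ℕ) :
    {F : K[X] | F.Monic ∧ F.natDegree = n}.Finite := by
  refine Set.Finite.of_finite_image (f := fun F : K[X] => fun i : Fin (n + 1) => F.coeff i)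
    (Set.toFinite _) ?_
  intro F hF G hG h
  ext i
  by_cases hi : i < n + 1
  · exact congrFun h ⟨i, hi⟩
  · rw [coeff_eq_zero_of_natDegree_lt (by rw [hF.2]; omega),
      coeff_eq_zero_of_natDegree_lt (by rw [hG.2]; omega)]

/-- Monic polynomials of degree `n`. -/
noncomputable def monicDeg (K : Type*) [Field K] [Fintype K] (n : ℕ) : Finset K[X] :=
  (monicDeg_finite K n).toFinset

theorem mem_monicDeg {n : ℕ} {F : K[X]} : F ∈ monicDeg K n ↔ F.Monic ∧ F.natDegree = n := by
  simp [monicDeg]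

open Classical in
/-- Monic irreducible polynomials of degree at most `m`. -/
noncomputable def irrLE (K : Type*) [Field K] [Fintype K] (m : ℕ) : Finset K[X] :=
  ((Finset.range (m + 1)).biUnion (fun n => monicDeg K n)).filter Irreducible

theorem mem_irrLE {m : ℕ} {P : K[X]} :
    P ∈ irrLE K m ↔ P.Monic ∧ P.natDegree ≤ m ∧ Irreducible P := by
  classical
  simp only [irrLE, Finset.mem_filter, Finset.mem_biUnion, Finset.mem_range, mem_monicDeg]
  constructor
  · rintro ⟨⟨n, hn, h1, h2⟩, h3⟩
    exact ⟨h1, by omega, h3⟩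
  · rintro ⟨h1, h2, h3⟩
    exact ⟨⟨_, by omega, h1, rfl⟩, h3⟩

/-- Coefficients of the `L`-function. -/
noncomputable def cCoef (lam : K[X] →* ℂ) (n : ℕ) : ℂ := ∑ F ∈ monicDeg K n, lam F

/-- Power sums of the `L`-function. -/
noncomputable def sCoef (lam : K[X] →* ℂ) (n : ℕ) : ℂ :=
  ∑ P ∈ irrLE K n, ∑ k ∈ Finset.Icc 1 n,
    if k * P.natDegree = n then (P.natDegree : ℂ) * lam P ^ k else 0

theorem sCoef_extend (lam : K[X] →* ℂ) {n m : ℕ} (hn : 1 ≤ n) (hnm : n ≤ m) :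
    sCoef lam n = ∑ P ∈ irrLE K m, ∑ k ∈ Finset.Icc 1 m,
      if k * P.natDegree = n then (P.natDegree : ℂ) * lam P ^ k else 0 := by
  classical
  have h1 : sCoef lam n = ∑ P ∈ irrLE K n, ∑ k ∈ Finset.Icc 1 m,
      if k * P.natDegree = n then (P.natDegree : ℂ) * lam P ^ k else 0 := by
    unfold sCoef
    refine Finset.sum_congr rfl fun P hP => ?_
    refine Finset.sum_subset (Finset.Icc_subset_Icc_right hnm) ?_
    intro k hk hk'
    rw [if_neg]
    rintro rfl
    have hP' := (mem_irrLE.mp hP).2.2.natDegree_pos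
    simp only [Finset.mem_Icc] at hk hk'
    exact hk' ⟨hk.1, Nat.le_mul_of_pos_right _ hP'⟩
  rw [h1]
  refine Finset.sum_subset ?_ ?_
  · intro P hP
    rw [mem_irrLE] at hP ⊢
    exact ⟨hP.1, hP.2.1.trans hnm, hP.2.2⟩
  · intro P hP hP'
    refine Finset.sum_eq_zero fun k hk => ?_
    rw [if_neg]
    rintro rfl
    apply hP'
    rw [mem_irrLE] at hP ⊢
    simp only [Finset.mem_Icc] at hk
    exact ⟨hP.1, Nat.le_mul_of_pos_left _ (by omega), hP.2.2⟩

open Classical in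
theorem degree_formula {m : ℕ} {F : K[X]} (hF : F ∈ monicDeg K m) :
    m = ∑ P ∈ irrLE K m, ∑ k ∈ Finset.Icc 1 m, if P ^ k ∣ F then P.natDegree else 0 := by
  obtain ⟨hmon, hdeg⟩ := mem_monicDeg.mp hF
  have hF0 : F ≠ 0 := hmon.ne_zero
  have hprod : (UniqueFactorizationMonoid.normalizedFactors F).prod = F := by
    rw [UniqueFactorizationMonoid.prod_normalizedFactors_eq hF0]
    exact hmon.normalize_eq_self
  have hmem : ∀ P ∈ UniqueFactorizationMonoid.normalizedFactors F,
      P.Monic ∧ Irreducible P ∧ P ∣ F := by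
    intro P hP
    have hirr := UniqueFactorizationMonoid.irreducible_of_normalized_factor P hP
    refine ⟨?_, hirr, UniqueFactorizationMonoid.dvd_of_mem_normalizedFactors hP⟩
    have := UniqueFactorizationMonoid.normalize_normalized_factor P hP
    rw [← this]
    exact monic_normalize hirr.ne_zero
  have h1 : m = ∑ P ∈ (UniqueFactorizationMonoid.normalizedFactors F).toFinset,
      (UniqueFactorizationMonoid.normalizedFactors F).count P * P.natDegree := by
    have : (Multiset.map natDegree (UniqueFactorizationMonoid.normalizedFactors F)).sum = m := by
      rw [← natDegree_multiset_prod_of_monic, hprod, hdeg]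
      intro P hP; exact (hmem P hP).1
    rw [← this, Finset.sum_multiset_map_count]
    rfl
  have hsub : (UniqueFactorizationMonoid.normalizedFactors F).toFinset ⊆ irrLE K m := by
    intro P hP
    rw [Multiset.mem_toFinset] at hP
    obtain ⟨a, b, c⟩ := hmem P hP
    exact mem_irrLE.mpr ⟨a, hdeg ▸ natDegree_le_of_dvd c hF0, b⟩
  conv_lhs => rw [h1]
  rw [Finset.sum_subset hsub]
  · refine Finset.sum_congr rfl fun P hP => ?_
    obtain ⟨hPm, hPd, hPi⟩ := mem_irrLE.mp hP
    rw [← Finset.sum_filter, Finset.sum_const, smul_eq_mul]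
    congr 1
    have hdvd : ∀ k, P ^ k ∣ F ↔ k ≤ (UniqueFactorizationMonoid.normalizedFactors F).count P := by
      intro k
      rw [pow_dvd_iff_le_emultiplicity,
        UniqueFactorizationMonoid.emultiplicity_eq_count_normalizedFactors hPi hF0,
        hPm.normalize_eq_self]
      exact_mod_cast Iff.rfl
    have hcle : (UniqueFactorizationMonoid.normalizedFactors F).count P ≤ m := by
      have := natDegree_le_of_dvd ((hdvd _).mpr le_rfl) hF0
      rw [natDegree_pow, hdeg] at this
      exact (Nat.le_mul_of_pos_right _ hPi.natDegree_pos).trans this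
    have : Finset.filter (fun k => P ^ k ∣ F) (Finset.Icc 1 m) =
        Finset.Icc 1 ((UniqueFactorizationMonoid.normalizedFactors F).count P) := by
      ext k
      simp only [Finset.mem_filter, Finset.mem_Icc, hdvd]
      omega
    rw [this, Nat.card_Icc]; omega
  · intro P _ hP
    rw [Multiset.mem_toFinset] at hP
    rw [Multiset.count_eq_zero_of_notMem hP, zero_mul]

open Classical in
theorem sum_dvd (lam : K[X] →* ℂ) (m j : ℕ) (Q : K[X]) (hQ : Q.Monic) (hj : Q.natDegree = j) :
    ∑ F ∈ monicDeg K m, (if Q ∣ F then lam F else 0) =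
      if j ≤ m then lam Q * cCoef lam (m - j) else 0 := by
  split_ifs with h
  · rw [← Finset.sum_filter, cCoef, Finset.mul_sum]
    symm
    refine Finset.sum_bij (fun G _ => Q * G) ?_ ?_ ?_ ?_
    · intro G hG
      obtain ⟨h1, h2⟩ := mem_monicDeg.mp hG
      rw [Finset.mem_filter, mem_monicDeg]
      refine ⟨⟨hQ.mul h1, ?_⟩, dvd_mul_right _ _⟩
      rw [hQ.natDegree_mul h1, h2]; omega
    · intro G _ G' _ h
      exact mul_left_cancel₀ hQ.ne_zero h
    · intro F hF
      rw [Finset.mem_filter, mem_monicDeg] at hF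
      obtain ⟨⟨h1, h2⟩, G, rfl⟩ := hF
      have hG := hQ.of_mul_monic_left h1
      refine ⟨G, mem_monicDeg.mpr ⟨hG, ?_⟩, rfl⟩
      rw [hQ.natDegree_mul hG] at h2; omega
    · intro G _; rw [map_mul]
  · refine Finset.sum_eq_zero fun F hF => ?_
    rw [if_neg]
    intro hd
    obtain ⟨h1, h2⟩ := mem_monicDeg.mp hF
    have := natDegree_le_of_dvd hd h1.ne_zero
    omega

theorem cCoef_recurrence (lam : K[X] →* ℂ) (m : ℕ) :
    (m : ℂ) * cCoef lam m = ∑ n ∈ Finset.Icc 1 m, sCoef lam n * cCoef lam (m - n) := by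
  classical
  have h1 : (m : ℂ) * cCoef lam m = ∑ P ∈ irrLE K m, ∑ k ∈ Finset.Icc 1 m,
      if k * P.natDegree ≤ m then
        (P.natDegree : ℂ) * lam P ^ k * cCoef lam (m - k * P.natDegree) else 0 := by
    have : (m : ℂ) * cCoef lam m = ∑ F ∈ monicDeg K m, ∑ P ∈ irrLE K m, ∑ k ∈ Finset.Icc 1 m,
        (P.natDegree : ℂ) * (if P ^ k ∣ F then lam F else 0) := by
      rw [cCoef, Finset.mul_sum]
      refine Finset.sum_congr rfl fun F hF => ?_
      have := degree_formula hF
      have h2 : (m : ℂ) = ((∑ P ∈ irrLE K m, ∑ k ∈ Finset.Icc 1 m,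
        if P ^ k ∣ F then P.natDegree else 0 : ℕ) : ℂ) := by exact_mod_cast this
      conv_lhs => rw [h2]
      push_cast
      rw [Finset.sum_mul]
      refine Finset.sum_congr rfl fun P _ => ?_
      rw [Finset.sum_mul]
      refine Finset.sum_congr rfl fun k _ => ?_
      split_ifs <;> simp
    rw [this, Finset.sum_comm]
    refine Finset.sum_congr rfl fun P hP => ?_
    rw [Finset.sum_comm]
    refine Finset.sum_congr rfl fun k _ => ?_
    obtain ⟨hPm, hPd, hPi⟩ := mem_irrLE.mp hP
    rw [← Finset.mul_sum, sum_dvd lam m (k * P.natDegree) (P ^ k) (hPm.pow k) (natDegree_pow _ _)]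
    rw [map_pow]
    split_ifs <;> ring
  rw [h1]
  have h2 : ∀ n ∈ Finset.Icc 1 m, sCoef lam n * cCoef lam (m - n) =
      ∑ P ∈ irrLE K m, ∑ k ∈ Finset.Icc 1 m,
      if k * P.natDegree = n then (P.natDegree : ℂ) * lam P ^ k * cCoef lam (m - n) else 0 := by
    intro n hn
    rw [Finset.mem_Icc] at hn
    rw [sCoef_extend lam hn.1 hn.2, Finset.sum_mul]
    refine Finset.sum_congr rfl fun P _ => ?_
    rw [Finset.sum_mul]
    refine Finset.sum_congr rfl fun k _ => ?_
    split_ifs <;> simp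
  refine Eq.trans ?_ (Finset.sum_congr rfl h2).symm
  refine Eq.trans ?_ (Finset.sum_comm).symm
  refine Finset.sum_congr rfl fun P hP => ?_
  refine Eq.trans ?_ (Finset.sum_comm).symm
  refine Finset.sum_congr rfl fun k hk => ?_
  rw [Finset.mem_Icc] at hk
  have hpos := (mem_irrLE.mp hP).2.2.natDegree_pos
  have hkp : 1 ≤ k * P.natDegree := Nat.mul_pos (by omega) hpos
  rw [Finset.sum_ite_eq]
  simp only [Finset.mem_Icc, hkp, true_and]

theorem cCoef_zero (lam : K[X] →* ℂ) : cCoef lam 0 = 1 := by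
  have : monicDeg K 0 = {1} := by
    ext F
    rw [mem_monicDeg, Finset.mem_singleton]
    constructor
    · rintro ⟨h1, h2⟩; exact h1.natDegree_eq_zero.mp h2
    · rintro rfl; exact ⟨monic_one, natDegree_one⟩
  rw [cCoef, this, Finset.sum_singleton, map_one]

theorem cCoef_one (lam : K[X] →* ℂ) : cCoef lam 1 = ∑ x : K, lam (X - C x) := by
  classical
  rw [cCoef]
  symm
  refine Finset.sum_bij (fun x _ => X - C x) ?_ ?_ ?_ ?_
  · intro x _; exact mem_monicDeg.mpr ⟨monic_X_sub_C x, natDegree_X_sub_C x⟩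
  · intro x _ y _ h; simpa using h
  · intro F hF
    obtain ⟨h1, h2⟩ := mem_monicDeg.mp hF
    refine ⟨-F.coeff 0, Finset.mem_univ _, ?_⟩
    have := h1.eq_X_add_C h2
    rw [this]; simp
  · intro x _; rfl

end LFun

end PartA2

section PartA3
open Polynomial

section Weil1

variable {K : Type*} [Field K] [Fintype K]

/-- The multiplicative function `F ↦ χ(∏ F(b)^{e_b})`. -/
noncomputable def lamHom (χ : MulChar K ℂ) (B : Finset K) (e : K → ℕ) : K[X] →* ℂ where
  toFun F := χ (∏ b ∈ B, F.eval b ^ e b)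
  map_one' := by simp
  map_mul' F G := by
    rw [← map_mul, ← Finset.prod_mul_distrib]
    congr 1
    refine Finset.prod_congr rfl fun b _ => ?_
    rw [eval_mul, mul_pow]

theorem lamHom_apply (χ : MulChar K ℂ) (B : Finset K) (e : K → ℕ) (F : K[X]) :
    lamHom χ B e F = χ (∏ b ∈ B, F.eval b ^ e b) := rfl

theorem cCoef_vanish (χ : MulChar K ℂ) (B : Finset K) (e : K → ℕ) (b0 : K) (hb0 : b0 ∈ B)
    (a : K) (ha : a ≠ 0) (hχ : χ a ^ e b0 ≠ 1) (m : ℕ) (hm : B.card ≤ m) :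
    cCoef (lamHom χ B e) m = 0 := by
  classical
  set L : K[X] := Lagrange.basis B id b0 with hL
  have hinj : Set.InjOn (id : K → K) B := Function.injective_id.injOn
  have hL0 : L.eval b0 = 1 := Lagrange.eval_basis_self (v := id) hinj hb0
  have hL1 : ∀ b ∈ B, b ≠ b0 → L.eval b = 0 := fun b hb hne =>
    Lagrange.eval_basis_of_ne (v := id) hne.symm hb
  have hBpos : 0 < B.card := Finset.card_pos.mpr ⟨b0, hb0⟩
  have hLd : L.degree < m := by
    rw [hL, Lagrange.degree_basis hinj hb0]
    exact_mod_cast (by omega : B.card - 1 < m)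
  have hmem : ∀ (c : K) (F : K[X]), F ∈ monicDeg K m → F + C c * L ∈ monicDeg K m := by
    intro c F hF
    obtain ⟨h1, h2⟩ := mem_monicDeg.mp hF
    have hdF : F.degree = m := by rw [degree_eq_natDegree h1.ne_zero, h2]
    have hlt : (C c * L).degree < F.degree := by
      rw [hdF]
      refine lt_of_le_of_lt ?_ hLd
      by_cases hc : c = 0
      · simp [hc]
      · rw [degree_C_mul hc]
    refine mem_monicDeg.mpr ⟨h1.add_of_left hlt, ?_⟩
    rw [natDegree_add_eq_left_of_degree_lt hlt, h2]
  have key : cCoef (lamHom χ B e) m = χ a ^ e b0 * cCoef (lamHom χ B e) m := by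
    conv_rhs => rw [cCoef, Finset.mul_sum]
    rw [cCoef]
    symm
    refine Finset.sum_bij' (fun F _ => F + C ((a - 1) * F.eval b0) * L)
      (fun F _ => F + C ((a⁻¹ - 1) * F.eval b0) * L) ?_ ?_ ?_ ?_ ?_
    · intro F hF; exact hmem _ F hF
    · intro F hF; exact hmem _ F hF
    · intro F _
      simp only [eval_add, eval_mul, eval_C, hL0]
      rw [add_assoc, ← add_mul, ← C_add]
      have : (a - 1) * eval b0 F + (a⁻¹ - 1) * (eval b0 F + (a - 1) * eval b0 F * 1) = 0 := by
        field_simp; ring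
      rw [this]; simp
    · intro F _
      simp only [eval_add, eval_mul, eval_C, hL0]
      rw [add_assoc, ← add_mul, ← C_add]
      have : (a⁻¹ - 1) * eval b0 F + (a - 1) * (eval b0 F + (a⁻¹ - 1) * eval b0 F * 1) = 0 := by
        field_simp; ring
      rw [this]; simp
    · intro F _
      rw [lamHom_apply, lamHom_apply, ← map_pow, ← map_mul]
      congr 1
      rw [← Finset.mul_prod_erase B _ hb0, ← Finset.mul_prod_erase B (fun b => _ ^ e b) hb0]
      rw [← mul_assoc]
      congr 1
      · rw [← mul_pow]; congr 1
        simp only [eval_add, eval_mul, eval_C, hL0]; ring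
      · refine Finset.prod_congr rfl fun b hb => ?_
        rw [Finset.mem_erase] at hb
        simp only [eval_add, eval_mul, eval_C, hL1 b hb.2 hb.1]
        simp
  have : (1 - χ a ^ e b0) * cCoef (lamHom χ B e) m = 0 := by
    rw [sub_mul, ← key]; ring
  rcases mul_eq_zero.mp this with h | h
  · exact absurd (sub_eq_zero.mp h).symm hχ
  · exact h

variable {E : Type*} [Field E] [Fintype E] [Algebra K E]

open IntermediateField in
theorem norm_sub_algebraMap (x : E) (b : K) (hn : Even (Module.finrank K E)) :
    Algebra.norm K (x - algebraMap K E b) =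
      ((minpoly K x).eval b) ^ (Module.finrank K E / (minpoly K x).natDegree) := by
  have hfin : FiniteDimensional K E := Module.Finite.of_finite
  set y := x - algebraMap K E b with hy
  have hyi : IsIntegral K y := Algebra.IsIntegral.isIntegral y
  have h1 := Algebra.norm_eq_norm_adjoin K y
  have h2 : Algebra.norm K (AdjoinSimple.gen K y) =
      (-1) ^ (minpoly K y).natDegree * (minpoly K y).coeff 0 := by
    have := Algebra.PowerBasis.norm_gen_eq_coeff_zero_minpoly (adjoin.powerBasis hyi)
    rw [adjoin.powerBasis_gen, adjoin.powerBasis_dim, minpoly_gen] at this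
    exact this
  have h3 : minpoly K y = (minpoly K x).comp (X + C b) := minpoly.sub_algebraMap x b
  have hdeg : (minpoly K y).natDegree = (minpoly K x).natDegree := by
    rw [h3, natDegree_comp, natDegree_X_add_C, mul_one]
  have hmul : (minpoly K y).natDegree * Module.finrank K⟮y⟯ E = Module.finrank K E := by
    rw [← adjoin.finrank hyi, Module.finrank_mul_finrank]
  have hpos : 0 < (minpoly K y).natDegree := minpoly.natDegree_pos hyi
  have hq : Module.finrank K⟮y⟯ E = Module.finrank K E / (minpoly K x).natDegree := by
    rw [← hdeg, ← hmul, Nat.mul_div_cancel_left _ hpos]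
  rw [h1, h2, mul_pow, ← pow_mul, hmul, hn.neg_one_pow, one_mul, hq]
  congr 1
  rw [h3, coeff_zero_eq_eval_zero, eval_comp]; simp

theorem card_minpoly_fiber [DecidableEq E] (P : K[X]) (hP : P.Monic) (hPi : Irreducible P)
    (hd : P.natDegree ∣ Module.finrank K E) :
    letI := Classical.decEq K[X]
    (Finset.univ.filter (fun x : E => minpoly K x = P)).card = P.natDegree := by
  classical
  have hfin : FiniteDimensional K E := Module.Finite.of_finite
  have hcard : Fintype.card E = Nat.card K ^ Module.finrank K E := by
    rw [Module.card_eq_pow_finrank (K := K) (V := E), Nat.card_eq_fintype_card]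
  have hdvd := (hPi.natDegree_dvd_iff_dvd_X_pow_card_pow_sub_X).mp hd
  have hsplit : Splits (P.map (algebraMap K E)) := by
    have h2 : Splits ((X ^ Fintype.card E - X : K[X]).map (algebraMap K E)) :=
      (FiniteField.isSplittingField_sub E K).splits
    refine h2.of_dvd ?_ ?_
    · rw [Polynomial.map_sub, Polynomial.map_pow, map_X]
      exact FiniteField.X_pow_card_sub_X_ne_zero E Fintype.one_lt_card
    · rw [hcard]; exact Polynomial.map_dvd _ hdvd
  have hsep : P.Separable := PerfectField.separable_of_irreducible hPi
  rw [← card_rootSet_eq_natDegree hsep hsplit, Fintype.card_subtype]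
  congr 1
  ext x
  simp only [Finset.mem_filter, Finset.mem_univ, true_and]
  rw [mem_rootSet]
  constructor
  · rintro rfl; exact ⟨hP.ne_zero, minpoly.aeval K x⟩
  · rintro ⟨_, h⟩; exact (minpoly.eq_of_irreducible_of_monic hPi h hP).symm

theorem sCoef_eq_sum (lam : K[X] →* ℂ) (hn : 0 < Module.finrank K E) :
    sCoef lam (Module.finrank K E) =
      ∑ x : E, lam (minpoly K x) ^ (Module.finrank K E / (minpoly K x).natDegree) := by
  classical
  have hfin : FiniteDimensional K E := Module.Finite.of_finite
  set n := Module.finrank K E with hn'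
  have hmap : ∀ x ∈ (Finset.univ : Finset E), minpoly K x ∈ irrLE K n := by
    intro x _
    have hx : IsIntegral K x := Algebra.IsIntegral.isIntegral x
    exact mem_irrLE.mpr ⟨minpoly.monic hx, minpoly.natDegree_le x, minpoly.irreducible hx⟩
  rw [← Finset.sum_fiberwise_of_maps_to hmap, sCoef]
  refine Finset.sum_congr rfl fun P hP => ?_
  obtain ⟨hPm, hPd, hPi⟩ := mem_irrLE.mp hP
  have hpos := hPi.natDegree_pos
  have hs : ∑ x ∈ Finset.univ.filter (fun x : E => minpoly K x = P),
      lam (minpoly K x) ^ (n / (minpoly K x).natDegree) =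
      ((Finset.univ.filter (fun x : E => minpoly K x = P)).card : ℂ) *
        lam P ^ (n / P.natDegree) := by
    rw [Finset.sum_congr rfl (g := fun _ => lam P ^ (n / P.natDegree))]
    · rw [Finset.sum_const, nsmul_eq_mul]
    · intro x hx
      rw [(Finset.mem_filter.mp hx).2]
  rw [hs]
  by_cases hd : P.natDegree ∣ n
  · have hc := card_minpoly_fiber (E := E) P hPm hPi hd
    obtain ⟨j, hj⟩ := hd
    have hjpos : 0 < j := by
      rcases Nat.eq_zero_or_pos j with h | h
      · rw [h] at hj; omega
      · exact h
    rw [Finset.sum_eq_single j]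
    · rw [if_pos (by rw [hj]; ring), hj, Nat.mul_div_cancel_left _ hpos]
      congr 2
      rw [← hc]
      congr!
    · intro k _ hk
      rw [if_neg]
      intro h
      apply hk
      rw [hj, mul_comm] at h
      exact Nat.eq_of_mul_eq_mul_left hpos h
    · intro h
      exfalso; apply h
      rw [Finset.mem_Icc]
      exact ⟨hjpos, by rw [hj]; exact Nat.le_mul_of_pos_left _ hpos⟩
  · have he : Finset.univ.filter (fun x : E => minpoly K x = P) = ∅ := by
      rw [Finset.filter_eq_empty_iff]
      intro x _ hx
      apply hd
      rw [← hx]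
      exact minpoly.degree_dvd (Algebra.IsIntegral.isIntegral x)
    rw [he]
    simp only [Finset.card_empty, Nat.cast_zero, zero_mul]
    refine Finset.sum_eq_zero fun k _ => ?_
    rw [if_neg]
    intro h
    exact hd ⟨k, by rw [← h]; ring⟩

theorem sCoef_lamHom (χ : MulChar K ℂ) (B : Finset K) (e : K → ℕ)
    (hn : 0 < Module.finrank K E) (hn2 : Even (Module.finrank K E)) :
    sCoef (lamHom χ B e) (Module.finrank K E) =
      ∑ x : E, χ (Algebra.norm K (∏ b ∈ B, (x - algebraMap K E b) ^ e b)) := by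
  rw [sCoef_eq_sum (E := E) _ hn]
  refine Finset.sum_congr rfl fun x _ => ?_
  rw [lamHom_apply, ← map_pow]
  congr 1
  rw [map_prod, ← Finset.prod_pow]
  refine Finset.prod_congr rfl fun b _ => ?_
  rw [map_pow, norm_sub_algebraMap x b hn2, ← pow_mul, ← pow_mul, mul_comm]

end Weil1

end PartA3

section PartA4
open Polynomial

section Weil2

theorem cubic_char_indicator (p : ℕ) [Fact p.Prime] (χ : MulChar (ZMod p) ℂ)
    (hχ : orderOf χ = 3) :
    3 ∣ p - 1 ∧ ∃ (ν : ℂ) (θ : ZMod p), θ ≠ 0 ∧ 1 + ν + ν ^ 2 = 0 ∧ ‖ν‖ = 1 ∧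
      (∀ y : ZMod p, χ y = ∑ i ∈ Finset.range 3, if y ^ ((p - 1) / 3) = θ ^ i then ν ^ i else 0) ∧
      (∀ y : ZMod p, y ≠ 0 →
        (∑ i ∈ Finset.range 3, if y ^ ((p - 1) / 3) = θ ^ i then 1 else 0) = 1) := by
  classical
  have h3 : 3 ∣ p - 1 := by
    have := MulChar.orderOf_dvd_card_sub_one (F := ZMod p) χ
    rw [hχ, ZMod.card] at this
    exact this
  refine ⟨h3, ?_⟩
  obtain ⟨ζ, hζ⟩ := IsCyclic.exists_generator (α := (ZMod p)ˣ)
  have hord : orderOf ζ = p - 1 := by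
    rw [orderOf_eq_card_of_forall_mem_zpowers hζ, Nat.card_eq_fintype_card, ZMod.card_units]
  have hp1 : 0 < p - 1 := by
    have := (Fact.out : p.Prime).two_le; omega
  obtain ⟨t, ht⟩ := h3
  have ht' : (p - 1) / 3 = t := by omega
  have htpos : 0 < t := by omega
  have hθord : orderOf (ζ ^ t) = 3 := by
    rw [orderOf_pow, hord, ht]
    rw [Nat.gcd_eq_right (Dvd.intro_left 3 rfl)]
    exact Nat.mul_div_cancel _ htpos
  have hpowj : ∀ y : ZMod p, y ≠ 0 → ∃ j : ℕ, y = ((ζ ^ j : (ZMod p)ˣ) : ZMod p) := by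
    intro y hy
    have := hζ (Units.mk0 y hy)
    rw [← mem_powers_iff_mem_zpowers] at this
    obtain ⟨j, hj⟩ := this
    refine ⟨j, ?_⟩
    have hj' : ζ ^ j = Units.mk0 y hy := hj
    rw [hj']; rfl
  set ν : ℂ := χ (ζ : ZMod p) with hν
  have hν3 : ν ^ 3 = 1 := by
    have h := pow_orderOf_eq_one χ
    rw [hχ] at h
    have h2 : (χ ^ 3) (ζ : ZMod p) = 1 := by rw [h]; exact MulChar.one_apply_coe ζ
    rw [MulChar.pow_apply_coe] at h2
    exact h2
  have hν1 : ν ≠ 1 := by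
    intro h
    have : χ = 1 := by
      ext y
      obtain ⟨j, hj⟩ := hpowj y y.ne_zero
      rw [hj, MulChar.one_apply_coe, Units.val_pow_eq_pow_val, map_pow, ← hν, h, one_pow]
    rw [this, orderOf_one] at hχ
    omega
  have hcond : ∀ (j i : ℕ), i < 3 →
      (((ζ ^ j : (ZMod p)ˣ) : ZMod p) ^ ((p - 1) / 3) = ((ζ ^ t : (ZMod p)ˣ) : ZMod p) ^ i ↔
        i = j % 3) := by
    intro j i hi
    rw [ht', ← Units.val_pow_eq_pow_val, ← Units.val_pow_eq_pow_val, Units.val_inj,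
      ← pow_mul, mul_comm j t, pow_mul, pow_eq_pow_iff_modEq, hθord, Nat.ModEq]
    omega
  refine ⟨ν, ((ζ ^ t : (ZMod p)ˣ) : ZMod p), Units.ne_zero _, ?_, ?_, ?_, ?_⟩
  · have : (ν - 1) * (1 + ν + ν ^ 2) = 0 := by linear_combination hν3
    rcases mul_eq_zero.mp this with h | h
    · exact absurd (sub_eq_zero.mp h) hν1
    · exact h
  · have h := congrArg norm hν3
    rw [norm_pow, norm_one] at h
    exact (pow_eq_one_iff_of_nonneg (norm_nonneg _) (by norm_num)).mp h
  · intro y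
    by_cases hy : y = 0
    · rw [hy, MulChar.map_zero]
      symm
      refine Finset.sum_eq_zero fun i _ => ?_
      rw [if_neg]
      rw [zero_pow (by omega)]
      exact (pow_ne_zero _ (Units.ne_zero _)).symm
    · obtain ⟨j, rfl⟩ := hpowj y hy
      have : χ ((ζ ^ j : (ZMod p)ˣ) : ZMod p) = ν ^ (j % 3) := by
        rw [Units.val_pow_eq_pow_val, map_pow, ← hν]
        conv_lhs => rw [← Nat.div_add_mod j 3, pow_add, pow_mul, hν3, one_pow, one_mul]
      rw [this]
      rw [Finset.sum_eq_single (j % 3)]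
      · rw [if_pos ((hcond j (j % 3) (Nat.mod_lt _ (by norm_num))).mpr rfl)]
      · intro i hi hne
        rw [if_neg]
        intro h
        exact hne ((hcond j i (Finset.mem_range.mp hi)).mp h)
      · intro h; exact absurd (Finset.mem_range.mpr (Nat.mod_lt _ (by norm_num))) h
  · intro y hy
    obtain ⟨j, rfl⟩ := hpowj y hy
    rw [Finset.sum_eq_single (j % 3)]
    · rw [if_pos ((hcond j (j % 3) (Nat.mod_lt _ (by norm_num))).mpr rfl)]
    · intro i hi hne
      rw [if_neg]
      intro h
      exact hne ((hcond j i (Finset.mem_range.mp hi)).mp h)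
    · intro h; exact absurd (Finset.mem_range.mpr (Nat.mod_lt _ (by norm_num))) h

theorem three_class_bound (ν : ℂ) (hν : 1 + ν + ν ^ 2 = 0) (hn : ‖ν‖ = 1) (N : ℕ → ℝ) (M : ℝ)
    (hM : ∀ i ∈ Finset.range 3, N i ≤ M) :
    ‖∑ i ∈ Finset.range 3, ν ^ i * (N i : ℂ)‖ ≤ 3 * M - ∑ i ∈ Finset.range 3, N i := by
  have h1 : ∑ i ∈ Finset.range 3, ν ^ i * (N i : ℂ) =
      ∑ i ∈ Finset.range 3, ν ^ i * ((N i - M : ℝ) : ℂ) := by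
    simp only [Finset.sum_range_succ, Finset.sum_range_zero]
    push_cast
    linear_combination (M : ℂ) * hν
  rw [h1]
  refine (norm_sum_le _ _).trans ?_
  have h2 : ∀ i ∈ Finset.range 3, ‖ν ^ i * ((N i - M : ℝ) : ℂ)‖ = M - N i := by
    intro i hi
    rw [norm_mul, norm_pow, hn, one_pow, one_mul, Complex.norm_real, Real.norm_eq_abs,
      abs_of_nonpos (by linarith [hM i hi])]
    ring
  rw [Finset.sum_congr rfl h2, Finset.sum_sub_distrib]
  simp

theorem sCoef_bound (p : ℕ) [Fact p.Prime] (χ : MulChar (ZMod p) ℂ) (hχ : orderOf χ = 3)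
    (B : Finset (ZMod p)) (hB : 0 ∈ B) (e : ZMod p → ℕ) (he : e 0 = 1 ∨ e 0 = 2)
    (a : ℕ) (ha : 0 < a) :
    ‖sCoef (lamHom χ B e) (2 * a)‖ ≤ (5 * (∑ b ∈ B, e b : ℕ) + 10) * (p : ℝ) ^ a := by
  classical
  obtain ⟨h3, ν, θ, hθ, hν, hνn, hχ1, hχ2⟩ := cubic_char_indicator p χ hχ
  let E := GaloisField p (2 * a)
  letI : Fintype E := Fintype.ofFinite E
  have hfr : Module.finrank (ZMod p) E = 2 * a := GaloisField.finrank p (by omega)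
  have hcard : Fintype.card E = p ^ (2 * a) := by
    rw [← Nat.card_eq_fintype_card]; exact GaloisField.card p (2 * a) (by omega)
  have hpp : p.Prime := Fact.out
  obtain ⟨t, ht⟩ := h3
  have hp : p = 3 * t + 1 := by have := hpp.two_le; omega
  obtain ⟨k, hk⟩ : ∃ k, p ^ a = 3 * k + 1 := by
    have : p ^ a ≡ 1 [MOD 3] := by
      have h1 : p ≡ 1 [MOD 3] := by rw [hp]; unfold Nat.ModEq; omega
      simpa using h1.pow a
    have h2 : p ^ a % 3 = 1 := this
    exact ⟨p ^ a / 3, by omega⟩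
  have hQ : Fintype.card E = (3 * k + 1) ^ 2 := by rw [hcard, ← hk, ← pow_mul, mul_comm]
  set d := ∑ b ∈ B, e b with hd
  set g : E → E := fun x => ∏ b ∈ B, (x - algebraMap (ZMod p) E b) ^ e b with hg
  have hS := sCoef_lamHom (E := E) χ B e (by omega) (by rw [hfr]; exact even_two_mul a)
  rw [hfr] at hS
  rw [hS]
  by_cases hk4 : 4 ≤ k
  swap
  · have h1 : ‖∑ x : E, χ (Algebra.norm (ZMod p) (g x))‖ ≤ ∑ x : E, (1 : ℝ) := by
      refine (norm_sum_le _ _).trans (Finset.sum_le_sum fun x _ => ?_)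
      by_cases h0 : Algebra.norm (ZMod p) (g x) = 0
      · rw [h0, MulChar.map_zero]; simp
      · rw [← Units.val_mk0 h0]
        refine le_of_eq ?_
        have hc3 : (χ (Units.mk0 _ h0 : (ZMod p)ˣ)) ^ 3 = (1 : ℂ) := by
          have h := pow_orderOf_eq_one χ
          rw [hχ] at h
          rw [← MulChar.pow_apply_coe, h]; exact MulChar.one_apply_coe _
        have h := congrArg norm hc3
        rw [norm_pow, norm_one] at h
        exact (pow_eq_one_iff_of_nonneg (norm_nonneg _) (by norm_num)).mp h
    refine h1.trans ?_
    rw [Finset.sum_const, nsmul_eq_mul, mul_one, Finset.card_univ, hQ]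
    have h2 : (p : ℝ) ^ a = 3 * k + 1 := by exact_mod_cast hk
    rw [h2]
    have h3 : (k : ℝ) ≤ 3 := by exact_mod_cast (by omega : k ≤ 3)
    have h4 : (0 : ℝ) ≤ k := by positivity
    have h5 : (0 : ℝ) ≤ (d : ℝ) := by positivity
    push_cast
    nlinarith [mul_nonneg h5 h4]
  -- the polynomial
  set g1 : E[X] := ∏ b ∈ B.erase 0, (X - C (algebraMap (ZMod p) E b)) ^ e b with hg1
  have hgeval : ∀ x : E, (X ^ e 0 * g1).eval x = g x := by
    intro x
    rw [hg, hg1]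
    simp only []
    rw [← Finset.mul_prod_erase B _ hB]
    simp [eval_prod]
  have hg1c : g1.coeff 0 ≠ 0 := by
    rw [coeff_zero_eq_eval_zero, hg1, eval_prod]
    refine Finset.prod_ne_zero_iff.mpr fun b hb => ?_
    rw [Finset.mem_erase] at hb
    simp only [eval_pow, eval_sub, eval_X, eval_C, zero_sub]
    refine pow_ne_zero _ (neg_ne_zero.mpr ?_)
    intro h
    exact hb.1 ((map_eq_zero _).mp h)
  have hmon1 : g1.Monic := monic_prod_of_monic _ _ fun b _ => (monic_X_sub_C _).pow _
  have hdeg : (X ^ e 0 * g1).natDegree = d := by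
    rw [(monic_X_pow _).natDegree_mul hmon1, natDegree_X_pow, hg1, natDegree_prod_of_monic _ _
      (fun b _ => (monic_X_sub_C _).pow _), hd, ← Finset.add_sum_erase B _ hB]
    congr 1
    refine Finset.sum_congr rfl fun b _ => ?_
    rw [natDegree_pow, natDegree_X_sub_C, mul_one]
  set N : ℕ → ℕ := fun i => (Finset.univ.filter (fun x : E =>
    (Algebra.norm (ZMod p) (g x)) ^ ((p - 1) / 3) = θ ^ i)).card with hN
  set Z : ℕ := (Finset.univ.filter (fun x : E => g x = 0)).card with hZ
  have hsum : ∑ x : E, χ (Algebra.norm (ZMod p) (g x)) =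
      ∑ i ∈ Finset.range 3, ν ^ i * ((N i : ℝ) : ℂ) := by
    rw [Finset.sum_congr rfl (fun x _ => hχ1 (Algebra.norm (ZMod p) (g x))), Finset.sum_comm]
    refine Finset.sum_congr rfl fun i _ => ?_
    rw [← Finset.sum_filter, Finset.sum_const, nsmul_eq_mul, mul_comm, hN]
    push_cast; rfl
  have hnz : ∀ x : E, g x ≠ 0 → Algebra.norm (ZMod p) (g x) ≠ 0 := by
    intro x hx
    exact Algebra.norm_ne_zero_iff.mpr hx
  have htot : (3 * k + 1) ^ 2 ≤ ∑ i ∈ Finset.range 3, N i + Z := by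
    rw [← hQ, ← Finset.card_univ]
    have h1 : ∑ i ∈ Finset.range 3, N i = ∑ x : E, ∑ i ∈ Finset.range 3,
        if (Algebra.norm (ZMod p) (g x)) ^ ((p - 1) / 3) = θ ^ i then 1 else 0 := by
      rw [Finset.sum_comm]
      refine Finset.sum_congr rfl fun i _ => ?_
      rw [hN]; simp only []
      rw [Finset.card_filter]
    rw [h1, hZ, Finset.card_filter, ← Finset.sum_add_distrib, Finset.card_eq_sum_ones]
    refine Finset.sum_le_sum fun x _ => ?_
    by_cases hx : g x = 0
    · rw [if_pos hx]; omega
    · rw [if_neg hx, hχ2 _ (hnz x hx)]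
  have hZd : Z ≤ d := by
    have hne : (X ^ e 0 * g1) ≠ 0 := ((monic_X_pow _).mul hmon1).ne_zero
    calc Z ≤ (X ^ e 0 * g1).roots.toFinset.card := by
          refine Finset.card_le_card ?_
          intro x hx
          rw [Multiset.mem_toFinset, mem_roots hne, IsRoot, hgeval]
          exact (Finset.mem_filter.mp hx).2
      _ ≤ (X ^ e 0 * g1).roots.card := Multiset.toFinset_card_le _
      _ ≤ (X ^ e 0 * g1).natDegree := card_roots' _
      _ = d := hdeg
  have hexp : (Nat.card E - 1) / (Nat.card (ZMod p) - 1) * ((p - 1) / 3) = k * (3 * k + 2) := by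
    rw [Nat.card_eq_fintype_card, Nat.card_eq_fintype_card, ZMod.card, hQ]
    have h1 : p - 1 ∣ (3 * k + 1) ^ 2 - 1 := by
      rw [← hk, ← pow_mul]
      simpa using Nat.sub_dvd_pow_sub_pow p 1 (a * 2)
    obtain ⟨w, hw⟩ := h1
    have hp1 : 0 < p - 1 := by have := hpp.two_le; omega
    rw [hw, Nat.mul_div_cancel_left _ hp1, ht, Nat.mul_div_cancel_left _ (by norm_num)]
    have h2 : (3 * k + 1) ^ 2 - 1 = 3 * (k * (3 * k + 2)) := by
      have : (3 * k + 1) ^ 2 = 3 * (k * (3 * k + 2)) + 1 := by ring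
      omega
    rw [ht, h2] at hw
    have h3 : 3 * (k * (3 * k + 2)) = 3 * (w * t) := by rw [hw]; ring
    omega
  have hNi : ∀ i ∈ Finset.range 3, N i ≤ 2 * k * d + (k + d) * (3 * k + 1) + k := by
    intro i _
    have hc : (algebraMap (ZMod p) E (θ ^ i)) ≠ 0 := by
      rw [Ne, map_eq_zero]; exact pow_ne_zero _ hθ
    have := stepanov_count (E := E) p a k hk hQ hk4 (e 0) he g1 hg1c _ hc d hdeg
    refine le_trans (le_of_eq ?_) this
    rw [hN]
    refine congrArg Finset.card ?_
    ext x
    simp only [Finset.mem_filter, Finset.mem_univ, true_and]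
    rw [hgeval, ← hexp, pow_mul, ← FiniteField.algebraMap_norm_eq_pow (K := ZMod p),
      ← map_pow (algebraMap (ZMod p) E)]
    exact (algebraMap (ZMod p) E).injective.eq_iff.symm
  have hbd := three_class_bound ν hν hνn (fun i => (N i : ℝ))
    ((2 * k * d + (k + d) * (3 * k + 1) + k : ℕ) : ℝ) (fun i hi => by exact_mod_cast hNi i hi)
  rw [← hsum] at hbd
  refine hbd.trans ?_
  have hpa : (p : ℝ) ^ a = 3 * k + 1 := by exact_mod_cast hk
  have htot' : (3 * k + 1 : ℝ) ^ 2 ≤ ∑ i ∈ Finset.range 3, (N i : ℝ) + d := by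
    have : (3 * k + 1) ^ 2 ≤ ∑ i ∈ Finset.range 3, N i + d := htot.trans (by omega)
    exact_mod_cast this
  rw [hpa]
  push_cast
  have h4 : (0 : ℝ) ≤ k := by positivity
  nlinarith

end Weil2

end PartA4

section PartA5
open Polynomial

section Weil3

theorem ps_newton (A : Multiset ℂ) :
    PowerSeries.X * PowerSeries.derivative ℂ
        (A.map (fun α => (1 - PowerSeries.C α * PowerSeries.X : PowerSeries ℂ))).prod =
      (A.map (fun α => (1 - PowerSeries.C α * PowerSeries.X : PowerSeries ℂ))).prod *
        (A.map (fun α => (PowerSeries.mk (fun n => if n = 0 then 0 else -α ^ n) :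
          PowerSeries ℂ))).sum := by
  induction A using Multiset.induction_on with
  | empty => simp
  | cons α A ih =>
    simp only [Multiset.map_cons, Multiset.prod_cons, Multiset.sum_cons]
    set P := (A.map (fun α => (1 - PowerSeries.C α * PowerSeries.X : PowerSeries ℂ))).prod
    set S := (A.map (fun α => (PowerSeries.mk (fun n => if n = 0 then 0 else -α ^ n) :
          PowerSeries ℂ))).sum
    have h1 : (1 - PowerSeries.C α * PowerSeries.X : PowerSeries ℂ) *
        PowerSeries.mk (fun n => if n = 0 then 0 else -α ^ n) =
        - (PowerSeries.C α * PowerSeries.X) := by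
      ext n
      rw [sub_mul, one_mul, mul_assoc, map_sub, PowerSeries.coeff_C_mul, map_neg,
        PowerSeries.coeff_C_mul]
      rcases n with _ | n
      · simp
      · rw [PowerSeries.coeff_succ_X_mul, PowerSeries.coeff_mk, PowerSeries.coeff_mk,
          PowerSeries.coeff_X]
        rcases n with _ | n
        · simp
        · simp [pow_succ]; ring
    have h2 : PowerSeries.derivative ℂ (1 - PowerSeries.C α * PowerSeries.X : PowerSeries ℂ) =
        - PowerSeries.C α := by
      rw [map_sub, Derivation.leibniz]
      simp
    rw [Derivation.leibniz, smul_eq_mul, smul_eq_mul, h2]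
    linear_combination (1 - PowerSeries.C α * PowerSeries.X) * ih - P * h1

theorem multiset_sum_finset_comm (A : Multiset ℂ) (t : Finset ℕ) (F : ℕ → ℂ → ℂ) :
    (A.map (fun β => ∑ k ∈ t, F k β)).sum = ∑ k ∈ t, (A.map (F k)).sum := by
  induction A using Multiset.induction_on with
  | empty => simp
  | cons a A ih => simp [ih, Finset.sum_add_distrib]

theorem multiset_sum_ite (A : Multiset ℂ) (P : ℂ → Prop) [DecidablePred P] (c : ℂ) :
    (A.map (fun β => if P β then c else 0)).sum = ((A.filter P).card : ℂ) * c := by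
  induction A using Multiset.induction_on with
  | empty => simp
  | cons a A ih =>
    by_cases h : P a
    · simp [ih, h]; ring
    · simp [ih, h]

theorem roots_bound (A : Multiset ℂ) (q Cst : ℝ) (hq : 0 < q)
    (hs : ∀ a : ℕ, 0 < a → ‖(A.map (fun α => α ^ (2 * a))).sum‖ ≤ Cst * q ^ a) :
    ∀ α ∈ A, ‖α‖ ≤ Real.sqrt q := by
  classical
  intro α hα
  set G : Finset ℂ := (A.map (fun α => α ^ 2)).toFinset with hG
  obtain ⟨γ, hγ⟩ : ∃ γ : ℂ, γ = α ^ 2 := ⟨_, rfl⟩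
  have hγG : γ ∈ G := by
    rw [hG, Multiset.mem_toFinset, hγ]; exact Multiset.mem_map_of_mem (fun α => α ^ 2) hα
  set T : ℂ[X] := Lagrange.basis G id γ with hT
  have hT1 : T.eval γ = 1 := Lagrange.eval_basis_self (v := id) Function.injective_id.injOn hγG
  have hT0 : ∀ b ∈ G, b ≠ γ → T.eval b = 0 := fun b hb hne =>
    Lagrange.eval_basis_of_ne (v := id) hne.symm hb
  have key : ∀ a : ℕ, 0 < a → ‖γ‖ ^ a ≤
      (∑ k ∈ Finset.range (T.natDegree + 1), ‖T.coeff k‖ * (Cst * q ^ k)) * q ^ a := by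
    intro a ha
    have h1 : (A.map (fun β => β ^ (2 * a) * T.eval (β ^ 2))).sum =
        ∑ k ∈ Finset.range (T.natDegree + 1),
          T.coeff k * (A.map (fun β => β ^ (2 * (a + k)))).sum := by
      have : ∀ β : ℂ, β ^ (2 * a) * T.eval (β ^ 2) =
          ∑ k ∈ Finset.range (T.natDegree + 1), T.coeff k * β ^ (2 * (a + k)) := by
        intro β
        rw [eval_eq_sum_range, Finset.mul_sum]
        refine Finset.sum_congr rfl fun k _ => ?_
        rw [mul_add, pow_add, pow_mul β 2 k]; ring
      rw [Multiset.map_congr rfl (fun β _ => this β), multiset_sum_finset_comm]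
      refine Finset.sum_congr rfl fun k _ => ?_
      rw [Multiset.sum_map_mul_left]
    have h2 : (A.map (fun β => β ^ (2 * a) * T.eval (β ^ 2))).sum =
        ((A.filter (fun β => β ^ 2 = γ)).card : ℂ) * γ ^ a := by
      have : ∀ β ∈ A, β ^ (2 * a) * T.eval (β ^ 2) = if β ^ 2 = γ then γ ^ a else 0 := by
        intro β hβ
        split_ifs with h
        · rw [h, hT1, pow_mul, h, mul_one]
        · rw [hT0 _ _ h, mul_zero]
          rw [hG, Multiset.mem_toFinset]; exact Multiset.mem_map_of_mem _ hβ
      rw [Multiset.map_congr rfl this]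
      exact multiset_sum_ite A (fun β => β ^ 2 = γ) _
    have hcard : 1 ≤ (A.filter (fun β => β ^ 2 = γ)).card := by
      rw [Nat.one_le_iff_ne_zero, Ne, Multiset.card_eq_zero]
      intro h0
      have : α ∈ A.filter (fun β => β ^ 2 = γ) := Multiset.mem_filter.mpr ⟨hα, hγ.symm⟩
      rw [h0] at this
      exact absurd this (Multiset.notMem_zero _)
    have h3 : ‖γ‖ ^ a ≤ ‖((A.filter (fun β => β ^ 2 = γ)).card : ℂ) * γ ^ a‖ := by
      rw [norm_mul, norm_pow, Complex.norm_natCast]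
      have : (1 : ℝ) ≤ ((A.filter (fun β => β ^ 2 = γ)).card : ℝ) := by exact_mod_cast hcard
      nlinarith [pow_nonneg (norm_nonneg γ) a]
    refine h3.trans ?_
    rw [← h2, h1, Finset.sum_mul]
    refine (norm_sum_le _ _).trans (Finset.sum_le_sum fun k _ => ?_)
    rw [norm_mul, mul_assoc, mul_assoc, ← pow_add, add_comm k a]
    exact mul_le_mul_of_nonneg_left (hs _ (by omega)) (norm_nonneg _)
  have hle : ‖γ‖ ≤ q := by
    by_contra hlt
    push Not at hlt
    have h1 : 1 < ‖γ‖ / q := by rwa [one_lt_div hq]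
    set M := (∑ k ∈ Finset.range (T.natDegree + 1), ‖T.coeff k‖ * (Cst * q ^ k))
    obtain ⟨n, hn⟩ := pow_unbounded_of_one_lt M h1
    have h2 := key (n + 1) (by omega)
    have h3 : M < (‖γ‖ / q) ^ (n + 1) :=
      lt_of_lt_of_le hn (pow_le_pow_right₀ h1.le (by omega))
    rw [div_pow, lt_div_iff₀ (by positivity)] at h3
    linarith
  apply Real.le_sqrt_of_sq_le
  rw [← norm_pow, ← hγ]; exact hle

theorem c1_bound (c s : ℕ → ℂ) (D : ℕ) (hD : 0 < D) (hc0 : c 0 = 1)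
    (hrec : ∀ m : ℕ, (m : ℂ) * c m = ∑ n ∈ Finset.Icc 1 m, s n * c (m - n))
    (hvan : ∀ m, D ≤ m → c m = 0) (q Cst : ℝ) (hq : 0 < q)
    (hs : ∀ a : ℕ, 0 < a → ‖s (2 * a)‖ ≤ Cst * q ^ a) :
    ‖c 1‖ ≤ (D - 1 : ℝ) * Real.sqrt q := by
  classical
  set R : ℂ[X] := ∑ j ∈ Finset.range D, C (c (D - 1 - j)) * X ^ j with hR
  have hRc : ∀ j, R.coeff j = if j < D then c (D - 1 - j) else 0 := by
    intro j
    rw [hR, finsetSum_coeff]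
    simp only [coeff_C_mul, coeff_X_pow, mul_ite, mul_one, mul_zero]
    rw [Finset.sum_ite_eq]
    simp only [Finset.mem_range]
  have hRd : R.natDegree = D - 1 := by
    refine natDegree_eq_of_le_of_coeff_ne_zero ?_ ?_
    · rw [natDegree_le_iff_coeff_eq_zero]
      intro N hN
      rw [hRc, if_neg (by omega)]
    · rw [hRc, if_pos (by omega), Nat.sub_self, hc0]; exact one_ne_zero
  have hRm : R.Monic := by
    rw [Monic, leadingCoeff, hRd, hRc, if_pos (by omega), Nat.sub_self, hc0]
  have hRs : R.Splits := IsAlgClosed.splits R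
  have hRp : R = (R.roots.map (fun α => X - C α)).prod := by
    have := hRs.eq_prod_roots
    rw [hRm.leadingCoeff, C_1, one_mul] at this
    exact this
  have hcardR : R.roots.card = D - 1 := by
    rw [← hRd]; exact hRs.natDegree_eq_card_roots.symm
  have hrev : ∀ A : Multiset ℂ, (A.map (fun α => X - C α)).prod.reverse =
      (A.map (fun α => 1 - C α * X)).prod := by
    intro A
    induction A using Multiset.induction_on with
    | empty =>
      simp only [Multiset.map_zero, Multiset.prod_zero]
      rw [← C_1, reverse_C]
    | cons α A ih =>
      simp only [Multiset.map_cons, Multiset.prod_cons]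
      rw [reverse_mul_of_domain, ih]
      congr 1
      ext n
      rw [coeff_reverse, natDegree_X_sub_C]
      rcases n with _ | _ | n
      · rw [revAt_le (by norm_num)]; simp
      · rw [revAt_le (by norm_num)]; simp [coeff_one]
      · rw [revAt_eq_self_of_lt (by omega)]
        simp [coeff_X, coeff_C, coeff_one]
  have hPc : ∀ m, ((R.roots.map (fun α => 1 - C α * X)).prod).coeff m = c m := by
    intro m
    rw [← hrev, ← hRp, coeff_reverse, hRd]
    by_cases hm : m ≤ D - 1
    · rw [revAt_le hm, hRc, if_pos (by omega)]
      congr 1; omega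
    · rw [revAt_eq_self_of_lt (by omega), hRc, if_neg (by omega), hvan m (by omega)]
  set A := R.roots with hA
  have hPS : PowerSeries.mk c =
      (A.map (fun α => (1 - PowerSeries.C α * PowerSeries.X : PowerSeries ℂ))).prod := by
    have h1 : (A.map (fun α => (1 - PowerSeries.C α * PowerSeries.X : PowerSeries ℂ))).prod =
        (((A.map (fun α => 1 - C α * X)).prod : ℂ[X]) : PowerSeries ℂ) := by
      rw [← Polynomial.coeToPowerSeries.ringHom_apply, map_multiset_prod, Multiset.map_map]
      congr 1
      refine Multiset.map_congr rfl fun α _ => ?_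
      simp [Polynomial.coeToPowerSeries.ringHom_apply]
    rw [h1]
    ext m
    rw [PowerSeries.coeff_mk, Polynomial.coeff_coe, hPc]
  set S : PowerSeries ℂ := PowerSeries.mk (fun n => if n = 0 then 0 else s n) with hS
  have hS1 : PowerSeries.X * PowerSeries.derivative ℂ (PowerSeries.mk c) = PowerSeries.mk c * S := by
    ext m
    rw [mul_comm (PowerSeries.mk c) S, PowerSeries.coeff_mul m S,
      Finset.Nat.sum_antidiagonal_eq_sum_range_succ
        (fun i j => (PowerSeries.coeff i) S * (PowerSeries.coeff j) (PowerSeries.mk c)),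
      Finset.sum_range_succ']
    simp only [hS, PowerSeries.coeff_mk]
    have h1 : ∑ k ∈ Finset.range m, (if k + 1 = 0 then 0 else s (k + 1)) * c (m - (k + 1)) =
        ∑ n ∈ Finset.Icc 1 m, s n * c (m - n) := by
      rw [Finset.range_eq_Ico, Finset.sum_Ico_add' (fun k => (if k = 0 then 0 else s k) *
        c (m - k)) 0 m 1]
      rw [zero_add]
      have : Finset.Ico 1 (m + 1) = Finset.Icc 1 m := by ext; simp
      rw [this]
      refine Finset.sum_congr rfl fun n hn => ?_
      rw [Finset.mem_Icc] at hn
      rw [if_neg (by omega)]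
    rw [h1, ← hrec]
    rcases m with _ | m
    · simp
    · rw [PowerSeries.coeff_succ_X_mul, PowerSeries.coeff_derivative,
        PowerSeries.coeff_mk]
      simp; ring
  have hne : PowerSeries.mk c ≠ 0 := by
    intro h
    have := congrArg (PowerSeries.coeff 0) h
    rw [PowerSeries.coeff_mk, hc0] at this
    simp at this
  have hSS : S = (A.map (fun α => (PowerSeries.mk (fun n => if n = 0 then 0 else -α ^ n) :
          PowerSeries ℂ))).sum := by
    have h2 := ps_newton A
    rw [← hPS, hS1] at h2
    exact mul_left_cancel₀ hne h2
  have hsp : ∀ n, n ≠ 0 → s n = -(A.map (fun α => α ^ n)).sum := by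
    intro n hn
    have h := congrArg (PowerSeries.coeff n) hSS
    rw [hS, PowerSeries.coeff_mk, if_neg hn, map_multiset_sum, Multiset.map_map] at h
    rw [h, ← Multiset.sum_map_neg]
    congr 1
    refine Multiset.map_congr rfl fun α _ => ?_
    simp [hn]
  have hbound := roots_bound A q Cst hq (by
    intro a ha
    have := hs a ha
    rw [hsp _ (by omega), norm_neg] at this
    exact this)
  have hc1 : c 1 = -(A.map (fun α => α ^ 1)).sum := by
    have := hrec 1
    simp [hc0] at this
    rw [this, hsp 1 (by norm_num)]
  rw [hc1, norm_neg]
  simp only [pow_one, Multiset.map_id']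
  have h5 : ‖A.sum‖ ≤ (A.map (fun α => ‖α‖)).sum := norm_multiset_sum_le A
  refine h5.trans ?_
  have h6 := Multiset.sum_le_card_nsmul (A.map (fun α => ‖α‖)) (Real.sqrt q) (by
    intro x hx
    obtain ⟨α, hα, rfl⟩ := Multiset.mem_map.mp hx
    exact hbound α hα)
  rw [Multiset.card_map, hcardR, nsmul_eq_mul, Nat.cast_sub (by omega)] at h6
  simpa using h6

/-- Weil bound for cubic characters. -/
theorem weil_zero (p : ℕ) [Fact p.Prime] (χ : MulChar (ZMod p) ℂ) (hχ : orderOf χ = 3)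
    (B : Finset (ZMod p)) (hB : 0 ∈ B) (e : ZMod p → ℕ) (he : e 0 = 1 ∨ e 0 = 2) :
    ‖∑ x : ZMod p, χ (∏ b ∈ B, (b - x) ^ e b)‖ ≤ (B.card - 1 : ℝ) * Real.sqrt p := by
  have hp : p.Prime := Fact.out
  have h1 : ∑ x : ZMod p, χ (∏ b ∈ B, (b - x) ^ e b) = cCoef (lamHom χ B e) 1 := by
    rw [cCoef_one]
    refine Finset.sum_congr rfl fun x _ => ?_
    rw [lamHom_apply]; simp
  rw [h1]
  obtain ⟨a, ha, hχa⟩ : ∃ a : ZMod p, a ≠ 0 ∧ χ a ^ e 0 ≠ 1 := by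
    by_contra hcon
    push Not at hcon
    have h2 : χ ^ (e 0) = 1 := by
      ext y
      rw [MulChar.pow_apply_coe, MulChar.one_apply_coe]
      exact hcon _ y.ne_zero
    have h3 := orderOf_dvd_of_pow_eq_one h2
    rw [hχ] at h3
    rcases he with h | h <;> rw [h] at h3 <;> omega
  exact c1_bound (fun n => cCoef (lamHom χ B e) n) (fun n => sCoef (lamHom χ B e) n) B.card
    (Finset.card_pos.mpr ⟨0, hB⟩) (cCoef_zero _) (cCoef_recurrence _)
    (fun m hm => cCoef_vanish χ B e 0 hB a ha hχa m hm) p _ (by exact_mod_cast hp.pos)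
    (fun n hn => sCoef_bound p χ hχ B hB e he n hn)

theorem weil_cubic (p : ℕ) [Fact p.Prime] (χ : MulChar (ZMod p) ℂ) (hχ : orderOf χ = 3)
    (B : Finset (ZMod p)) (b0 : ZMod p) (hB : b0 ∈ B) (e : ZMod p → ℕ)
    (he : e b0 = 1 ∨ e b0 = 2) :
    ‖∑ x : ZMod p, χ (∏ b ∈ B, (b - x) ^ e b)‖ ≤ (B.card - 1 : ℝ) * Real.sqrt p := by
  classical
  have h1 := weil_zero p χ hχ (B.image (fun b => b - b0)) (by
    rw [Finset.mem_image]; exact ⟨b0, hB, by ring⟩) (fun y => e (y + b0)) (by simpa using he)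
  have hinj : Function.Injective (fun b : ZMod p => b - b0) := sub_left_injective
  rw [Finset.card_image_of_injective _ hinj] at h1
  refine le_trans (le_of_eq ?_) h1
  congr 1
  rw [← Equiv.sum_comp (Equiv.addRight b0) (fun x => χ (∏ b ∈ B, (b - x) ^ e b))]
  refine Finset.sum_congr rfl fun x _ => ?_
  rw [Finset.prod_image (fun _ _ _ _ h => hinj h)]
  congr 1
  refine Finset.prod_congr rfl fun b _ => ?_
  simp only [Equiv.coe_addRight, sub_add_cancel]
  congr 1; ring

end Weil3

end PartA5

section PartB1
section BadCount

variable {M : Type*} [Fintype M] [DecidableEq M]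

/-- multiplicity of `m` in the tuple `a`. -/
def cntF {n : ℕ} (a : Fin n → M) (m : M) : ℕ := ∑ i, if a i = m then 1 else 0

/-- tuples with matching multiplicities mod 3. -/
def badP {r s : ℕ} (a : Fin r → M) (b : Fin s → M) : Prop := ∀ m, cntF a m % 3 = cntF b m % 3

instance {r s : ℕ} (a : Fin r → M) (b : Fin s → M) : Decidable (badP a b) := by
  unfold badP; infer_instance

/-- number of bad pairs of tuples -/
def badN (M : Type*) [Fintype M] [DecidableEq M] (r s : ℕ) : ℕ :=
  ∑ a : Fin r → M, ∑ b : Fin s → M, if badP a b then 1 else 0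

theorem badN_symm (r s : ℕ) : badN M r s = badN M s r := by
  unfold badN
  rw [Finset.sum_comm]
  refine Finset.sum_congr rfl fun b _ => Finset.sum_congr rfl fun a _ => ?_
  have : badP a b ↔ badP b a := ⟨fun h m => (h m).symm, fun h m => (h m).symm⟩
  simp only [this]

theorem cntF_succ {n : ℕ} (a : Fin (n + 1) → M) (m : M) :
    cntF a m = (if a 0 = m then 1 else 0) + cntF (fun i => a (Fin.succ i)) m := by
  unfold cntF; rw [Fin.sum_univ_succ]

theorem cntF_succAbove {n : ℕ} (a : Fin (n + 1) → M) (j : Fin (n + 1)) (m : M) :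
    cntF a m = (if a j = m then 1 else 0) + cntF (fun i => a (j.succAbove i)) m := by
  unfold cntF; rw [Fin.sum_univ_succAbove _ j]

theorem sum_removeNth {n : ℕ} (j : Fin (n + 1)) (F : (Fin (n + 1) → M) → ℕ)  :
    ∑ b : Fin (n + 1) → M, F b = ∑ x : M, ∑ b : Fin n → M, F (j.insertNth x b) := by
  rw [← (Fin.insertNthEquiv (fun _ => M) j).sum_comp, Fintype.sum_prod_type]
  rfl

theorem cntF_insertNth {n : ℕ} (j : Fin (n + 1)) (x : M) (b : Fin n → M) (m : M) :
    cntF (j.insertNth x b : Fin (n + 1) → M) m = (if x = m then 1 else 0) + cntF b m := by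
  rw [cntF_succAbove _ j]
  simp

theorem badN_zero_zero : badN M 0 0 = 1 := by
  simp [badN, badP, cntF]

theorem cntF_zero (a : Fin 0 → M) (m : M) : cntF a m = 0 := by simp [cntF]

theorem exists_of_cntF_pos {n : ℕ} (a : Fin n → M) (m : M) (h : 0 < cntF a m) : ∃ j, a j = m := by
  by_contra hcon
  push Not at hcon
  unfold cntF at h
  rw [Finset.sum_eq_zero (fun i _ => if_neg (hcon i))] at h
  omega

theorem pair_sum_ge {n : ℕ} (a : Fin (n + 2) → M) (m : M) (h : 2 ≤ cntF a m) :
    2 ≤ ∑ i1 : Fin (n + 2), ∑ i2 : Fin (n + 1),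
      if a i1 = m ∧ a (i1.succAbove i2) = m then 1 else 0 := by
  have h1 : ∀ i1 : Fin (n + 2), (if a i1 = m then 1 else 0) ≤ ∑ i2 : Fin (n + 1),
      if a i1 = m ∧ a (i1.succAbove i2) = m then 1 else 0 := by
    intro i1
    split_ifs with hi
    · have h2 := cntF_succAbove a i1 m
      rw [if_pos hi] at h2
      obtain ⟨i2, hi2⟩ := exists_of_cntF_pos (fun i => a (i1.succAbove i)) m (by omega)
      calc 1 = if a i1 = m ∧ a (i1.succAbove i2) = m then 1 else 0 := by rw [if_pos ⟨hi, hi2⟩]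
        _ ≤ _ := Finset.single_le_sum (f := fun i2 : Fin (n + 1) =>
          if a i1 = m ∧ a (i1.succAbove i2) = m then 1 else 0) (fun _ _ => Nat.zero_le _)
          (Finset.mem_univ i2)
    · exact Nat.zero_le _
  exact h.trans (Finset.sum_le_sum fun i _ => h1 i)

theorem pair_sum_ge' {n : ℕ} (a : Fin n → M) (m : M) (h : 2 ≤ cntF a m) : ∃ k, n = k + 2 := by
  have : cntF a m ≤ n := by
    unfold cntF
    calc _ ≤ ∑ i : Fin n, 1 := Finset.sum_le_sum fun i _ => by split_ifs <;> omega
      _ = n := by simp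
  exact ⟨n - 2, by omega⟩

/-- contribution where `b_j = a_0`. -/
theorem bad_match (r s : ℕ) (j : Fin (s + 1)) :
    ∑ a : Fin (r + 1) → M, ∑ b : Fin (s + 1) → M, (if badP a b ∧ b j = a 0 then 1 else 0) =
      Fintype.card M * badN M r s := by
  have h1 : ∀ a : Fin (r + 1) → M,
      ∑ b : Fin (s + 1) → M, (if badP a b ∧ b j = a 0 then 1 else 0) =
      ∑ b : Fin s → M, if badP (fun i => a (Fin.succ i)) b then 1 else 0 := by
    intro a
    rw [sum_removeNth j]
    rw [Finset.sum_eq_single (a 0)]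
    · refine Finset.sum_congr rfl fun b _ => ?_
      have : (badP a (j.insertNth (a 0) b : Fin (s + 1) → M) ∧
          (j.insertNth (a 0) b : Fin (s + 1) → M) j = a 0) ↔
          badP (fun i => a (Fin.succ i)) b := by
        simp only [Fin.insertNth_apply_same, and_true]
        refine forall_congr' fun m => ?_
        rw [cntF_insertNth, cntF_succ]
        omega
      simp only [this]
    · intro x _ hx
      refine Finset.sum_eq_zero fun b _ => ?_
      rw [if_neg]
      rintro ⟨_, h⟩
      rw [Fin.insertNth_apply_same] at h
      exact hx h
    · intro h; exact absurd (Finset.mem_univ _) h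
  rw [Finset.sum_congr rfl (fun a _ => h1 a)]
  rw [sum_removeNth 0 (fun a => ∑ b : Fin s → M, if badP (fun i => a (Fin.succ i)) b then 1 else 0)]
  rw [badN]
  rw [Finset.sum_congr rfl (g := fun _ => ∑ a : Fin r → M, ∑ b : Fin s → M,
    if badP a b then 1 else 0)]
  · rw [Finset.sum_const, smul_eq_mul, Finset.card_univ]
  · intro x _
    refine Finset.sum_congr rfl fun a _ => ?_
    have : (fun i => (Fin.insertNth 0 x a : Fin (r + 1) → M) (Fin.succ i)) = a := by
      funext i; simp
    rw [this]

theorem bad_triple (n s : ℕ) (i1 : Fin (n + 2)) (i2 : Fin (n + 1)) :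
    ∑ a : Fin (n + 3) → M, ∑ b : Fin s → M,
      (if badP a b ∧ a (Fin.succ i1) = a 0 ∧ a (Fin.succ (i1.succAbove i2)) = a 0
        then 1 else 0) =
      Fintype.card M * badN M n s := by
  rw [sum_removeNth 0]
  rw [badN]
  rw [Finset.sum_congr rfl (g := fun _ => ∑ a : Fin n → M, ∑ b : Fin s → M,
    if badP a b then 1 else 0)]
  · rw [Finset.sum_const, smul_eq_mul, Finset.card_univ]
  intro x _
  rw [sum_removeNth i1, Finset.sum_eq_single x]
  · rw [sum_removeNth i2, Finset.sum_eq_single x]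
    · refine Finset.sum_congr rfl fun a _ => Finset.sum_congr rfl fun b _ => ?_
      congr 1
      simp only [Fin.insertNth_zero', Fin.cons_succ, Fin.cons_zero, Fin.insertNth_apply_same,
        Fin.insertNth_apply_succAbove, and_self, and_true, eq_iff_iff]
      refine forall_congr' fun m => ?_
      rw [cntF_succ]
      simp only [Fin.cons_succ, Fin.cons_zero, cntF_insertNth]
      split_ifs <;> omega
    · intro y _ hy
      refine Finset.sum_eq_zero fun a _ => Finset.sum_eq_zero fun b _ => ?_
      rw [if_neg]
      rintro ⟨_, _, h⟩
      apply hy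
      simpa using h
    · intro h; exact absurd (Finset.mem_univ _) h
  · intro y _ hy
    refine Finset.sum_eq_zero fun a _ => Finset.sum_eq_zero fun b _ => ?_
    rw [if_neg]
    rintro ⟨_, h, _⟩
    apply hy
    simpa using h
  · intro h; exact absurd (Finset.mem_univ _) h

/-- the general step -/
theorem badN_step (r s : ℕ) :
    2 * badN M (r + 1) s ≤ 2 * ∑ a : Fin (r + 1) → M, ∑ b : Fin s → M,
        ∑ j : Fin s, (if badP a b ∧ b j = a 0 then 1 else 0) +
      ∑ a : Fin (r + 1) → M, ∑ b : Fin s → M,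
        (if badP a b ∧ 2 ≤ cntF (fun i => a (Fin.succ i)) (a 0) then 2 else 0) := by
  unfold badN
  rw [Finset.mul_sum, Finset.mul_sum, ← Finset.sum_add_distrib]
  refine Finset.sum_le_sum fun a _ => ?_
  rw [Finset.mul_sum, Finset.mul_sum, ← Finset.sum_add_distrib]
  refine Finset.sum_le_sum fun b _ => ?_
  by_cases hb : badP a b
  swap
  · simp [hb]
  by_cases hj : ∃ j, b j = a 0
  · obtain ⟨j, hj⟩ := hj
    have : 1 ≤ ∑ j : Fin s, (if badP a b ∧ b j = a 0 then 1 else 0) := by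
      calc 1 = if badP a b ∧ b j = a 0 then 1 else 0 := by rw [if_pos ⟨hb, hj⟩]
        _ ≤ _ := Finset.single_le_sum (f := fun j => if badP a b ∧ b j = a 0 then 1 else 0)
          (fun _ _ => Nat.zero_le _) (Finset.mem_univ j)
    rw [if_pos hb]; omega
  · have h0 : cntF b (a 0) = 0 := by
      by_contra hne
      exact hj (exists_of_cntF_pos b (a 0) (Nat.pos_of_ne_zero hne))
    have h1 := hb (a 0)
    rw [h0, cntF_succ, if_pos rfl] at h1
    have h2 : 2 ≤ cntF (fun i => a (Fin.succ i)) (a 0) := by omega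
    rw [if_pos hb, if_pos ⟨hb, h2⟩]; omega

theorem badN_step_match (r s : ℕ) :
    ∑ a : Fin (r + 1) → M, ∑ b : Fin (s + 1) → M,
        ∑ j : Fin (s + 1), (if badP a b ∧ b j = a 0 then 1 else 0) =
      (s + 1) * (Fintype.card M * badN M r s) := by
  rw [Finset.sum_congr rfl (fun a _ => Finset.sum_comm), Finset.sum_comm]
  rw [Finset.sum_congr rfl (fun j _ => bad_match r s j)]
  simp

theorem badN_step_triple (n s : ℕ) :
    ∑ a : Fin (n + 3) → M, ∑ b : Fin s → M,
        (if badP a b ∧ 2 ≤ cntF (fun i => a (Fin.succ i)) (a 0) then 2 else 0) ≤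
      (n + 2) * (n + 1) * (Fintype.card M * badN M n s) := by
  have h1 : ∀ (a : Fin (n + 3) → M) (b : Fin s → M),
      (if badP a b ∧ 2 ≤ cntF (fun i => a (Fin.succ i)) (a 0) then 2 else 0) ≤
      ∑ i1 : Fin (n + 2), ∑ i2 : Fin (n + 1), (if badP a b ∧ a (Fin.succ i1) = a 0 ∧
        a (Fin.succ (i1.succAbove i2)) = a 0 then 1 else 0) := by
    intro a b
    split_ifs with h
    · refine (pair_sum_ge (fun i => a (Fin.succ i)) (a 0) h.2).trans (le_of_eq ?_)
      refine Finset.sum_congr rfl fun i1 _ => Finset.sum_congr rfl fun i2 _ => ?_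
      simp [h.1]
    · exact Nat.zero_le _
  refine (Finset.sum_le_sum fun a _ => Finset.sum_le_sum fun b _ => h1 a b).trans ?_
  have h2 : ∑ a : Fin (n + 3) → M, ∑ b : Fin s → M, ∑ i1 : Fin (n + 2), ∑ i2 : Fin (n + 1),
      (if badP a b ∧ a (Fin.succ i1) = a 0 ∧
        a (Fin.succ (i1.succAbove i2)) = a 0 then 1 else 0) =
      ∑ i1 : Fin (n + 2), ∑ i2 : Fin (n + 1), ∑ a : Fin (n + 3) → M, ∑ b : Fin s → M,
      (if badP a b ∧ a (Fin.succ i1) = a 0 ∧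
        a (Fin.succ (i1.succAbove i2)) = a 0 then 1 else 0) := by
    rw [Finset.sum_congr rfl (fun a _ => Finset.sum_comm), Finset.sum_comm]
    refine Finset.sum_congr rfl fun i1 _ => ?_
    rw [Finset.sum_congr rfl (fun a _ => Finset.sum_comm), Finset.sum_comm]
  rw [h2, Finset.sum_congr rfl (fun i1 _ => Finset.sum_congr rfl fun i2 _ => bad_triple n s i1 i2)]
  simp [mul_assoc]

theorem badN_step_small (r s : ℕ) (hr : r < 2) :
    ∑ a : Fin (r + 1) → M, ∑ b : Fin s → M,
        (if badP a b ∧ 2 ≤ cntF (fun i => a (Fin.succ i)) (a 0) then 2 else 0) = 0 := by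
  refine Finset.sum_eq_zero fun a _ => Finset.sum_eq_zero fun b _ => ?_
  rw [if_neg]
  rintro ⟨_, h⟩
  obtain ⟨k, hk⟩ := pair_sum_ge' _ _ h
  omega

end BadCount

end PartB1

section PartB2
section ClosedForm

/-- coefficients of `exp(h x³/6)` -/
noncomputable def eCo (h : ℝ) (m : ℤ) : ℝ :=
  if 0 ≤ m ∧ 3 ∣ m then (h / 6) ^ (m / 3).toNat / ((m / 3).toNat.factorial : ℝ) else 0

theorem eCo_rec (h : ℝ) (m : ℤ) : (m : ℝ) * eCo h m = (h / 2) * eCo h (m - 3) := by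
  unfold eCo
  by_cases h3 : 3 ∣ m
  · obtain ⟨k, rfl⟩ := h3
    have e1 : (3 * k - 3) = 3 * (k - 1) := by ring
    rw [e1]
    simp only [dvd_mul_right, and_true]
    rw [Int.mul_ediv_cancel_left _ (by norm_num), Int.mul_ediv_cancel_left _ (by norm_num)]
    rcases lt_trichotomy k 0 with hk | hk | hk
    · rw [if_neg (by omega), if_neg (by omega)]; simp
    · subst hk; simp
    · obtain ⟨n, rfl⟩ : ∃ n : ℕ, k = n + 1 := ⟨(k - 1).toNat, by omega⟩
      rw [if_pos (by omega), if_pos (by omega)]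
      have t1 : ((n : ℤ) + 1).toNat = n + 1 := by omega
      have t2 : ((n : ℤ) + 1 - 1).toNat = n := by omega
      rw [t1, t2, Nat.factorial_succ]
      push_cast
      have : (n.factorial : ℝ) ≠ 0 := by positivity
      have h' : (n : ℝ) + 1 ≠ 0 := by positivity
      field_simp
      ring
  · rw [if_neg (fun H => h3 H.2), if_neg (fun H => h3 (by have := H.2; omega))]; simp

theorem eCo_neg (h : ℝ) (m : ℤ) (hm : m < 0) : eCo h m = 0 := by
  unfold eCo; rw [if_neg (by omega)]

theorem eCo_nonneg (h : ℝ) (hh : 0 ≤ h) (m : ℤ) : 0 ≤ eCo h m := by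
  unfold eCo; split_ifs <;> positivity

/-- bivariate coefficients -/
noncomputable def gCo (h : ℝ) (N : ℕ) (r s : ℤ) : ℝ :=
  ∑ k ∈ Finset.range N, eCo h (r - k) * eCo h (s - k) * (h ^ k / (k.factorial : ℝ))

theorem gCo_stable (h : ℝ) (N N' : ℕ) (r s : ℤ) (hr : r < N) (hN : N ≤ N') :
    gCo h N' r s = gCo h N r s := by
  unfold gCo
  symm
  refine Finset.sum_subset (Finset.range_subset_range.mpr hN) ?_
  intro k _ hk
  rw [Finset.mem_range] at hk
  rw [eCo_neg h (r - k) (by omega)]; simp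

theorem gCo_rec (h : ℝ) (N : ℕ) (r s : ℤ) :
    (r : ℝ) * gCo h (N + 1) r s = (h / 2) * gCo h (N + 1) (r - 3) s +
      h * gCo h N (r - 1) (s - 1) := by
  unfold gCo
  have h1 : h * ∑ k ∈ Finset.range N, eCo h (r - 1 - k) * eCo h (s - 1 - k) *
      (h ^ k / (k.factorial : ℝ)) = ∑ k ∈ Finset.range (N + 1),
      (k : ℝ) * (eCo h (r - k) * eCo h (s - k) * (h ^ k / (k.factorial : ℝ))) := by
    rw [Finset.sum_range_succ']
    simp only [Nat.cast_zero, zero_mul, add_zero]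
    rw [Finset.mul_sum]
    refine Finset.sum_congr rfl fun k _ => ?_
    rw [Nat.factorial_succ, pow_succ]
    push_cast
    have e1 : r - 1 - (k : ℤ) = r - (k + 1) := by ring
    have e2 : s - 1 - (k : ℤ) = s - (k + 1) := by ring
    rw [e1, e2]
    have : (k.factorial : ℝ) ≠ 0 := by positivity
    have h' : (k : ℝ) + 1 ≠ 0 := by positivity
    field_simp
  rw [h1, Finset.mul_sum, Finset.mul_sum, ← Finset.sum_add_distrib]
  refine Finset.sum_congr rfl fun k _ => ?_
  have h2 := eCo_rec h (r - k)
  have e3 : r - (k : ℤ) - 3 = r - 3 - k := by ring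
  rw [e3] at h2
  push_cast at h2
  linear_combination (eCo h (s - k) * (h ^ k / (k.factorial : ℝ))) * h2

/-- closed form majorant -/
noncomputable def DCo (h : ℝ) (r s : ℕ) : ℝ :=
  (r.factorial : ℝ) * (s.factorial : ℝ) * gCo h (r + 1) r s

theorem gCo_neg (h : ℝ) (N : ℕ) (r s : ℤ) (hs : r < 0 ∨ s < 0) : gCo h N r s = 0 := by
  unfold gCo
  refine Finset.sum_eq_zero fun k _ => ?_
  rcases hs with hs | hs
  · rw [eCo_neg h (r - k) (by omega)]; simp
  · rw [eCo_neg h (s - k) (by omega)]; simp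

theorem gCo_nonneg (h : ℝ) (hh : 0 ≤ h) (N : ℕ) (r s : ℤ) : 0 ≤ gCo h N r s := by
  unfold gCo
  refine Finset.sum_nonneg fun k _ => ?_
  have := eCo_nonneg h hh (r - k)
  have := eCo_nonneg h hh (s - k)
  positivity

theorem DCo_symm (h : ℝ) (r s : ℕ) : DCo h r s = DCo h s r := by
  unfold DCo
  have h1 := gCo_stable h (r + 1) (r + s + 1) r s (by push_cast; omega) (by omega)
  have h2 := gCo_stable h (s + 1) (r + s + 1) s r (by push_cast; omega) (by omega)
  rw [← h1, ← h2]
  have : gCo h (r + s + 1) r s = gCo h (r + s + 1) s r := by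
    unfold gCo
    refine Finset.sum_congr rfl fun k _ => by ring
  rw [this]; ring

theorem DCo_succ_succ (h : ℝ) (r s : ℕ) :
    DCo h (r + 1) (s + 1) = (s + 1) * h * DCo h r s +
      (h / 2) * ((r + 1).factorial * (s + 1).factorial / (r + 1)) *
        gCo h (r + 2) ((r : ℤ) - 2) (s + 1) := by
  unfold DCo
  have h1 := gCo_rec h (r + 1) ((r : ℤ) + 1) ((s : ℤ) + 1)
  have e1 : (r : ℤ) + 1 - 3 = r - 2 := by ring
  have e2 : (r : ℤ) + 1 - 1 = r := by ring
  have e3 : (s : ℤ) + 1 - 1 = s := by ring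
  rw [e1, e2, e3] at h1
  push_cast at h1 ⊢
  have h' : (r : ℝ) + 1 ≠ 0 := by positivity
  have h2 : gCo h (r + 1 + 1) ((r : ℤ) + 1) ((s : ℤ) + 1) =
      (h / 2 * gCo h (r + 1 + 1) ((r : ℤ) - 2) (s + 1) + h * gCo h (r + 1) r s) / (r + 1) := by
    rw [← h1]; field_simp
  rw [h2, Nat.factorial_succ, Nat.factorial_succ]
  push_cast
  field_simp
  ring

theorem DCo_succ_zero (h : ℝ) (r : ℕ) :
    DCo h (r + 1) 0 =
      (h / 2) * ((r + 1).factorial / (r + 1)) * gCo h (r + 2) ((r : ℤ) - 2) 0 := by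
  unfold DCo
  have h1 := gCo_rec h (r + 1) ((r : ℤ) + 1) 0
  have e1 : (r : ℤ) + 1 - 3 = r - 2 := by ring
  rw [e1, gCo_neg h (r + 1) _ (0 - 1) (by omega)] at h1
  push_cast at h1 ⊢
  have h' : (r : ℝ) + 1 ≠ 0 := by positivity
  have h2 : gCo h (r + 1 + 1) ((r : ℤ) + 1) 0 =
      (h / 2 * gCo h (r + 1 + 1) ((r : ℤ) - 2) 0) / (r + 1) := by
    rw [mul_zero, add_zero] at h1
    rw [← h1]; field_simp
  rw [h2, Nat.factorial_succ]
  push_cast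
  field_simp
  simp

theorem DCo_triple (h : ℝ) (n s : ℕ) :
    (h / 2) * ((n + 2 + 1).factorial * s.factorial / ((n + 2 : ℕ) + 1)) *
        gCo h (n + 2 + 2) (((n + 2 : ℕ) : ℤ) - 2) s =
      (n + 2) * (n + 1) / 2 * h * DCo h n s := by
  unfold DCo
  have e1 : (((n + 2 : ℕ) : ℤ) - 2) = n := by push_cast; ring
  rw [e1, gCo_stable h (n + 1) (n + 2 + 2) n s (by push_cast; omega) (by omega)]
  rw [Nat.factorial_succ, Nat.factorial_succ, Nat.factorial_succ]
  push_cast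
  field_simp
  ring

variable {M : Type*} [Fintype M] [DecidableEq M]

theorem badN_zero_right (r : ℕ) : (badN M r 0 : ℝ) ≤ DCo (Fintype.card M) r 0 := by
  induction r using Nat.strong_induction_on with
  | _ r ih =>
  rcases r with _ | r
  · rw [badN_zero_zero]
    simp [DCo, gCo, eCo]
  · have hs := badN_step (M := M) r 0
    have h0 : ∑ a : Fin (r + 1) → M, ∑ b : Fin 0 → M,
        ∑ j : Fin 0, (if badP a b ∧ b j = a 0 then 1 else 0) = 0 := by simp
    rw [h0] at hs
    rw [DCo_succ_zero]
    by_cases hr : r < 2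
    · rw [badN_step_small r 0 hr] at hs
      have : badN M (r + 1) 0 = 0 := by omega
      rw [this, gCo_neg _ _ _ _ (Or.inl (by omega))]; simp
    · obtain ⟨n, rfl⟩ : ∃ n, r = n + 2 := ⟨r - 2, by omega⟩
      have h1 := badN_step_triple (M := M) n 0
      have h2 := DCo_triple (Fintype.card M : ℝ) n 0
      simp only [Nat.factorial_zero, Nat.cast_one, mul_one, Nat.cast_zero] at h2
      rw [h2]
      have h3 : 2 * badN M (n + 2 + 1) 0 ≤ (n + 2) * (n + 1) * (Fintype.card M * badN M n 0) := by
        refine hs.trans ?_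
        simpa using h1
      have h4 : (2 : ℝ) * badN M (n + 2 + 1) 0 ≤
          (n + 2) * (n + 1) * (Fintype.card M * badN M n 0) := by exact_mod_cast h3
      have h5 := ih n (by omega)
      have h6 : ((n : ℝ) + 2) * (n + 1) * (Fintype.card M * badN M n 0) ≤
          ((n : ℝ) + 2) * (n + 1) * (Fintype.card M * DCo (Fintype.card M) n 0) := by gcongr
      linarith

theorem badN_le (r s : ℕ) : (badN M r s : ℝ) ≤ DCo (Fintype.card M) r s := by
  induction r using Nat.strong_induction_on generalizing s with
  | _ r ih =>
  rcases r with _ | r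
  · rw [badN_symm, DCo_symm]; exact badN_zero_right s
  rcases s with _ | s
  · exact badN_zero_right (r + 1)
  have hs := badN_step (M := M) r (s + 1)
  rw [badN_step_match] at hs
  rw [DCo_succ_succ]
  have h7 := ih r (by omega) s
  have h8 : ((s : ℝ) + 1) * (Fintype.card M * badN M r s) ≤
      ((s : ℝ) + 1) * (Fintype.card M * DCo (Fintype.card M) r s) := by gcongr
  by_cases hr : r < 2
  · rw [badN_step_small r (s + 1) hr] at hs
    rw [gCo_neg _ _ _ _ (Or.inl (by omega))]
    have h4 : (2 : ℝ) * badN M (r + 1) (s + 1) ≤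
          2 * ((s + 1) * (Fintype.card M * badN M r s)) := by exact_mod_cast hs
    linarith
  · obtain ⟨n, rfl⟩ : ∃ n, r = n + 2 := ⟨r - 2, by omega⟩
    have h1 := badN_step_triple (M := M) n (s + 1)
    have h2 := DCo_triple (Fintype.card M : ℝ) n (s + 1)
    have h2' : (Fintype.card M : ℝ) / 2 * ((n + 2 + 1).factorial * (s + 1).factorial /
        ((n + 2 : ℕ) + 1)) * gCo (Fintype.card M) (n + 2 + 2) (((n + 2 : ℕ) : ℤ) - 2) (s + 1) =
      (n + 2) * (n + 1) / 2 * Fintype.card M * DCo (Fintype.card M) n (s + 1) := by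
      rw [← h2]; push_cast; rfl
    rw [h2']
    have h3 : 2 * badN M (n + 2 + 1) (s + 1) ≤ 2 * ((s + 1) * (Fintype.card M * badN M (n + 2) s))
        + (n + 2) * (n + 1) * (Fintype.card M * badN M n (s + 1)) := by
      refine hs.trans ?_
      exact Nat.add_le_add_left h1 _
    have h4 : (2 : ℝ) * badN M (n + 2 + 1) (s + 1) ≤
        2 * ((s + 1) * (Fintype.card M * badN M (n + 2) s))
        + (n + 2) * (n + 1) * (Fintype.card M * badN M n (s + 1)) := by exact_mod_cast h3
    have h5 := ih n (by omega) (s + 1)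
    have h6 : ((n : ℝ) + 2) * (n + 1) * (Fintype.card M * badN M n (s + 1)) ≤
        ((n : ℝ) + 2) * (n + 1) * (Fintype.card M * DCo (Fintype.card M) n (s + 1)) := by gcongr
    linarith

theorem DCo_diag (h : ℝ) (r : ℕ) :
    DCo h r r = ∑ n ∈ Finset.range (r / 3 + 1),
      ((r.factorial : ℝ) / ((n.factorial : ℝ) * 6 ^ n)) ^ 2 *
        h ^ (r - n) / ((r - 3 * n).factorial : ℝ) := by
  unfold DCo gCo
  rw [Finset.mul_sum]
  symm
  refine Finset.sum_bij_ne_zero (fun n _ _ => r - 3 * n) ?_ ?_ ?_ ?_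
  · intro n hn _
    rw [Finset.mem_range] at *; omega
  · intro n hn _ n' hn' _ he
    rw [Finset.mem_range] at *; omega
  · intro k hk hne
    rw [Finset.mem_range] at hk
    have h3 : (3 : ℤ) ∣ (r : ℤ) - k := by
      by_contra h3
      apply hne
      unfold eCo
      rw [if_neg (fun H => h3 H.2)]; simp
    refine ⟨(r - k) / 3, ?_, ?_, ?_⟩
    · rw [Finset.mem_range]; omega
    · intro h0
      apply hne
      have hk' : r - 3 * ((r - k) / 3) = k := by omega
      rw [hk'] at h0
      have : h ^ (r - (r - k) / 3) = h ^ ((r - k) / 3) * h ^ ((r - k) / 3) * h ^ k := by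
        rw [← pow_add, ← pow_add]; congr 1; omega
      rw [this] at h0
      have hp : ((r.factorial : ℝ) / (((r - k) / 3).factorial * 6 ^ ((r - k) / 3))) ^ 2 ≠ 0 := by
        positivity
      have hp2 : (k.factorial : ℝ) ≠ 0 := by positivity
      have h1 : h ^ ((r - k) / 3) * h ^ ((r - k) / 3) * h ^ k = 0 := by
        rcases div_eq_zero_iff.mp h0 with h1 | h1
        · rcases mul_eq_zero.mp h1 with h1 | h1
          · exact absurd h1 hp
          · exact h1
        · exact absurd h1 hp2
      have hT : (((r : ℤ) - k) / 3).toNat = (r - k) / 3 := by omega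
      unfold eCo
      rw [if_pos ⟨by omega, h3⟩, hT, div_pow]
      rcases mul_eq_zero.mp h1 with h1 | h1
      · rcases mul_eq_zero.mp h1 with h1 | h1 <;> rw [h1] <;> simp
      · rw [h1]; simp
    · omega
  · intro n hn _
    rw [Finset.mem_range] at hn
    have e1 : (r : ℤ) - ((r - 3 * n : ℕ) : ℤ) = 3 * n := by omega
    rw [e1]
    unfold eCo
    rw [if_pos ⟨by omega, by simp⟩, Int.mul_ediv_cancel_left _ (by norm_num), Int.toNat_natCast]
    have e2 : h ^ (r - n) = h ^ n * h ^ n * h ^ (r - 3 * n) := by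
      rw [← pow_add, ← pow_add]; congr 1; omega
    rw [e2, div_pow h 6]
    field_simp

end ClosedForm

end PartB2

section PartB3
section Moment

theorem cubic_norm_le (p : ℕ) [Fact p.Prime] (χ : MulChar (ZMod p) ℂ) (hχ : orderOf χ = 3)
    (y : ZMod p) : ‖χ y‖ ≤ 1 := by
  by_cases h0 : y = 0
  · rw [h0, MulChar.map_zero]; simp
  · rw [← Units.val_mk0 h0]
    refine le_of_eq ?_
    have hc3 : (χ (Units.mk0 _ h0 : (ZMod p)ˣ)) ^ 3 = (1 : ℂ) := by
      have h := pow_orderOf_eq_one χ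
      rw [hχ] at h
      rw [← MulChar.pow_apply_coe, h]; exact MulChar.one_apply_coe _
    have h := congrArg norm hc3
    rw [norm_pow, norm_one] at h
    exact (pow_eq_one_iff_of_nonneg (norm_nonneg _) (by norm_num)).mp h

theorem cubic_pow_three (p : ℕ) [Fact p.Prime] (χ : MulChar (ZMod p) ℂ) (hχ : orderOf χ = 3)
    (y : ZMod p) (h0 : y ≠ 0) : χ y ^ 3 = 1 := by
  rw [← Units.val_mk0 h0]
  have h := pow_orderOf_eq_one χ
  rw [hχ] at h
  rw [← MulChar.pow_apply_coe, h]; exact MulChar.one_apply_coe _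

theorem cubic_norm_eq (p : ℕ) [Fact p.Prime] (χ : MulChar (ZMod p) ℂ) (hχ : orderOf χ = 3)
    (y : ZMod p) (h0 : y ≠ 0) : ‖χ y‖ = 1 := by
  have h := congrArg norm (cubic_pow_three p χ hχ y h0)
  rw [norm_pow, norm_one] at h
  exact (pow_eq_one_iff_of_nonneg (norm_nonneg _) (by norm_num)).mp h

theorem cubic_conj (p : ℕ) [Fact p.Prime] (χ : MulChar (ZMod p) ℂ) (hχ : orderOf χ = 3)
    (y : ZMod p) : (starRingEnd ℂ) (χ y) = χ y ^ 2 := by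
  by_cases h0 : y = 0
  · rw [h0, MulChar.map_zero]; simp
  · have h1 := cubic_pow_three p χ hχ y h0
    have h2 := cubic_norm_eq p χ hχ y h0
    have h3 : χ y * (starRingEnd ℂ) (χ y) = 1 := by
      rw [Complex.mul_conj, Complex.normSq_eq_norm_sq, h2]; simp
    have hne : χ y ≠ 0 := by intro h; rw [h] at h2; simp at h2
    apply mul_left_cancel₀ hne
    rw [h3, ← h1]; ring

variable {h : ℕ}

theorem prod_eq_prod_cntF {n : ℕ} (a : Fin n → Fin h) (F : Fin h → ℂ) :
    ∏ i, F (a i) = ∏ m, F m ^ cntF a m := by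
  unfold cntF
  simp_rw [← Finset.prod_pow_eq_pow_sum]
  rw [Finset.prod_comm]
  refine Finset.prod_congr rfl fun i _ => ?_
  rw [Finset.prod_eq_single (a i)]
  · simp
  · intro b _ hb; rw [if_neg hb.symm, pow_zero]
  · intro hh; exact absurd (Finset.mem_univ _) hh

theorem sum_cntF {n : ℕ} (a : Fin n → Fin h) : ∑ m, cntF a m = n := by
  unfold cntF
  rw [Finset.sum_comm]
  simp

theorem tuple_sum_bound (p : ℕ) [Fact p.Prime] (χ : MulChar (ZMod p) ℂ) (hχ : orderOf χ = 3)
    (y : Fin h → ZMod p) (hy : Function.Injective y) (r : ℕ) (a b : Fin r → Fin h)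
    (hab : ¬ badP a b) :
    ‖∑ x : ZMod p, ∏ m, χ (y m - x) ^ (cntF a m + 2 * cntF b m)‖ ≤
      (2 * r - 1 : ℝ) * Real.sqrt p := by
  classical
  set E : Fin h → ℕ := fun m => cntF a m + 2 * cntF b m with hE
  set e' : Fin h → ℕ := fun m => if E m % 3 = 0 then 3 else E m % 3 with he'
  set T : Finset (Fin h) := Finset.univ.filter (fun m => E m ≠ 0) with hT
  obtain ⟨m0, hm0⟩ : ∃ m, cntF a m % 3 ≠ cntF b m % 3 := by
    unfold badP at hab; push Not at hab; exact hab
  have hEm0 : E m0 % 3 ≠ 0 := by rw [hE]; simp only; omega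
  have hT0 : m0 ∈ T := by
    rw [hT, Finset.mem_filter]; exact ⟨Finset.mem_univ _, fun h0 => hEm0 (by rw [h0])⟩
  have hcard : T.card ≤ 2 * r := by
    have h1 : T.card ≤ ∑ m, (cntF a m + cntF b m) := by
      rw [hT, Finset.card_filter]
      refine Finset.sum_le_sum fun m _ => ?_
      split_ifs with h
      · rw [hE] at h; simp only at h; omega
      · omega
    rw [Finset.sum_add_distrib, sum_cntF, sum_cntF] at h1
    omega
  have hw := weil_cubic p χ hχ (T.image y) (y m0) (Finset.mem_image_of_mem _ hT0)
    (Function.extend y e' 0) (by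
      rw [hy.extend_apply, he']; simp only; rw [if_neg hEm0]; omega)
  rw [Finset.card_image_of_injective _ hy] at hw
  have heq : ∑ x : ZMod p, ∏ m, χ (y m - x) ^ E m =
      ∑ x : ZMod p, χ (∏ b ∈ T.image y, (b - x) ^ Function.extend y e' 0 b) := by
    refine Finset.sum_congr rfl fun x _ => ?_
    rw [Finset.prod_image (fun _ _ _ _ h => hy h), map_prod]
    have h1 : ∏ m, χ (y m - x) ^ E m = ∏ m ∈ T, χ (y m - x) ^ E m := by
      symm
      refine Finset.prod_subset (Finset.subset_univ _) ?_
      intro m _ hm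
      rw [hT, Finset.mem_filter] at hm
      push Not at hm
      rw [hm (Finset.mem_univ _), pow_zero]
    rw [h1]
    refine Finset.prod_congr rfl fun m hm => ?_
    rw [hy.extend_apply, map_pow]
    have hEm : E m ≠ 0 := (Finset.mem_filter.mp hm).2
    have he1 : e' m ≠ 0 := by rw [he']; simp only; split_ifs <;> omega
    by_cases h0 : y m - x = 0
    · rw [h0, MulChar.map_zero, zero_pow hEm, zero_pow he1]
    · have h3 := cubic_pow_three p χ hχ _ h0
      have hmod : E m % 3 = e' m % 3 := by rw [he']; simp only; split_ifs <;> omega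
      rw [← Nat.div_add_mod (E m) 3, ← Nat.div_add_mod (e' m) 3, pow_add, pow_mul, h3, pow_add,
        pow_mul, h3, one_pow, one_pow, hmod]
  rw [heq]
  refine hw.trans ?_
  have : (T.card : ℝ) ≤ 2 * r := by exact_mod_cast hcard
  gcongr

theorem moment_bound (p : ℕ) [Fact p.Prime] (χ : MulChar (ZMod p) ℂ) (hχ : orderOf χ = 3)
    (y : Fin h → ZMod p) (hy : Function.Injective y) (r : ℕ) (hr : 0 < r) :
    ∑ x : ZMod p, ‖∑ m, χ (y m - x)‖ ^ (2 * r) ≤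
      p * DCo h r r + (2 * r - 1 : ℝ) * Real.sqrt p * (h : ℝ) ^ (2 * r) := by
  classical
  have h1 : ∀ x : ZMod p, (((‖∑ m, χ (y m - x)‖ ^ (2 * r) : ℝ)) : ℂ) =
      ∑ a : Fin r → Fin h, ∑ b : Fin r → Fin h,
        ∏ m, χ (y m - x) ^ (cntF a m + 2 * cntF b m) := by
    intro x
    have h2 : (((‖∑ m, χ (y m - x)‖ ^ (2 * r) : ℝ)) : ℂ) =
        (∑ m, χ (y m - x)) ^ r * (∑ m, χ (y m - x) ^ 2) ^ r := by
      rw [pow_mul, ← Complex.normSq_eq_norm_sq, Complex.ofReal_pow, ← Complex.mul_conj, mul_pow]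
      congr 2
      rw [map_sum]
      exact Finset.sum_congr rfl fun m _ => cubic_conj p χ hχ _
    rw [h2, Fintype.sum_pow, Fintype.sum_pow, Finset.sum_mul_sum]
    refine Finset.sum_congr rfl fun a _ => Finset.sum_congr rfl fun b _ => ?_
    rw [prod_eq_prod_cntF a (fun m => χ (y m - x)), prod_eq_prod_cntF b (fun m => χ (y m - x) ^ 2),
      ← Finset.prod_mul_distrib]
    refine Finset.prod_congr rfl fun m _ => ?_
    rw [pow_add, pow_mul]
  have h3 : ((∑ x : ZMod p, ‖∑ m, χ (y m - x)‖ ^ (2 * r) : ℝ) : ℂ) =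
      ∑ a : Fin r → Fin h, ∑ b : Fin r → Fin h, ∑ x : ZMod p,
        ∏ m, χ (y m - x) ^ (cntF a m + 2 * cntF b m) := by
    rw [Complex.ofReal_sum, Finset.sum_congr rfl (fun x _ => h1 x), Finset.sum_comm]
    refine Finset.sum_congr rfl fun a _ => ?_
    rw [Finset.sum_comm]
  have h4 : ∑ x : ZMod p, ‖∑ m, χ (y m - x)‖ ^ (2 * r) =
      ‖((∑ x : ZMod p, ‖∑ m, χ (y m - x)‖ ^ (2 * r) : ℝ) : ℂ)‖ := by
    rw [Complex.norm_real, Real.norm_of_nonneg]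
    exact Finset.sum_nonneg fun x _ => by positivity
  rw [h4, h3]
  have hr1 : (0 : ℝ) ≤ 2 * r - 1 := by
    have : (1 : ℝ) ≤ r := by exact_mod_cast hr
    linarith
  have h5 : ∀ a b : Fin r → Fin h,
      ‖∑ x : ZMod p, ∏ m, χ (y m - x) ^ (cntF a m + 2 * cntF b m)‖ ≤
      (p : ℝ) * ((if badP a b then 1 else 0 : ℕ) : ℝ) + (2 * r - 1 : ℝ) * Real.sqrt p := by
    intro a b
    by_cases hb : badP a b
    · rw [if_pos hb]
      have : ‖∑ x : ZMod p, ∏ m, χ (y m - x) ^ (cntF a m + 2 * cntF b m)‖ ≤ ∑ x : ZMod p, (1 : ℝ) := by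
        refine (norm_sum_le _ _).trans (Finset.sum_le_sum fun x _ => ?_)
        rw [norm_prod]
        refine Finset.prod_le_one (fun _ _ => norm_nonneg _) fun m _ => ?_
        rw [norm_pow]
        exact pow_le_one₀ (norm_nonneg _) (cubic_norm_le p χ hχ _)
      rw [Finset.sum_const, Finset.card_univ, ZMod.card, nsmul_eq_mul, mul_one] at this
      have h6 : 0 ≤ (2 * r - 1 : ℝ) * Real.sqrt p := by positivity
      push_cast
      linarith
    · rw [if_neg hb]
      have := tuple_sum_bound p χ hχ y hy r a b hb
      push_cast
      linarith
  refine (norm_sum_le _ _).trans ?_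
  refine (Finset.sum_le_sum fun a _ => norm_sum_le _ _).trans ?_
  refine (Finset.sum_le_sum fun a _ => Finset.sum_le_sum fun b _ => h5 a b).trans ?_
  have h7 : ∑ a : Fin r → Fin h, ∑ b : Fin r → Fin h,
      ((p : ℝ) * ((if badP a b then 1 else 0 : ℕ) : ℝ) + (2 * r - 1 : ℝ) * Real.sqrt p) =
      (p : ℝ) * (badN (Fin h) r r : ℝ) + (2 * r - 1 : ℝ) * Real.sqrt p * (h : ℝ) ^ (2 * r) := by
    simp only [Finset.sum_add_distrib, Finset.sum_const, Finset.card_univ, Fintype.card_fun,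
      Fintype.card_fin, nsmul_eq_mul, ← Finset.mul_sum]
    unfold badN
    push_cast
    rw [two_mul r, pow_add]
    ring
  rw [h7]
  have h8 := badN_le (M := Fin h) r r
  rw [Fintype.card_fin] at h8
  gcongr

end Moment

end PartB3

section PartC1
open scoped ArithmeticFunction.Moebius

theorem c_moebius_ind (n : ℕ) (hn : n ≠ 0) :
    ∑ d ∈ n.divisors, ((μ d : ℤ) : ℝ) = if n = 1 then 1 else 0 := by
  have h := ArithmeticFunction.coe_mul_zeta_apply (R := ℤ) (f := μ) (x := n)
  rw [ArithmeticFunction.moebius_mul_coe_zeta, ArithmeticFunction.one_apply] at h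
  rw [← Int.cast_sum, ← h]
  split_ifs <;> simp

theorem c_totient (n : ℕ) (hn : 0 < n) :
    (Nat.totient n : ℝ) = ∑ x ∈ n.divisorsAntidiagonal, ((μ x.1 : ℤ) : ℝ) * (x.2 : ℝ) := by
  have h := (ArithmeticFunction.sum_eq_iff_sum_mul_moebius_eq (R := ℝ)
    (f := fun n => (Nat.totient n : ℝ)) (g := fun n => (n : ℝ))).1 (by
      intro n hn
      rw [← Nat.cast_sum, Nat.sum_totient]) n hn
  exact h.symm

theorem c_totient_div (n : ℕ) (hn : 0 < n) :
    (Nat.totient n : ℝ) / n = ∑ d ∈ n.divisors, ((μ d : ℤ) : ℝ) / d := by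
  have hn' : (n : ℝ) ≠ 0 := by positivity
  rw [c_totient n hn, Nat.sum_divisorsAntidiagonal (f := fun a b => ((μ a : ℤ) : ℝ) * (b : ℝ)),
    Finset.sum_div]
  refine Finset.sum_congr rfl fun d hd => ?_
  have hd' := Nat.dvd_of_mem_divisors hd
  have hd0 : (d : ℝ) ≠ 0 := by
    have := Nat.pos_of_mem_divisors hd
    positivity
  rw [Nat.cast_div hd' hd0]
  field_simp

theorem c_coprime_ind (e u : ℕ) (hu : 0 < u) :
    (if Nat.Coprime e u then (1 : ℝ) else 0) =
      ∑ d ∈ u.divisors, if d ∣ e then ((μ d : ℤ) : ℝ) else 0 := by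
  have h := c_moebius_ind (Nat.gcd e u) (Nat.gcd_pos_of_pos_right _ hu).ne'
  rw [← Finset.sum_filter]
  have : u.divisors.filter (fun d => d ∣ e) = (Nat.gcd e u).divisors := by
    ext d
    simp only [Finset.mem_filter, Nat.mem_divisors, Nat.dvd_gcd_iff]
    have := (Nat.gcd_pos_of_pos_right e hu).ne'
    constructor
    · rintro ⟨⟨a, b⟩, c⟩; exact ⟨⟨c, a⟩, this⟩
    · rintro ⟨⟨a, b⟩, c⟩; exact ⟨⟨b, hu.ne'⟩, a⟩
  rw [this, h]

theorem c_sigma_prod (u : ℕ) (hu : Squarefree u) :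
    ((∑ d ∈ u.divisors, d : ℕ) : ℝ) = ∏ p ∈ u.primeFactors, ((p : ℝ) + 1) := by
  have h := ArithmeticFunction.IsMultiplicative.prodPrimeFactors_one_add_of_squarefree
    (R := ℝ) (h_mult := (ArithmeticFunction.isMultiplicative_id.natCast (R := ℝ))) (n := u) hu
  push_cast
  have e : ∏ p ∈ u.primeFactors, ((p : ℝ) + 1) = ∏ p ∈ u.primeFactors, (1 + (p : ℝ)) :=
    Finset.prod_congr rfl (fun p _ => add_comm (p : ℝ) 1)
  rw [e]
  simpa using h.symm

theorem c_totient_prod (u : ℕ) (hu : Squarefree u) :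
    (Nat.totient u : ℝ) = ∏ p ∈ u.primeFactors, ((p : ℝ) - 1) := by
  have h := Nat.totient_eq_div_primeFactors_mul u
  rw [Nat.prod_primeFactors_of_squarefree hu, Nat.div_self (Nat.pos_of_ne_zero hu.ne_zero), one_mul] at h
  rw [h, Nat.cast_prod]
  refine Finset.prod_congr rfl fun p hp => ?_
  rw [Nat.cast_sub (Nat.prime_of_mem_primeFactors hp).one_lt.le]
  simp

theorem c_self_prod (u : ℕ) (hu : Squarefree u) :
    (u : ℝ) = ∏ p ∈ u.primeFactors, (p : ℝ) := by
  conv_lhs => rw [← Nat.prod_primeFactors_of_squarefree hu]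
  simp

theorem c_Tsum (y : ℝ) (hy : 0 ≤ y) :
    ∃ ψ : ℝ, 0 ≤ ψ ∧ ψ ≤ 1 / 8 ∧
      ∑ e ∈ Finset.Icc 1 ⌊y⌋₊, (y - e) = y ^ 2 / 2 - y / 2 + ψ := by
  set N := ⌊y⌋₊ with hN
  have h1 : (N : ℝ) ≤ y := Nat.floor_le hy
  have h2 : y < N + 1 := Nat.lt_floor_add_one y
  have hs : ∀ N : ℕ, ∑ e ∈ Finset.Icc 1 N, (y - e) = N * y - N * (N + 1) / 2 := by
    intro N
    induction N with
    | zero => simp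
    | succ k ih => rw [Finset.sum_Icc_succ_top (by omega), ih]; push_cast; ring
  refine ⟨((y - N) - (y - N) ^ 2) / 2, ?_, ?_, ?_⟩
  · nlinarith
  · nlinarith [sq_nonneg (y - N - 1 / 2)]
  · rw [hs]; ring

/-- The twisted Möbius sum limit. -/
theorem c_moebius_limit (u : ℕ) (hu : Squarefree u) :
    HasSum (fun d : ℕ => if Nat.Coprime d u then ((μ d : ℤ) : ℝ) / (d : ℝ) ^ 2 else 0)
      (6 / Real.pi ^ 2 * (u : ℝ) ^ 2 /
        ((Nat.totient u : ℝ) * ((∑ d ∈ u.divisors, d : ℕ) : ℝ))) := by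
  have hu0 : NeZero u := ⟨hu.ne_zero⟩
  have hs : 1 < (2 : ℂ).re := by norm_num
  set χ : DirichletCharacter ℂ u := 1 with hχ
  have h1 := DirichletCharacter.LSeries.mul_mu_eq_one χ hs
  have h2 : LSeries (fun n => χ n) 2 = (∏ p ∈ u.primeFactors, (1 - (p : ℂ) ^ (-2 : ℂ))) * riemannZeta 2 := by
    rw [← DirichletCharacter.LFunctionTrivChar_eq_mul_riemannZeta (by norm_num),
      DirichletCharacter.LFunctionTrivChar, DirichletCharacter.LFunction_eq_LSeries _ hs]
  have h3 : LSeriesSummable ((fun n : ℕ => χ n) * (fun n : ℕ => ((μ n : ℤ) : ℂ))) 2 :=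
    DirichletCharacter.LSeriesSummable_mul χ
      (ArithmeticFunction.LSeriesSummable_moebius_iff.mpr hs)
  have h4 := h3.LSeriesHasSum
  rw [LSeriesHasSum] at h4
  have hpr : (∏ p ∈ u.primeFactors, (1 - (p : ℂ) ^ (-2 : ℂ))) =
      (((Nat.totient u : ℝ) * ((∑ d ∈ u.divisors, d : ℕ) : ℝ) / (u : ℝ) ^ 2 : ℝ) : ℂ) := by
    rw [c_sigma_prod u hu, c_totient_prod u hu]
    conv_rhs => rw [c_self_prod u hu]
    rw [← Finset.prod_mul_distrib, ← Finset.prod_pow, ← Finset.prod_div_distrib]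
    push_cast
    refine Finset.prod_congr rfl fun p hp => ?_
    have hp0 : (p : ℂ) ≠ 0 := by
      exact_mod_cast (Nat.prime_of_mem_primeFactors hp).ne_zero
    rw [Complex.cpow_neg]
    norm_cast
    push_cast
    field_simp
    ring
  have hφ : (0 : ℝ) < Nat.totient u := by
    exact_mod_cast Nat.totient_pos.2 (Nat.pos_of_ne_zero hu.ne_zero)
  have hσ : (0 : ℝ) < ((∑ d ∈ u.divisors, d : ℕ) : ℝ) := by
    rw [c_sigma_prod u hu]
    exact Finset.prod_pos fun p _ => by positivity
  have huR : (0 : ℝ) < u := by exact_mod_cast Nat.pos_of_ne_zero hu.ne_zero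
  have h5 : LSeries ((fun n : ℕ => χ n) * (fun n : ℕ => ((μ n : ℤ) : ℂ))) 2 =
      ((6 / Real.pi ^ 2 * (u : ℝ) ^ 2 /
        ((Nat.totient u : ℝ) * ((∑ d ∈ u.divisors, d : ℕ) : ℝ)) : ℝ) : ℂ) := by
    have h6 := h1
    rw [h2, hpr, riemannZeta_two] at h6
    rw [eq_comm, ← mul_one (Complex.ofReal _), ← h6, ← mul_assoc]
    have : ((6 / Real.pi ^ 2 * (u : ℝ) ^ 2 /
        ((Nat.totient u : ℝ) * ((∑ d ∈ u.divisors, d : ℕ) : ℝ)) : ℝ) : ℂ) *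
        ((((Nat.totient u : ℝ) * ((∑ d ∈ u.divisors, d : ℕ) : ℝ) / (u : ℝ) ^ 2 : ℝ) : ℂ) *
          ((Real.pi : ℂ) ^ 2 / 6)) = 1 := by
      have hpi := Real.pi_pos
      rw [← Complex.ofReal_pow]
      have : ((Real.pi ^ 2 : ℝ) : ℂ) / 6 = ((Real.pi ^ 2 / 6 : ℝ) : ℂ) := by push_cast; ring
      rw [this, ← Complex.ofReal_mul, ← Complex.ofReal_mul, ← Complex.ofReal_one]
      congr 1
      field_simp
    rw [this, one_mul]
  rw [h5] at h4
  rw [← Complex.hasSum_ofReal]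
  convert! h4 using 1
  funext d
  rcases Nat.eq_zero_or_pos d with rfl | hd
  · simp
  · rw [LSeries.term_of_ne_zero hd.ne']
    simp only [Function.comp, Pi.mul_apply]
    by_cases hc : Nat.Coprime d u
    · have : χ (d : ZMod u) = 1 := MulChar.one_apply ((ZMod.isUnit_iff_coprime d u).2 hc)
      rw [if_pos hc, this, one_mul]
      push_cast
      norm_cast
    · have : χ (d : ZMod u) = 0 :=
        MulChar.map_nonunit _ (fun h => hc ((ZMod.isUnit_iff_coprime d u).1 h))
      rw [if_neg hc, this]
      simp

/-- Mertens type bound. -/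
theorem c_mu_recip (N : ℕ) : |∑ d ∈ Finset.Icc 1 N, ((μ d : ℤ) : ℝ) / d| ≤ 1 := by
  rcases Nat.eq_zero_or_pos N with rfl | hN
  · simp
  have hN' : (0 : ℝ) < N := by exact_mod_cast hN
  have key : ∑ d ∈ Finset.Icc 1 N, ((μ d : ℤ) : ℝ) * ((N / d : ℕ) : ℝ) = 1 := by
    have h1 : ∀ d ∈ Finset.Icc 1 N, ((μ d : ℤ) : ℝ) * ((N / d : ℕ) : ℝ) =
        ∑ n ∈ Finset.Icc 1 N, if d ∣ n then ((μ d : ℤ) : ℝ) else 0 := by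
      intro d hd
      rw [← Finset.sum_filter, Finset.sum_const, nsmul_eq_mul, mul_comm]
      congr 2
      have := Nat.Ioc_filter_dvd_card_eq_div N d
      rw [← this]
      rfl
    rw [Finset.sum_congr rfl h1, Finset.sum_comm]
    have h2 : ∀ n ∈ Finset.Icc 1 N, (∑ d ∈ Finset.Icc 1 N, if d ∣ n then ((μ d : ℤ) : ℝ) else 0) =
        if n = 1 then 1 else 0 := by
      intro n hn
      rw [Finset.mem_Icc] at hn
      rw [← c_moebius_ind n (by omega), ← Finset.sum_filter]
      refine Finset.sum_congr ?_ fun _ _ => rfl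
      ext d
      simp only [Finset.mem_filter, Finset.mem_Icc, Nat.mem_divisors]
      constructor
      · rintro ⟨_, h⟩; exact ⟨h, by omega⟩
      · rintro ⟨h, _⟩
        have := Nat.le_of_dvd (by omega) h
        have := Nat.pos_of_dvd_of_pos h (by omega)
        exact ⟨⟨by omega, by omega⟩, h⟩
    rw [Finset.sum_congr rfl h2, Finset.sum_ite_eq' ]
    simp; omega
  have hmu : ∀ d, |((μ d : ℤ) : ℝ)| ≤ 1 := fun d => by
    exact_mod_cast ArithmeticFunction.abs_moebius_le_one (n := d)
  have h3 : (N : ℝ) * ∑ d ∈ Finset.Icc 1 N, ((μ d : ℤ) : ℝ) / d =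
      1 + ∑ d ∈ Finset.Icc 1 N, ((μ d : ℤ) : ℝ) * ((N : ℝ) / d - ((N / d : ℕ) : ℝ)) := by
    rw [← key, ← Finset.sum_add_distrib, Finset.mul_sum]
    refine Finset.sum_congr rfl fun d _ => ?_
    ring
  have h4 : |∑ d ∈ Finset.Icc 1 N, ((μ d : ℤ) : ℝ) * ((N : ℝ) / d - ((N / d : ℕ) : ℝ))| ≤ N - 1 := by
    obtain ⟨M, rfl⟩ : ∃ M, N = M + 1 := ⟨N - 1, by omega⟩
    rw [Finset.sum_Icc_succ_top (by omega)]
    rw [Nat.div_self (by omega), div_self (by positivity)]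
    simp only [Nat.cast_one, sub_self, mul_zero, add_zero]
    refine (Finset.abs_sum_le_sum_abs _ _).trans ?_
    refine (Finset.sum_le_sum (g := fun _ => (1 : ℝ)) fun d hd => ?_).trans ?_
    · rw [Finset.mem_Icc] at hd
      rw [abs_mul]
      refine mul_le_one₀ (hmu d) (abs_nonneg _) ?_
      have e : (((M + 1) / d : ℕ) : ℝ) = ((⌊((M + 1 : ℕ) : ℝ) / (d : ℝ)⌋₊ : ℕ) : ℝ) := by
        rw [Nat.floor_div_natCast, Nat.floor_natCast]
      rw [e, abs_le]
      have a1 := Nat.floor_le (a := ((M + 1 : ℕ) : ℝ) / (d : ℝ)) (by positivity)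
      have a2 := Nat.lt_floor_add_one (((M + 1 : ℕ) : ℝ) / (d : ℝ))
      constructor <;> linarith
    · simp
  have h5 : |(N : ℝ) * ∑ d ∈ Finset.Icc 1 N, ((μ d : ℤ) : ℝ) / d| ≤ N := by
    rw [h3]
    refine (abs_add_le _ _).trans ?_
    rw [abs_one]
    linarith
  rw [abs_mul, abs_of_pos hN'] at h5
  by_contra hcon
  push Not at hcon
  nlinarith

end PartC1

section PartC2
open scoped ArithmeticFunction.Moebius

theorem c_sum_dvd (N δ : ℕ) (hδ : 0 < δ) (g : ℕ → ℝ) :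
    (∑ e ∈ Finset.Icc 1 N, if δ ∣ e then g e else 0) = ∑ e ∈ Finset.Icc 1 (N / δ), g (δ * e) := by
  rw [← Finset.sum_filter]
  symm
  refine Finset.sum_nbij (fun e => δ * e) ?_ ?_ ?_ ?_
  · intro e he
    simp only [Finset.mem_filter, Finset.mem_Icc] at he ⊢
    rw [Nat.le_div_iff_mul_le hδ] at he
    exact ⟨⟨Nat.mul_pos hδ he.1, by linarith [mul_comm e δ]⟩, dvd_mul_right _ _⟩
  · intro a _ b _ hab
    exact Nat.eq_of_mul_eq_mul_left hδ hab
  · intro e he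
    simp only [Finset.coe_filter, Finset.mem_Icc, Set.mem_ofPred_eq] at he
    obtain ⟨⟨h1, h2⟩, c, rfl⟩ := he
    refine ⟨c, ?_, rfl⟩
    simp only [Finset.coe_Icc, Set.mem_Icc]
    rw [Nat.le_div_iff_mul_le hδ]
    exact ⟨Nat.pos_of_mul_pos_left h1 , by linarith [mul_comm c δ]⟩
  · intro _ _; rfl

theorem c_Tu (u : ℕ) (hu : 0 < u) (y : ℝ) (hy : 0 ≤ y) :
    ∃ err : ℝ, |err| ≤ ((∑ d ∈ u.divisors, d : ℕ) : ℝ) / 8 ∧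
      (∑ e ∈ Finset.Icc 1 ⌊y⌋₊, if Nat.Coprime e u then (y - e) else 0) =
        (Nat.totient u : ℝ) / u * y ^ 2 / 2 - (if u = 1 then 1 else 0) * (y / 2) + err := by
  choose ψ h0 h1 h2 using fun δ : ℕ => c_Tsum (y / δ) (by positivity)
  refine ⟨∑ δ ∈ u.divisors, ((μ δ : ℤ) : ℝ) * (δ * ψ δ), ?_, ?_⟩
  · refine (Finset.abs_sum_le_sum_abs _ _).trans ?_
    push_cast
    rw [Finset.sum_div]
    refine Finset.sum_le_sum fun δ _ => ?_
    have hmu : |((μ δ : ℤ) : ℝ)| ≤ 1 := by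
      exact_mod_cast ArithmeticFunction.abs_moebius_le_one (n := δ)
    rw [abs_mul, abs_of_nonneg (mul_nonneg (Nat.cast_nonneg δ) (h0 δ))]
    have a : (δ : ℝ) * ψ δ ≤ δ / 8 := by
      have := mul_le_mul_of_nonneg_left (h1 δ) (Nat.cast_nonneg (α := ℝ) δ)
      linarith
    have b : 0 ≤ (δ : ℝ) * ψ δ := mul_nonneg (Nat.cast_nonneg δ) (h0 δ)
    nlinarith
  · have e1 : ∀ e ∈ Finset.Icc 1 ⌊y⌋₊, (if Nat.Coprime e u then (y - e) else 0) =
        ∑ δ ∈ u.divisors, if δ ∣ e then ((μ δ : ℤ) : ℝ) * (y - e) else 0 := by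
      intro e _
      have := c_coprime_ind e u hu
      rw [show (if Nat.Coprime e u then (y - e) else 0) =
        (if Nat.Coprime e u then (1 : ℝ) else 0) * (y - e) by split_ifs <;> simp, this,
        Finset.sum_mul]
      refine Finset.sum_congr rfl fun δ _ => ?_
      split_ifs <;> simp
    rw [Finset.sum_congr rfl e1, Finset.sum_comm]
    have e2 : ∀ δ ∈ u.divisors, (∑ e ∈ Finset.Icc 1 ⌊y⌋₊,
        if δ ∣ e then ((μ δ : ℤ) : ℝ) * (y - e) else 0) =
        (((μ δ : ℤ) : ℝ) / δ) * (y ^ 2 / 2) - ((μ δ : ℤ) : ℝ) * (y / 2)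
          + ((μ δ : ℤ) : ℝ) * (δ * ψ δ) := by
      intro δ hδ
      have hδ0 := Nat.pos_of_mem_divisors hδ
      have hδR : (δ : ℝ) ≠ 0 := by positivity
      rw [c_sum_dvd _ _ hδ0 (fun e => ((μ δ : ℤ) : ℝ) * (y - e))]
      have h3 := h2 δ
      rw [Nat.floor_div_natCast] at h3
      have : ∑ e ∈ Finset.Icc 1 (⌊y⌋₊ / δ), ((μ δ : ℤ) : ℝ) * (y - ((δ * e : ℕ) : ℝ)) =
          ((μ δ : ℤ) : ℝ) * δ * ∑ e ∈ Finset.Icc 1 (⌊y⌋₊ / δ), (y / δ - e) := by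
        rw [Finset.mul_sum]
        refine Finset.sum_congr rfl fun e _ => ?_
        push_cast
        field_simp
      rw [this, h3]
      field_simp
    rw [Finset.sum_congr rfl e2, Finset.sum_add_distrib, Finset.sum_sub_distrib, ← Finset.sum_mul,
      ← Finset.sum_mul, c_moebius_ind u hu.ne', c_totient_div u hu]
    ring

theorem c_G_eq (u : ℕ) (hu : 0 < u) (Y : ℝ) :
    (∑ n ∈ Finset.Icc 1 ⌊Y⌋₊, if Nat.Coprime n u then (Nat.totient n : ℝ) * (Y / n - 1) else 0) =
    ∑ d ∈ Finset.Icc 1 ⌊Y⌋₊, (if Nat.Coprime d u then ((μ d : ℤ) : ℝ) else 0) *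
      ∑ e ∈ Finset.Icc 1 ⌊Y / d⌋₊, if Nat.Coprime e u then (Y / d - e) else 0 := by
  have e1 : ∀ n ∈ Finset.Icc 1 ⌊Y⌋₊,
      (if Nat.Coprime n u then (Nat.totient n : ℝ) * (Y / n - 1) else 0) =
      ∑ d ∈ Finset.Icc 1 ⌊Y⌋₊, if d ∣ n then
        (if Nat.Coprime n u then ((μ d : ℤ) : ℝ) * (Y / d - n / d) else 0) else 0 := by
    intro n hn
    rw [Finset.mem_Icc] at hn
    have hn0 : (n : ℝ) ≠ 0 := by
      have : 0 < n := by omega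
      positivity
    rw [← Finset.sum_filter]
    have : (Finset.Icc 1 ⌊Y⌋₊).filter (fun d => d ∣ n) = n.divisors := by
      ext d
      simp only [Finset.mem_filter, Finset.mem_Icc, Nat.mem_divisors]
      constructor
      · rintro ⟨_, h⟩; exact ⟨h, by omega⟩
      · rintro ⟨h, _⟩
        have := Nat.le_of_dvd (by omega) h
        have := Nat.pos_of_dvd_of_pos h (by omega)
        exact ⟨⟨by omega, by omega⟩, h⟩
    rw [this]
    by_cases hc : Nat.Coprime n u
    · simp only [if_pos hc]
      have h := c_totient_div n (by omega)
      rw [show (Nat.totient n : ℝ) * (Y / n - 1) = (Nat.totient n : ℝ) / n * (Y - n) by field_simp,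
        h, Finset.sum_mul]
      refine Finset.sum_congr rfl fun d hd => ?_
      ring
    · simp [if_neg hc]
  rw [Finset.sum_congr rfl e1, Finset.sum_comm]
  refine Finset.sum_congr rfl fun d hd => ?_
  rw [Finset.mem_Icc] at hd
  have hd0 : 0 < d := by omega
  rw [c_sum_dvd _ _ hd0 (fun n => if Nat.Coprime n u then ((μ d : ℤ) : ℝ) * (Y / d - n / d) else 0),
    Nat.floor_div_natCast, Finset.mul_sum]
  refine Finset.sum_congr rfl fun e _ => ?_
  have hdR : (d : ℝ) ≠ 0 := by positivity
  simp only [Nat.coprime_mul_iff_left]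
  by_cases h1 : Nat.Coprime d u
  · by_cases h2 : Nat.Coprime e u
    · rw [if_pos ⟨h1, h2⟩, if_pos h1, if_pos h2]
      push_cast
      field_simp
    · rw [if_neg (fun h => h2 h.2), if_neg h2, mul_zero]
  · rw [if_neg (fun h => h1 h.1), if_neg h1, zero_mul]

theorem c_tail (N M : ℕ) (h : N ≤ M) :
    ∑ d ∈ Finset.Ioc N M, 1 / (d : ℝ) ^ 2 ≤ 1 / ((N : ℝ) + 1) ^ 2 + 1 / ((N : ℝ) + 1) := by
  rcases h.eq_or_lt with rfl | h
  · simp; positivity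
  have : ∑ d ∈ Finset.Ioc N M, 1 / (d : ℝ) ^ 2 ≤
      1 / ((N : ℝ) + 1) ^ 2 + 1 / ((N : ℝ) + 1) - 1 / M := by
    induction M, h using Nat.le_induction with
    | base => simp
    | succ M hM ih =>
      have hM0 : (0 : ℝ) < M := by
        have : 0 < M := by omega
        exact_mod_cast this
      rw [Finset.sum_Ioc_succ_top (by omega)]
      have a := ih (by omega)
      have : 1 / ((M + 1 : ℕ) : ℝ) ^ 2 ≤ 1 / M - 1 / ((M + 1 : ℕ) : ℝ) := by
        push_cast
        rw [div_sub_div _ _ (by positivity) (by positivity), div_le_div_iff₀ (by positivity) (by positivity)]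
        nlinarith
      linarith
  have : (0 : ℝ) ≤ 1 / M := by positivity
  linarith

theorem c_tail_one (N M : ℕ) (h : N ≤ M) :
    ∑ d ∈ Finset.Ioc N M, ((μ d : ℤ) : ℝ) / (d : ℝ) ^ 2 ≤
      (1 - ∑ d ∈ Finset.Icc 1 N, ((μ d : ℤ) : ℝ) / d) / ((N : ℝ) + 1) := by
  set m : ℕ → ℝ := fun N => ∑ d ∈ Finset.Icc 1 N, ((μ d : ℤ) : ℝ) / d with hm
  have hm1 : ∀ N, m N ≤ 1 := fun N => (abs_le.1 (c_mu_recip N)).2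
  have key : ∑ d ∈ Finset.Ioc N M, ((μ d : ℤ) : ℝ) / (d : ℝ) ^ 2 - m M / ((M : ℝ) + 1) ≤
      1 / ((N : ℝ) + 1) - 1 / ((M : ℝ) + 1) - m N / ((N : ℝ) + 1) := by
    induction M, h using Nat.le_induction with
    | base => simp
    | succ M hM ih =>
      rw [Finset.sum_Ioc_succ_top (by omega)]
      have h1 : m (M + 1) = m M + ((μ (M + 1) : ℤ) : ℝ) / ((M + 1 : ℕ) : ℝ) := by
        rw [hm]; simp only
        rw [Finset.sum_Icc_succ_top (by omega)]
      have h2 : ((μ (M + 1) : ℤ) : ℝ) / ((M + 1 : ℕ) : ℝ) ^ 2 =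
          (m (M + 1) - m M) / ((M : ℝ) + 1) := by
        rw [h1]; push_cast; field_simp; ring
      rw [h2]
      have h3 : 0 ≤ (1 - m (M + 1)) * (1 / ((M : ℝ) + 1) - 1 / (((M + 1 : ℕ) : ℝ) + 1)) := by
        refine mul_nonneg (by linarith [hm1 (M + 1)]) ?_
        push_cast
        rw [sub_nonneg]
        exact one_div_le_one_div_of_le (by positivity) (by linarith)
      have h4 : (m (M + 1) - m M) / ((M : ℝ) + 1) = m (M+1) * (1 / ((M : ℝ) + 1)) - m M / ((M : ℝ) + 1) := by ring
      have h5 : m (M + 1) / (((M + 1 : ℕ) : ℝ) + 1) = m (M + 1) * (1 / (((M + 1 : ℕ) : ℝ) + 1)) := by ring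
      rw [h4, h5]
      linarith
  have : m M / ((M : ℝ) + 1) ≤ 1 / ((M : ℝ) + 1) :=
    div_le_div_of_nonneg_right (hm1 M) (by positivity)
  rw [sub_div]
  linarith

theorem c_totient_sum (u : ℕ) (hu : Squarefree u) (Y : ℝ) (hY : 1 ≤ Y) :
    3 / Real.pi ^ 2 * (u / ((∑ d ∈ u.divisors, d : ℕ) : ℝ)) * Y ^ 2
      - ((∑ d ∈ u.divisors, d : ℕ) : ℝ) / 8 * Y - (Nat.totient u : ℝ) / (2 * u) * (Y + 1) ≤
    ∑ n ∈ Finset.Icc 1 ⌊Y⌋₊, if Nat.Coprime n u then (Nat.totient n : ℝ) * (Y / n - 1) else 0 := by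
  have hu0 : 0 < u := Nat.pos_of_ne_zero hu.ne_zero
  rw [c_G_eq u hu0]
  set σ : ℝ := ((∑ d ∈ u.divisors, d : ℕ) : ℝ) with hσ
  set N := ⌊Y⌋₊ with hN
  have hφ : (0 : ℝ) < Nat.totient u := by exact_mod_cast Nat.totient_pos.2 hu0
  have hσ0 : (0 : ℝ) < σ := by
    rw [hσ, c_sigma_prod u hu]
    exact Finset.prod_pos fun p _ => by positivity
  have huR : (0 : ℝ) < u := by exact_mod_cast hu0
  choose err he1 he2 using fun d : ℕ => c_Tu u hu0 (Y / d) (by positivity)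
  have hN1 : (N : ℝ) ≤ Y := Nat.floor_le (by linarith)
  have hN2 : Y < N + 1 := Nat.lt_floor_add_one Y
  set S : ℕ → ℝ := fun M => ∑ d ∈ Finset.Icc 1 M,
    if Nat.Coprime d u then ((μ d : ℤ) : ℝ) / (d : ℝ) ^ 2 else 0 with hS
  set m1 : ℝ := ∑ d ∈ Finset.Icc 1 N, if Nat.Coprime d u then ((μ d : ℤ) : ℝ) / d else 0 with hm1
  have hexp : (∑ d ∈ Finset.Icc 1 N, (if Nat.Coprime d u then ((μ d : ℤ) : ℝ) else 0) *
      ∑ e ∈ Finset.Icc 1 ⌊Y / d⌋₊, if Nat.Coprime e u then (Y / d - e) else 0) =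
      (Nat.totient u : ℝ) / (2 * u) * Y ^ 2 * S N - (if u = 1 then 1 else 0) * (Y / 2) * m1 +
      ∑ d ∈ Finset.Icc 1 N, (if Nat.Coprime d u then ((μ d : ℤ) : ℝ) else 0) * err d := by
    rw [hS, hm1]
    simp only
    rw [Finset.mul_sum, Finset.mul_sum, ← Finset.sum_sub_distrib, ← Finset.sum_add_distrib]
    refine Finset.sum_congr rfl fun d hd => ?_
    rw [Finset.mem_Icc] at hd
    have hdR : (d : ℝ) ≠ 0 := by
      have : 0 < d := by omega
      positivity
    rw [he2 d]
    split_ifs <;> field_simp <;> ring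
  rw [hexp]
  have herr : |∑ d ∈ Finset.Icc 1 N, (if Nat.Coprime d u then ((μ d : ℤ) : ℝ) else 0) * err d| ≤
      σ / 8 * Y := by
    refine (Finset.abs_sum_le_sum_abs _ _).trans ?_
    refine (Finset.sum_le_sum (g := fun _ => σ / 8) fun d _ => ?_).trans ?_
    · have hmu : |((μ d : ℤ) : ℝ)| ≤ 1 := by
        exact_mod_cast ArithmeticFunction.abs_moebius_le_one (n := d)
      rw [abs_mul]
      have a : |if Nat.Coprime d u then ((μ d : ℤ) : ℝ) else 0| ≤ 1 := by
        split_ifs <;> simp [hmu]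
      have := he1 d
      nlinarith [abs_nonneg (err d), abs_nonneg (if Nat.Coprime d u then ((μ d : ℤ) : ℝ) else 0)]
    · simp only [Finset.sum_const, Nat.card_Icc, nsmul_eq_mul]
      rw [mul_comm]
      exact mul_le_mul_of_nonneg_left (by simpa using hN1) (by positivity)
  have herr' := (abs_le.1 herr).1
  set Lim : ℝ := 6 / Real.pi ^ 2 * (u : ℝ) ^ 2 / ((Nat.totient u : ℝ) * σ) with hLim
  have hten : Filter.Tendsto S Filter.atTop (nhds Lim) := by
    have := (c_moebius_limit u hu).tendsto_sum_nat
    have h2 := this.comp (Filter.tendsto_add_atTop_nat 1)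
    refine h2.congr fun M => ?_
    simp only [Function.comp, hS]
    rw [Finset.sum_range_eq_add_Ico _ (by omega)]
    simp only [ArithmeticFunction.map_zero, Int.cast_zero, zero_div, ite_self, zero_add]
    rfl
  have hmain : Y ^ 2 * (Lim - S N) + (if u = 1 then 1 else 0) * Y * m1 ≤ Y + 1 := by
    have hsub : ∀ M, N ≤ M → S M - S N = ∑ d ∈ Finset.Ioc N M,
        if Nat.Coprime d u then ((μ d : ℤ) : ℝ) / (d : ℝ) ^ 2 else 0 := by
      intro M hM
      rw [hS]; simp only
      have := Finset.sum_Ioc_consecutive (fun d : ℕ => if Nat.Coprime d u then ((μ d : ℤ) : ℝ) / (d : ℝ) ^ 2 else 0)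
        (Nat.zero_le N) hM
      rw [sub_eq_iff_eq_add']
      exact this.symm
    by_cases h1 : u = 1
    · have hb : Lim - S N ≤ (1 - m1) / ((N : ℝ) + 1) := by
        refine le_of_tendsto (hten.sub_const (S N)) ?_
        filter_upwards [Filter.eventually_ge_atTop N] with M hM
        rw [hsub M hM, hm1]
        simpa [h1] using c_tail_one N M hM
      have hm1' : m1 ≤ 1 := by
        have := (abs_le.1 (c_mu_recip N)).2
        rw [hm1]; simpa [h1] using this
      rw [if_pos h1]
      have : Y ^ 2 * (Lim - S N) ≤ Y * (1 - m1) := by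
        calc Y ^ 2 * (Lim - S N) ≤ Y ^ 2 * ((1 - m1) / ((N : ℝ) + 1)) :=
              mul_le_mul_of_nonneg_left hb (by positivity)
          _ = Y * (1 - m1) * (Y / ((N : ℝ) + 1)) := by ring
          _ ≤ Y * (1 - m1) * 1 := by
              refine mul_le_mul_of_nonneg_left ?_ (mul_nonneg (by linarith) (by linarith))
              rw [div_le_one (by positivity)]; exact hN2.le
          _ = _ := by ring
      linarith
    · have hb : Lim - S N ≤ 1 / ((N : ℝ) + 1) ^ 2 + 1 / ((N : ℝ) + 1) := by
        refine le_of_tendsto (hten.sub_const (S N)) ?_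
        filter_upwards [Filter.eventually_ge_atTop N] with M hM
        rw [hsub M hM]
        refine le_trans (Finset.sum_le_sum fun d _ => ?_) (c_tail N M hM)
        have hmu : ((μ d : ℤ) : ℝ) ≤ 1 := by
          exact_mod_cast (abs_le.1 (ArithmeticFunction.abs_moebius_le_one (n := d))).2
        split_ifs
        · exact div_le_div_of_nonneg_right hmu (by positivity)
        · positivity
      rw [if_neg h1]
      have hY0 : 0 < Y := by linarith
      have h2 : 1 / ((N : ℝ) + 1) ^ 2 ≤ 1 / Y ^ 2 :=
        one_div_le_one_div_of_le (by positivity) (pow_le_pow_left₀ hY0.le hN2.le 2)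
      have h3 : 1 / ((N : ℝ) + 1) ≤ 1 / Y := one_div_le_one_div_of_le hY0 hN2.le
      have : Y ^ 2 * (Lim - S N) ≤ Y ^ 2 * (1 / Y ^ 2 + 1 / Y) :=
        mul_le_mul_of_nonneg_left (by linarith) (by positivity)
      have h4 : Y ^ 2 * (1 / Y ^ 2 + 1 / Y) = Y + 1 := by field_simp; ring
      linarith
  have hL : (Nat.totient u : ℝ) / (2 * u) * Y ^ 2 * Lim = 3 / Real.pi ^ 2 * (u / σ) * Y ^ 2 := by
    have := Real.pi_pos
    rw [hLim]; field_simp; norm_num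
  have hfin : (Nat.totient u : ℝ) / (2 * u) * (Y ^ 2 * (Lim - S N)) +
      (if u = 1 then 1 else 0) * (Y / 2) * m1 ≤ (Nat.totient u : ℝ) / (2 * u) * (Y + 1) := by
    have h1 := mul_le_mul_of_nonneg_left hmain (show 0 ≤ (Nat.totient u : ℝ) / (2 * u) by positivity)
    refine le_trans (le_of_eq ?_) h1
    by_cases h1 : u = 1
    · subst h1; simp; ring
    · simp [h1]
  rw [← hL]
  linarith

end PartC2

section PartD1
theorem cube_root_re (z : ℂ) (hz : z ^ 3 = 1) (hz1 : z ≠ 1) : z.re = -1 / 2 := by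
  have h : z ^ 2 + z + 1 = 0 := by
    have : (z - 1) * (z ^ 2 + z + 1) = 0 := by linear_combination hz
    rcases mul_eq_zero.1 this with h | h
    · exact absurd (sub_eq_zero.1 h) hz1
    · exact h
  have hre := congrArg Complex.re h
  have him := congrArg Complex.im h
  simp [pow_two] at hre him
  have : z.im * (2 * z.re + 1) = 0 := by linarith
  rcases mul_eq_zero.1 this with h0 | h0
  · rw [h0] at hre; nlinarith [sq_nonneg (z.re + 1 / 2)]
  · linarith

theorem cubic_neg_one (f : ℕ) [Fact f.Prime] (χ : MulChar (ZMod f) ℂ) (hχ : orderOf χ = 3) :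
    χ (-1) = 1 := by
  have h3 := cubic_pow_three f χ hχ (-1) (by simp)
  have h2 : χ (-1) ^ 2 = 1 := by rw [← map_pow]; simp
  calc χ (-1) = χ (-1) ^ 3 := by rw [pow_succ, h2, one_mul]
    _ = 1 := h3

theorem cubic_natAbs (f : ℕ) [Fact f.Prime] (χ : MulChar (ZMod f) ℂ) (hχ : orderOf χ = 3) (a : ℤ) :
    χ ((a.natAbs : ℕ) : ZMod f) = χ (a : ZMod f) := by
  rcases Int.natAbs_eq a with h | h
  · conv_rhs => rw [h]
    simp
  · conv_rhs => rw [h]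
    rw [Int.cast_neg, Int.cast_natCast, neg_eq_neg_one_mul, map_mul, cubic_neg_one f χ hχ, one_mul]

theorem term_lemma (f : ℕ) [Fact f.Prime] (χ : MulChar (ZMod f) ℂ) (hχ : orderOf χ = 3)
    (ω : ℂ) (hω : ω ^ 3 = 1) (u v : ℕ) (hv : 0 < v) (H : ℝ) (hHf : H < f)
    (hno : ∀ m : ℕ, 0 < m → (m : ℝ) ≤ H → Nat.Coprime m (u * v) → χ (m : ZMod f) ≠ ω)
    (a : ℤ) (hau : IsCoprime a u) (haH : |(a : ℝ)| ≤ H) :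
    (starRingEnd ℂ ω * χ (a : ZMod f)).re ≤ -1 / 2 +
      3 / 2 * ((v.primeFactors.filter (fun p : ℕ => (p : ℤ) ∣ a)).card : ℝ) +
      1 / 2 * (if a = 0 then 1 else 0) := by
  by_cases ha : a = 0
  · subst ha
    have : (0 : ℝ) ≤ ((v.primeFactors.filter (fun p : ℕ => (p : ℤ) ∣ 0)).card : ℝ) := by positivity
    rw [Int.cast_zero, χ.map_zero, mul_zero, if_pos rfl, Complex.zero_re]
    linarith
  rw [if_neg ha]
  have hnorm : ‖ω‖ = 1 := by
    have : ‖ω‖ ^ 3 = 1 := by rw [← norm_pow, hω, norm_one]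
    exact (pow_eq_one_iff_of_nonneg (norm_nonneg _) (by norm_num)).1 this
  have hconj : starRingEnd ℂ ω * ω = 1 := by
    rw [mul_comm, Complex.mul_conj, Complex.normSq_eq_norm_sq, hnorm]; simp
  have hm0 : 0 < a.natAbs := Int.natAbs_pos.2 ha
  have hmR : ((a.natAbs : ℕ) : ℝ) = |(a : ℝ)| := by
    rw [Nat.cast_natAbs]; simp
  by_cases hcop : (v.primeFactors.filter (fun p : ℕ => (p : ℤ) ∣ a)).card = 0
  · rw [hcop]
    rw [Finset.card_eq_zero, Finset.filter_eq_empty_iff] at hcop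
    have hcv : Nat.Coprime a.natAbs v := by
      rw [Nat.coprime_iff_gcd_eq_one]
      by_contra hne
      obtain ⟨p, hp, hpd⟩ := Nat.exists_prime_and_dvd hne
      refine hcop (x := p) ?_ ?_
      · exact Nat.mem_primeFactors.2 ⟨hp, hpd.trans (Nat.gcd_dvd_right _ _), hv.ne'⟩
      · exact Int.natCast_dvd.2 (hpd.trans (Nat.gcd_dvd_left _ _))
    have hcu : Nat.Coprime a.natAbs u := by
      have := Int.isCoprime_iff_gcd_eq_one.1 hau
      simpa [Int.gcd] using this
    have hne := hno a.natAbs hm0 (by rw [hmR]; exact haH) (Nat.Coprime.mul_right hcu hcv)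
    rw [cubic_natAbs f χ hχ] at hne
    have hχ3 : χ (a : ZMod f) ^ 3 = 1 := by
      apply cubic_pow_three f χ hχ
      rw [Ne, ZMod.intCast_zmod_eq_zero_iff_dvd]
      intro hd
      have := Int.natCast_dvd.1 hd
      have h1 := Nat.le_of_dvd hm0 this
      have h2 : (f : ℝ) ≤ (a.natAbs : ℝ) := by exact_mod_cast h1
      rw [hmR] at h2
      linarith
    rw [cube_root_re _ (by
      rw [mul_pow, hχ3, ← map_pow, hω]; simp) (by
      intro h1
      apply hne
      calc χ (a : ZMod f) = (starRingEnd ℂ ω * ω) * χ (a : ZMod f) := by rw [hconj, one_mul]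
        _ = ω * (starRingEnd ℂ ω * χ (a : ZMod f)) := by ring
        _ = ω := by rw [h1, mul_one])]
    norm_num
  · have h1 : (1 : ℝ) ≤ ((v.primeFactors.filter (fun p : ℕ => (p : ℤ) ∣ a)).card : ℝ) := by
      exact_mod_cast Nat.one_le_iff_ne_zero.2 hcop
    have h2 : (starRingEnd ℂ ω * χ (a : ZMod f)).re ≤ 1 := by
      refine (Complex.re_le_norm _).trans ?_
      rw [norm_mul, RCLike.norm_conj, hnorm, one_mul]
      exact cubic_norm_le f χ hχ _
    linarith

theorem block_lemma (f : ℕ) [Fact f.Prime] (χ : MulChar (ZMod f) ℂ) (hχ : orderOf χ = 3)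
    (ω : ℂ) (hω : ω ^ 3 = 1) (h u v : ℕ) (hv : 0 < v)
    (hvP : ∀ p : ℕ, p.Prime → p ∣ v → h ≤ p) (H : ℝ) (hHf : H < f)
    (hno : ∀ m : ℕ, 0 < m → (m : ℝ) ≤ H → Nat.Coprime m (u * v) → χ (m : ZMod f) ≠ ω)
    (a b : ℤ) (hub : (u : ℤ) ∣ b) (hab : IsCoprime a b)
    (haH : ∀ j < h, |((a + b * (j : ℕ) : ℤ) : ℝ)| ≤ H) :
    (starRingEnd ℂ ω * ∑ j ∈ Finset.range h, χ ((a + b * (j : ℕ) : ℤ) : ZMod f)).re ≤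
      -((h : ℝ) - 3 * (v.primeFactors.card : ℝ)) / 2 +
      1 / 2 * ∑ j ∈ Finset.range h, (if a + b * (j : ℕ) = 0 then (1 : ℝ) else 0) := by
  rw [Finset.mul_sum, Complex.re_sum]
  have hcop : ∀ j : ℕ, IsCoprime (a + b * (j : ℕ)) b := fun j => by
    rw [mul_comm]; exact IsCoprime.add_mul_right_left_iff.2 hab
  have h1 : ∀ j ∈ Finset.range h, (starRingEnd ℂ ω * χ ((a + b * (j : ℕ) : ℤ) : ZMod f)).re ≤
      -1 / 2 + 3 / 2 * ((v.primeFactors.filter (fun p : ℕ => (p : ℤ) ∣ a + b * (j : ℕ))).card : ℝ) +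
      1 / 2 * (if a + b * (j : ℕ) = 0 then 1 else 0) := by
    intro j hj
    exact term_lemma f χ hχ ω hω u v hv H hHf hno _ ((hcop j).of_isCoprime_of_dvd_right hub)
      (haH j (Finset.mem_range.1 hj))
  refine (Finset.sum_le_sum h1).trans ?_
  rw [Finset.sum_add_distrib, Finset.sum_add_distrib, ← Finset.mul_sum, ← Finset.mul_sum]
  have h2 : ∑ j ∈ Finset.range h,
      ((v.primeFactors.filter (fun p : ℕ => (p : ℤ) ∣ a + b * (j : ℕ))).card : ℝ) ≤
      v.primeFactors.card := by
    have : ∑ j ∈ Finset.range h,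
      ((v.primeFactors.filter (fun p : ℕ => (p : ℤ) ∣ a + b * (j : ℕ))).card) ≤
      v.primeFactors.card := by
      simp only [Finset.card_filter]
      rw [Finset.sum_comm]
      rw [Finset.card_eq_sum_ones]
      refine Finset.sum_le_sum fun p hp => ?_
      rw [← Finset.card_filter, Finset.card_le_one]
      have hpp := Nat.prime_of_mem_primeFactors hp
      have hph := hvP p hpp (Nat.dvd_of_mem_primeFactors hp)
      intro i hi j hj
      simp only [Finset.mem_filter, Finset.mem_range] at hi hj
      have hd : (p : ℤ) ∣ b * ((i : ℤ) - j) := by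
        have := dvd_sub hi.2 hj.2
        have e : a + b * (i : ℕ) - (a + b * (j : ℕ)) = b * ((i : ℤ) - j) := by ring
        rwa [e] at this
      rcases (Nat.prime_iff_prime_int.1 hpp).dvd_or_dvd hd with hb | hij
      · exfalso
        have := (hcop i).of_isCoprime_of_dvd_left hi.2
        have h3 := this.of_isCoprime_of_dvd_right hb
        exact (Nat.prime_iff_prime_int.1 hpp).not_isUnit (isCoprime_self.1 h3)
      · by_contra hne
        have h4 := Int.le_of_dvd (abs_pos.2 (by omega) : (0 : ℤ) < |(i : ℤ) - j|) ((dvd_abs _ _).2 hij)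
        have : |(i : ℤ) - j| < h := by rw [abs_lt]; constructor <;> omega
        omega
    exact_mod_cast this
  have h3 : ∑ j ∈ Finset.range h, (-1 / 2 : ℝ) = -h / 2 := by
    rw [Finset.sum_const, Finset.card_range, nsmul_eq_mul]; ring
  rw [h3]
  linarith

end PartD1

section PartD2
/-- The block starting points attached to the fraction `t/q`. -/
noncomputable def blk (f h : ℕ) (H : ℝ) (q t : ℕ) : Finset ℤ :=
  Finset.Icc ⌊(t : ℝ) * f / q⌋ (⌊((t : ℝ) * f + H) / q⌋ - h) ∪
    Finset.Icc (⌈((t : ℝ) * f - H) / q⌉ - 1) (⌈(t : ℝ) * f / q⌉ - 1 - h)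

theorem blk_mem (f h : ℕ) (H : ℝ) (q t : ℕ) (hq : 0 < q) (x : ℤ) (hx : x ∈ blk f h H q t) :
    ((t : ℝ) * f < q * (x + 1) ∧ (q : ℝ) * (x + h) ≤ t * f + H) ∨
    ((t : ℝ) * f - H ≤ q * (x + 1) ∧ (q : ℝ) * (x + h) < t * f) := by
  have hq' : (0 : ℝ) < q := by exact_mod_cast hq
  rw [blk, Finset.mem_union, Finset.mem_Icc, Finset.mem_Icc] at hx
  rcases hx with ⟨h1, h2⟩ | ⟨h1, h2⟩
  · left
    have h3 : ⌊(t : ℝ) * f / q⌋ < x + 1 := by omega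
    have h4 : x + h ≤ ⌊((t : ℝ) * f + H) / q⌋ := by omega
    rw [Int.floor_lt, div_lt_iff₀ hq'] at h3
    rw [Int.le_floor, le_div_iff₀ hq'] at h4
    push_cast at h3 h4
    constructor <;> nlinarith
  · right
    have h3 : ⌈((t : ℝ) * f - H) / q⌉ ≤ x + 1 := by omega
    have h4 : x + h < ⌈(t : ℝ) * f / q⌉ := by omega
    rw [Int.ceil_le, div_le_iff₀ hq'] at h3
    rw [Int.lt_ceil, lt_div_iff₀ hq'] at h4
    push_cast at h3 h4
    constructor <;> nlinarith

theorem blk_card (f h : ℕ) (hh : 0 < h) (H : ℝ) (q t : ℕ) (hq : 0 < q) :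
    2 * (H / q - h) ≤ ((blk f h H q t).card : ℝ) := by
  have hq' : (0 : ℝ) < q := by exact_mod_cast hq
  have hdis : Disjoint (Finset.Icc ⌊(t : ℝ) * f / q⌋ (⌊((t : ℝ) * f + H) / q⌋ - h))
    (Finset.Icc (⌈((t : ℝ) * f - H) / q⌉ - 1) (⌈(t : ℝ) * f / q⌉ - 1 - h)) := by
    rw [Finset.disjoint_left]
    intro x hx hx'
    rw [Finset.mem_Icc] at hx hx'
    have := Int.ceil_le_floor_add_one ((t : ℝ) * f / q)
    omega
  rw [blk, Finset.card_union_of_disjoint hdis, Int.card_Icc, Int.card_Icc]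
  have e1 : ∀ z : ℤ, (z : ℝ) ≤ ((z.toNat : ℕ) : ℝ) := fun z => by
    exact_mod_cast Int.self_le_toNat z
  have h1 := e1 (⌊((t : ℝ) * f + H) / q⌋ - h + 1 - ⌊(t : ℝ) * f / q⌋)
  have h2 := e1 (⌈(t : ℝ) * f / q⌉ - 1 - h + 1 - (⌈((t : ℝ) * f - H) / q⌉ - 1))
  push_cast at h1 h2 ⊢
  have a1 := Int.floor_le ((t : ℝ) * f / q)
  have a2 := Int.lt_floor_add_one (((t : ℝ) * f + H) / q)
  have a3 := Int.le_ceil ((t : ℝ) * f / q)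
  have a4 := Int.ceil_lt_add_one (((t : ℝ) * f - H) / q)
  have a5 := add_div ((t : ℝ) * f) H q
  have a6 := sub_div ((t : ℝ) * f) H q
  linarith

theorem blk_value (f : ℕ) [Fact f.Prime] (χ : MulChar (ZMod f) ℂ) (hχ : orderOf χ = 3)
    (ω : ℂ) (hω : ω ^ 3 = 1) (h u v : ℕ) (hv : 0 < v)
    (hvP : ∀ p : ℕ, p.Prime → p ∣ v → h ≤ p) (H : ℝ) (hHf : H < f)
    (hno : ∀ m : ℕ, 0 < m → (m : ℝ) ≤ H → Nat.Coprime m (u * v) → χ (m : ZMod f) ≠ ω)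
    (q t : ℕ) (hq : 0 < q) (hqf : q < f) (huq : u ∣ q) (hqt : Nat.Coprime t q)
    (x : ℤ) (hx : x ∈ blk f h H q t) :
    ((h : ℝ) - 3 * (v.primeFactors.card : ℝ)) / 2 ≤
      ‖∑ j ∈ Finset.range h, χ ((x : ZMod f) + 1 + (j : ℕ))‖ := by
  have hq' : (0 : ℝ) < q := by exact_mod_cast hq
  have hfp : f.Prime := Fact.out
  have hmem := blk_mem f h H q t hq x hx
  have hval : ∀ j < h, |(((q : ℤ) * (x + 1) - t * f + (q : ℤ) * (j : ℕ) : ℤ) : ℝ)| ≤ H ∧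
      (q : ℤ) * (x + 1) - t * f + (q : ℤ) * (j : ℕ) ≠ 0 := by
    intro j hj
    have hj' : (j : ℝ) + 1 ≤ h := by exact_mod_cast hj
    have hj0 : (0 : ℝ) ≤ j := by positivity
    have hne : (((q : ℤ) * (x + 1) - t * f + (q : ℤ) * (j : ℕ) : ℤ) : ℝ) ≠ 0 →
      (q : ℤ) * (x + 1) - t * f + (q : ℤ) * (j : ℕ) ≠ 0 := fun h => by exact_mod_cast h
    refine ⟨?_, hne ?_⟩
    · push_cast
      rw [abs_le]
      rcases hmem with ⟨h1, h2⟩ | ⟨h1, h2⟩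
      · constructor <;> nlinarith
      · constructor <;> nlinarith
    · push_cast
      rcases hmem with ⟨h1, h2⟩ | ⟨h1, h2⟩
      · apply ne_of_gt; nlinarith
      · apply ne_of_lt; nlinarith
  have hcop : IsCoprime ((q : ℤ) * (x + 1) - t * f) (q : ℤ) := by
    have h1 : IsCoprime ((t : ℤ) * f) (q : ℤ) := by
      refine IsCoprime.mul_left (Nat.isCoprime_iff_coprime.2 hqt) (Nat.isCoprime_iff_coprime.2 ?_)
      exact (Nat.Prime.coprime_iff_not_dvd hfp).2 fun hd => by
        have := Nat.le_of_dvd hq hd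
        omega
    have h2 : IsCoprime (-((t : ℤ) * f) + (q : ℤ) * (x + 1)) (q : ℤ) :=
      IsCoprime.add_mul_left_left_iff.2 h1.neg_left
    have e : (q : ℤ) * (x + 1) - t * f = -((t : ℤ) * f) + (q : ℤ) * (x + 1) := by ring
    rwa [e]
  have hb := block_lemma f χ hχ ω hω h u v hv hvP H hHf hno _ _ (Int.natCast_dvd_natCast.2 huq) hcop
    (fun j hj => (hval j hj).1)
  have hz : ∑ j ∈ Finset.range h, (if (q : ℤ) * (x + 1) - t * f + (q : ℤ) * (j : ℕ) = 0
      then (1 : ℝ) else 0) = 0 :=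
    Finset.sum_eq_zero fun j hj => if_neg (hval j (Finset.mem_range.1 hj)).2
  rw [hz, mul_zero, add_zero] at hb
  have hχe : ∑ j ∈ Finset.range h, χ (((q : ℤ) * (x + 1) - t * f + (q : ℤ) * (j : ℕ) : ℤ) : ZMod f) =
      χ (q : ZMod f) * ∑ j ∈ Finset.range h, χ ((x : ZMod f) + 1 + (j : ℕ)) := by
    rw [Finset.mul_sum]
    refine Finset.sum_congr rfl fun j _ => ?_
    rw [← map_mul]
    congr 1
    push_cast
    rw [ZMod.natCast_self]
    ring
  rw [hχe] at hb
  have hnorm : ‖ω‖ = 1 := by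
    have : ‖ω‖ ^ 3 = 1 := by rw [← norm_pow, hω, norm_one]
    exact (pow_eq_one_iff_of_nonneg (norm_nonneg _) (by norm_num)).1 this
  have h2 := Complex.abs_re_le_norm (starRingEnd ℂ ω *
    (χ (q : ZMod f) * ∑ j ∈ Finset.range h, χ ((x : ZMod f) + 1 + (j : ℕ))))
  rw [norm_mul, norm_mul, RCLike.norm_conj, hnorm, one_mul] at h2
  have h3 := cubic_norm_le f χ hχ (q : ZMod f)
  have h4 := neg_abs_le (starRingEnd ℂ ω *
    (χ (q : ZMod f) * ∑ j ∈ Finset.range h, χ ((x : ZMod f) + 1 + (j : ℕ)))).re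
  have h5 := mul_le_mul_of_nonneg_right h3
    (norm_nonneg (∑ j ∈ Finset.range h, χ ((x : ZMod f) + 1 + (j : ℕ))))
  linarith

theorem blk_abs (f h : ℕ) (hh : 0 < h) (H : ℝ) (q t : ℕ) (hq : 0 < q) (x : ℤ)
    (hx : x ∈ blk f h H q t) :
    -H ≤ (q : ℝ) * (x + 1) - t * f ∧ (q : ℝ) * (x + 1) - t * f ≤ H - q * (h - 1) := by
  have hq' : (0 : ℝ) < q := by exact_mod_cast hq
  have hh' : (1 : ℝ) ≤ h := by exact_mod_cast hh
  rcases blk_mem f h H q t hq x hx with ⟨h1, h2⟩ | ⟨h1, h2⟩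
  · constructor <;> nlinarith
  · constructor <;> nlinarith

theorem blk_inj (f h u : ℕ) (hf : 0 < f) (hh : 0 < h) (H X : ℝ) (hXH : H = h * X)
    (hcase : ((h : ℝ) + 1) * X ^ 2 < f * u)
    (q t q' t' : ℕ) (hq : 0 < q) (hq' : 0 < q') (hqX : (q : ℝ) ≤ X) (hqX' : (q' : ℝ) ≤ X)
    (huq : u ∣ q) (huq' : u ∣ q') (hqt : Nat.Coprime t q) (hqt' : Nat.Coprime t' q')
    (htq : t < q) (htq' : t' < q') (x x' : ℤ) (hx : x ∈ blk f h H q t) (hx' : x' ∈ blk f h H q' t')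
    (hxx : (x : ZMod f) = (x' : ZMod f)) : q = q' ∧ t = t' ∧ x = x' := by
  obtain ⟨c, hc⟩ : (f : ℤ) ∣ x' - x := (ZMod.intCast_eq_intCast_iff_dvd_sub x x' f).1 hxx
  have hqR : (0 : ℝ) < q := by exact_mod_cast hq
  have hqR' : (0 : ℝ) < q' := by exact_mod_cast hq'
  have hh' : (1 : ℝ) ≤ h := by exact_mod_cast hh
  have hfR : (0 : ℝ) < f := by exact_mod_cast hf
  obtain ⟨a1, a2⟩ := blk_abs f h hh H q t hq x hx
  obtain ⟨b1, b2⟩ := blk_abs f h hh H q' t' hq' x' hx'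
  have hxr : (x' : ℝ) = x + f * c := by
    have : x' = x + f * c := by linarith
    exact_mod_cast this
  rw [hxr] at b1 b2
  set T : ℤ := t' - c * q' with hT
  have hTr : (T : ℝ) = t' - c * q' := by rw [hT]; push_cast; ring
  have hB : (h - 1) * ((q : ℝ) * q') + f * u ≤ H * (q + q') → False := by
    intro hle
    have : H * (q + q') - (h - 1) * ((q : ℝ) * q') ≤ (h + 1) * X ^ 2 := by
      rw [hXH]
      nlinarith [mul_nonneg (sub_nonneg.2 hqX) (sub_nonneg.2 hqX'),
        mul_nonneg (mul_nonneg (sub_nonneg.2 hh') (sub_nonneg.2 hqX)) (sub_nonneg.2 hqX'),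
        mul_nonneg hqR.le (sub_nonneg.2 hqX), mul_nonneg hqR'.le (sub_nonneg.2 hqX')]
    linarith
  have key : (q : ℤ) * T = q' * t := by
    by_contra hne
    have hdvd : (u : ℤ) ∣ (q : ℤ) * T - q' * t :=
      dvd_sub ((Int.natCast_dvd_natCast.2 huq).mul_right _)
        ((Int.natCast_dvd_natCast.2 huq').mul_right _)
    have habs := Int.le_of_dvd (abs_pos.2 (sub_ne_zero.2 hne)) ((dvd_abs _ _).2 hdvd)
    have habsR : (u : ℝ) ≤ |(q : ℝ) * T - q' * t| := by exact_mod_cast habs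
    apply hB
    rcases abs_cases ((q : ℝ) * T - q' * t) with ⟨h1, _⟩ | ⟨h1, _⟩
    · rw [h1] at habsR
      have := mul_le_mul_of_nonneg_left habsR hfR.le
      rw [hTr] at this
      have c1 := mul_le_mul_of_nonneg_left a2 hqR'.le
      have c2 := mul_le_mul_of_nonneg_left b1 hqR.le
      linarith
    · rw [h1] at habsR
      have := mul_le_mul_of_nonneg_left habsR hfR.le
      rw [hTr] at this
      have c1 := mul_le_mul_of_nonneg_left a1 hqR'.le
      have c2 := mul_le_mul_of_nonneg_left b2 hqR.le
      linarith
  have hcopT : IsCoprime T (q' : ℤ) := by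
    have := Nat.isCoprime_iff_coprime.2 hqt'
    rw [hT, sub_eq_add_neg, ← neg_mul]
    exact IsCoprime.add_mul_right_left_iff.2 this
  have d1 : (q : ℤ) ∣ q' :=
    (Nat.isCoprime_iff_coprime.2 hqt).symm.dvd_of_dvd_mul_right (Dvd.intro _ key)
  have d2 : (q' : ℤ) ∣ q := hcopT.symm.dvd_of_dvd_mul_right (Dvd.intro _ key.symm)
  have hqq : q = q' := Nat.dvd_antisymm (Int.natCast_dvd_natCast.1 d1) (Int.natCast_dvd_natCast.1 d2)
  subst hqq
  have hTt : T = t := mul_left_cancel₀ (by exact_mod_cast hq.ne') key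
  have hc0 : c = 0 := by
    rw [hT] at hTt
    by_contra hc0
    rcases lt_or_gt_of_ne hc0 with h1 | h1
    · have : c * q ≤ -1 * (q : ℤ) := mul_le_mul_of_nonneg_right (by omega) (by positivity)
      omega
    · have : 1 * (q : ℤ) ≤ c * q := mul_le_mul_of_nonneg_right (by omega) (by positivity)
      omega
  refine ⟨rfl, ?_, ?_⟩
  · rw [hT, hc0] at hTt; omega
  · rw [hc0] at hc; omega

end PartD2

section PartD3
theorem burgess_count (f : ℕ) [Fact f.Prime] (χ : MulChar (ZMod f) ℂ) (hχ : orderOf χ = 3)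
    (ω : ℂ) (hω : ω ^ 3 = 1) (r h u v : ℕ) (hh : 0 < h) (hu : 0 < u) (hv : 0 < v)
    (hvP : ∀ p : ℕ, p.Prime → p ∣ v → h ≤ p)
    (h3 : 3 * v.primeFactors.card < h) (H X : ℝ) (hXH : H = h * X) (hHf : H < f) (hX : 0 < X)
    (hno : ∀ m : ℕ, 0 < m → (m : ℝ) ≤ H → Nat.Coprime m (u * v) → χ (m : ZMod f) ≠ ω)
    (hcase : ((h : ℝ) + 1) * X ^ 2 < f * u) :
    (2 * h * (Nat.totient u : ℝ) * ∑ n ∈ Finset.Icc 1 ⌊X / u⌋₊,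
        if Nat.Coprime n u then (Nat.totient n : ℝ) * (X / u / n - 1) else 0) *
      (((h : ℝ) - 3 * (v.primeFactors.card : ℝ)) / 2) ^ (2 * r) ≤
    ∑ x : ZMod f, ‖∑ m : Fin h, χ (((m : ℕ) + 1 : ZMod f) - x)‖ ^ (2 * r) := by
  classical
  have hfp : f.Prime := Fact.out
  have huR : (0 : ℝ) < u := by exact_mod_cast hu
  have hhR : (1 : ℝ) ≤ h := by exact_mod_cast hh
  set S : Finset ℕ := (Finset.Icc 1 ⌊X / u⌋₊).filter (fun n => Nat.Coprime n u) with hS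
  set T : ℕ → Finset ℕ := fun q => (Finset.range q).filter (fun t => Nat.Coprime t q) with hT
  set I : Finset (Σ _ : ℕ, Σ _ : ℕ, ℤ) :=
    S.sigma (fun n => (T (u * n)).sigma (fun t => blk f h H (u * n) t)) with hI
  have hSn : ∀ n ∈ S, 0 < u * n ∧ ((u * n : ℕ) : ℝ) ≤ X ∧ Nat.Coprime n u := by
    intro n hn
    rw [hS, Finset.mem_filter, Finset.mem_Icc] at hn
    refine ⟨Nat.mul_pos hu hn.1.1, ?_, hn.2⟩
    have h1 : (n : ℝ) ≤ X / u := (Nat.le_floor_iff' (by omega)).1 hn.1.2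
    rw [le_div_iff₀ huR] at h1
    push_cast; linarith
  have hXf : X < f := by nlinarith
  set g : (Σ _ : ℕ, Σ _ : ℕ, ℤ) → ZMod f := fun i => -((i.2.2 : ℤ) : ZMod f) with hg
  set F : ZMod f → ℝ := fun x => ‖∑ m : Fin h, χ (((m : ℕ) + 1 : ZMod f) - x)‖ ^ (2 * r) with hF
  have hinj : Set.InjOn g I := by
    rintro ⟨n, t, x⟩ hi ⟨n', t', x'⟩ hi' hxx
    rw [Finset.mem_coe] at hi hi'
    simp only [hI, Finset.mem_sigma, hT, Finset.mem_filter, Finset.mem_range] at hi hi'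
    obtain ⟨hn, ⟨ht1, ht2⟩, hx⟩ := hi
    obtain ⟨hn', ⟨ht1', ht2'⟩, hx'⟩ := hi'
    obtain ⟨p1, p2, p3⟩ := hSn n hn
    obtain ⟨q1, q2, q3⟩ := hSn n' hn'
    have := blk_inj f h u hfp.pos hh H X hXH hcase (u * n) t (u * n') t' p1 q1 p2 q2
      (dvd_mul_right _ _) (dvd_mul_right _ _) ht2 ht2' ht1 ht1' x x' hx hx' (by
        simpa [hg] using hxx)
    obtain ⟨e1, e2, e3⟩ := this
    have e1' := Nat.eq_of_mul_eq_mul_left hu e1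
    subst e1'; subst e2; subst e3
    rfl
  have hval : ∀ i ∈ I, (((h : ℝ) - 3 * (v.primeFactors.card : ℝ)) / 2) ^ (2 * r) ≤ F (g i) := by
    rintro ⟨n, t, x⟩ hi
    simp only [hI, Finset.mem_sigma, hT, Finset.mem_filter, Finset.mem_range] at hi
    obtain ⟨hn, ⟨ht1, ht2⟩, hx⟩ := hi
    obtain ⟨p1, p2, p3⟩ := hSn n hn
    have hqf : u * n < f := by
      have : ((u * n : ℕ) : ℝ) < f := by linarith
      exact_mod_cast this
    have hb := blk_value f χ hχ ω hω h u v hv hvP H hHf hno (u * n) t p1 hqf (dvd_mul_right _ _) ht2 x hx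
    have h0 : (0 : ℝ) ≤ ((h : ℝ) - 3 * (v.primeFactors.card : ℝ)) / 2 := by
      have : (3 * v.primeFactors.card : ℝ) < h := by exact_mod_cast h3
      linarith
    refine pow_le_pow_left₀ h0 (hb.trans (le_of_eq ?_)) _
    congr 1
    rw [← Fin.sum_univ_eq_sum_range (fun j => χ ((x : ZMod f) + 1 + (j : ℕ)))]
    refine Finset.sum_congr rfl fun j _ => ?_
    congr 1
    simp only [hg]
    ring
  have hcard : 2 * h * (Nat.totient u : ℝ) * (∑ n ∈ Finset.Icc 1 ⌊X / u⌋₊,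
        if Nat.Coprime n u then (Nat.totient n : ℝ) * (X / u / n - 1) else 0) ≤ (I.card : ℝ) := by
    rw [← Finset.sum_filter, ← hS, hI, Finset.card_sigma, Finset.mul_sum]
    push_cast
    refine Finset.sum_le_sum fun n hn => ?_
    obtain ⟨p1, p2, p3⟩ := hSn n hn
    have hqR : (0 : ℝ) < ((u * n : ℕ) : ℝ) := by exact_mod_cast p1
    have hnR : (0 : ℝ) < n := by
      have := Nat.pos_of_mul_pos_left p1
      exact_mod_cast this
    rw [Finset.card_sigma]
    push_cast
    have h1 : ∑ t ∈ T (u * n), (2 * (H / ((u * n : ℕ) : ℝ) - h)) ≤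
        ∑ t ∈ T (u * n), ((blk f h H (u * n) t).card : ℝ) :=
      Finset.sum_le_sum fun t _ => blk_card f h hh H (u * n) t p1
    refine le_trans (le_of_eq ?_) h1
    have hTc : (T (u * n)).card = Nat.totient u * Nat.totient n := by
      rw [← Nat.totient_mul p3.symm, hT]
      simp only [Nat.totient]
      congr 1
      refine Finset.filter_congr fun t _ => ?_
      exact Nat.coprime_comm
    rw [Finset.sum_const, hTc, nsmul_eq_mul, hXH]
    push_cast
    field_simp
  have hpow : (0 : ℝ) ≤ (((h : ℝ) - 3 * (v.primeFactors.card : ℝ)) / 2) ^ (2 * r) := by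
    rw [pow_mul]; positivity
  calc _ ≤ (I.card : ℝ) * (((h : ℝ) - 3 * (v.primeFactors.card : ℝ)) / 2) ^ (2 * r) :=
        mul_le_mul_of_nonneg_right hcard hpow
    _ = ∑ i ∈ I, (((h : ℝ) - 3 * (v.primeFactors.card : ℝ)) / 2) ^ (2 * r) := by
        rw [Finset.sum_const, nsmul_eq_mul]
    _ ≤ ∑ i ∈ I, F (g i) := Finset.sum_le_sum hval
    _ = ∑ x ∈ I.image g, F x := (Finset.sum_image hinj).symm
    _ ≤ ∑ x : ZMod f, F x := by
        refine Finset.sum_le_univ_sum_of_nonneg fun x => ?_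
        rw [hF]; positivity

theorem burgess_case (f : ℕ) [Fact f.Prime] (χ : MulChar (ZMod f) ℂ) (hχ : orderOf χ = 3)
    (ω : ℂ) (hω : ω ^ 3 = 1) (r h u v : ℕ) (hr : 0 < r) (hh : 0 < h) (hu : 0 < u) (hv : 0 < v)
    (huSq : Squarefree u)
    (hvP : ∀ p : ℕ, p.Prime → p ∣ v → h ≤ p)
    (h3 : 3 * v.primeFactors.card < h) (H X : ℝ) (hXH : H = h * X) (hHf : H < f)
    (hXu : 1 ≤ X / u) (hE : EFun u X > 0)
    (hno : ∀ m : ℕ, 0 < m → (m : ℝ) ≤ H → Nat.Coprime m (u * v) → χ (m : ZMod f) ≠ ω)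
    (hcase : ((h : ℝ) + 1) * X ^ 2 < f * u)
    (hmain : (1 / EFun u X) * (Real.pi ^ 2 / 6) * ((sigmaFun u : ℝ) / (Nat.totient u : ℝ)) *
      u * h * Real.sqrt f * ((2 * h : ℝ) / ((h : ℝ) - 3 * (v.primeFactors.card : ℕ))) ^ (2 * r) *
        WFun f h r / H ^ 2 < 1) : False := by
  have hfp : f.Prime := Fact.out
  have huR : (0 : ℝ) < u := by exact_mod_cast hu
  have hhR : (0 : ℝ) < h := by exact_mod_cast hh
  have hX0 : 0 < X := by
    by_contra hc
    push Not at hc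
    have : X / u ≤ 0 := div_nonpos_of_nonpos_of_nonneg hc huR.le
    linarith
  have hH0 : 0 < H := by rw [hXH]; positivity
  have h1 := burgess_count f χ hχ ω hω r h u v hh hu hv hvP h3 H X hXH hHf hX0 hno hcase
  have h2 := c_totient_sum u huSq (X / u) hXu
  have hhf : h ≤ f := by
    have : (h : ℝ) < f := by
      have : 1 ≤ X := by
        rw [le_div_iff₀ huR] at hXu
        have : (1 : ℝ) ≤ u := by exact_mod_cast hu
        linarith
      nlinarith
    exact_mod_cast this.le
  have h4 := moment_bound f χ hχ (fun m : Fin h => ((m : ℕ) + 1 : ZMod f)) (by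
    intro a b hab
    have hab' : ((a : ℕ) : ZMod f) = ((b : ℕ) : ZMod f) := by simpa using hab
    rw [ZMod.natCast_eq_natCast_iff'] at hab'
    rw [Nat.mod_eq_of_lt (by omega), Nat.mod_eq_of_lt (by omega)] at hab'
    exact Fin.ext hab') r hr
  have hσe : (sigmaFun u : ℝ) = ((∑ d ∈ u.divisors, d : ℕ) : ℝ) := rfl
  rw [← hσe] at h2
  set σ : ℝ := (sigmaFun u : ℝ) with hσ
  set φ : ℝ := (Nat.totient u : ℝ) with hφ
  set E := EFun u X with hEd
  have hφ0 : 0 < φ := by rw [hφ]; exact_mod_cast Nat.totient_pos.2 hu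
  have hσ0 : (0 : ℝ) < σ := by
    rw [hσe, c_sigma_prod u huSq]
    exact Finset.prod_pos fun p _ => by positivity
  have hpi := Real.pi_pos
  have hEeq : 3 / Real.pi ^ 2 * (u / σ) * (X / u) ^ 2
      - σ / 8 * (X / u) - φ / (2 * u) * (X / u + 1) = 3 / Real.pi ^ 2 * (u / σ) * (X / u) ^ 2 * E := by
    rw [hEd, EFun, ← hσ, ← hφ]
    field_simp
    ring
  rw [hEeq] at h2
  set L : ℝ := (h : ℝ) - 3 * (v.primeFactors.card : ℝ) with hL
  have hL0 : 0 < L := by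
    have : (3 * v.primeFactors.card : ℝ) < h := by exact_mod_cast h3
    rw [hL]; linarith
  have hW : (f : ℝ) * DCo h r r + (2 * r - 1 : ℝ) * Real.sqrt f * (h : ℝ) ^ (2 * r) =
      Real.sqrt f * (h : ℝ) ^ (2 * r) * WFun f h r := by
    rw [WFun, dFun, DCo_diag]
    have hs : Real.sqrt f * Real.sqrt f = f := Real.mul_self_sqrt (by positivity)
    have hr0 : (r.factorial : ℝ) ≠ 0 := by positivity
    set D := ∑ n ∈ Finset.range (r / 3 + 1), ((r.factorial : ℝ) / ((n.factorial : ℝ) * 6 ^ n)) ^ 2 *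
        (h : ℝ) ^ (r - n) / ((r - 3 * n).factorial : ℝ) with hD
    have : (h : ℝ) ^ (2 * r) = (h : ℝ) ^ r * (h : ℝ) ^ r := by ring
    rw [this]
    have e : Real.sqrt f * ((h : ℝ) ^ r * (h : ℝ) ^ r) * ((2 * r - 1 : ℝ) + Real.sqrt f / (h : ℝ) ^ r *
      (r.factorial : ℝ) * (1 / ((r.factorial : ℝ) * (h : ℝ) ^ r) * D)) =
      (2 * r - 1 : ℝ) * Real.sqrt f * ((h : ℝ) ^ r * (h : ℝ) ^ r) + (Real.sqrt f * Real.sqrt f) * D := by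
      field_simp
    rw [e, hs]
    ring
  rw [hW] at h4
  have h5 := h1.trans h4
  have hLp : (0 : ℝ) < (L / 2) ^ (2 * r) := by positivity
  have h6 : 2 * h * φ * (3 / Real.pi ^ 2 * (u / σ) * (X / u) ^ 2 * E) * (L / 2) ^ (2 * r) ≤
      Real.sqrt f * (h : ℝ) ^ (2 * r) * WFun f h r :=
    le_trans (mul_le_mul_of_nonneg_right
      (mul_le_mul_of_nonneg_left h2 (by positivity)) hLp.le) h5
  have h7 : (2 * h / L : ℝ) ^ (2 * r) * (L / 2) ^ (2 * r) = (h : ℝ) ^ (2 * r) := by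
    rw [← mul_pow]; congr 1; field_simp
  rw [← h7] at h6
  have h8 : 2 * h * φ * (3 / Real.pi ^ 2 * (u / σ) * (X / u) ^ 2 * E) ≤
      Real.sqrt f * (2 * h / L : ℝ) ^ (2 * r) * WFun f h r := by
    refine le_of_mul_le_mul_right (h6.trans (le_of_eq (by ring))) hLp
  rw [div_lt_one (by positivity)] at hmain
  have h9 : (1 / E) * (Real.pi ^ 2 / 6) * (σ / φ) * u * h *
      (2 * h * φ * (3 / Real.pi ^ 2 * (u / σ) * (X / u) ^ 2 * E)) = H ^ 2 := by
    rw [hXH]; field_simp; norm_num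
  have h10 := mul_le_mul_of_nonneg_left h8
    (show 0 ≤ (1 / E) * (Real.pi ^ 2 / 6) * (σ / φ) * u * h by positivity)
  rw [h9] at h10
  have h11 : (1 / E) * (Real.pi ^ 2 / 6) * (σ / φ) * u * h *
      (Real.sqrt f * (2 * h / L : ℝ) ^ (2 * r) * WFun f h r) =
      (1 / E) * (Real.pi ^ 2 / 6) * (σ / φ) * u * h * Real.sqrt f *
      (2 * h / L : ℝ) ^ (2 * r) * WFun f h r := by ring
  rw [h11] at h10
  linarith

end PartD3

section PartE1
theorem e_corr (f : ℕ) [Fact f.Prime] (χ : MulChar (ZMod f) ℂ) (hχ : orderOf χ = 3) (a b : ZMod f) :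
    ∑ x : ZMod f, χ (x - a) * starRingEnd ℂ (χ (x - b)) = if a = b then (f : ℂ) - 1 else -1 := by
  have hχ1 : χ ≠ 1 := by
    intro h; rw [h, orderOf_one] at hχ; norm_num at hχ
  have hsh : ∑ x : ZMod f, χ (x - a) * starRingEnd ℂ (χ (x - b))
      = ∑ x : ZMod f, χ x * starRingEnd ℂ (χ (x - (b - a))) := by
    apply Fintype.sum_equiv (Equiv.subRight a)
    intro x
    simp only [Equiv.subRight_apply]
    congr 3
    ring
  rw [hsh]
  split_ifs with hab
  · subst hab
    have : ∀ x : ZMod f, χ x * starRingEnd ℂ (χ (x - (a - a))) = 1 - if x = 0 then 1 else 0 := by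
      intro x
      rw [sub_self, sub_zero]
      split_ifs with hx
      · rw [hx, MulChar.map_zero]; simp
      · rw [Complex.mul_conj, Complex.normSq_eq_norm_sq, cubic_norm_eq f χ hχ x hx]; simp
    rw [Finset.sum_congr rfl fun x _ => this x]
    simp [ZMod.card]
  · set d := b - a with hd
    have hd0 : d ≠ 0 := fun h => hab (sub_eq_zero.mp h).symm
    have h1 : ∑ x : ZMod f, χ x * starRingEnd ℂ (χ (x - d))
        = ∑ x : ZMod f, χ (d * x) * χ⁻¹ (d * x - d) := by
      symm
      apply Fintype.sum_equiv (Equiv.mulLeft₀ d hd0)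
      intro x
      change χ (d * x) * χ⁻¹ (d * x - d) = χ (d * x) * starRingEnd ℂ (χ (d * x - d))
      congr 1
      exact (MulChar.star_apply' χ _).symm
    rw [h1]
    have h2 : ∀ x : ZMod f, χ (d * x) * χ⁻¹ (d * x - d) = χ⁻¹ (-1) * (χ x * χ⁻¹ (1 - x)) := by
      intro x
      have : d * x - d = d * ((-1) * (1 - x)) := by ring
      rw [this, map_mul, map_mul, map_mul]
      have h3 : χ d * χ⁻¹ d = 1 := by
        rw [← MulChar.mul_apply, mul_inv_cancel, MulChar.one_apply (isUnit_iff_ne_zero.mpr hd0)]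
      linear_combination (χ x * χ⁻¹ (-1) * χ⁻¹ (1 - x)) * h3
    rw [Finset.sum_congr rfl fun x _ => h2 x, ← Finset.mul_sum]
    have h4 := jacobiSum_nontrivial_inv hχ1
    rw [jacobiSum] at h4
    rw [h4]
    have h3 : χ (-1) * χ⁻¹ (-1) = 1 := by
      rw [← MulChar.mul_apply, mul_inv_cancel, MulChar.one_apply (isUnit_iff_ne_zero.mpr (by simp))]
    linear_combination -h3

theorem e_cast_inj (f L : ℕ) (hLf : L ≤ f) (i j : ℕ) (hi : i < L) (hj : j < L) (s : ZMod f)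
    (h : (i : ZMod f) + s = (j : ZMod f) + s) : i = j := by
  have h1 := add_right_cancel h
  rw [ZMod.natCast_eq_natCast_iff] at h1
  exact Nat.ModEq.eq_of_lt_of_lt h1 (by omega) (by omega)

theorem e_L2 (f : ℕ) [Fact f.Prime] (χ : MulChar (ZMod f) ℂ) (hχ : orderOf χ = 3) (L : ℕ)
    (hLf : L ≤ f) (w : ℕ → ℂ) (hw : ∀ j, ‖w j‖ = 1) :
    ∑ x : ZMod f, ‖∑ j ∈ Finset.range L, w j * χ (x - (j : ZMod f))‖ ^ 2
      = f * L - ‖∑ j ∈ Finset.range L, w j‖ ^ 2 := by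
  have key : ((∑ x : ZMod f, ‖∑ j ∈ Finset.range L, w j * χ (x - (j : ZMod f))‖ ^ 2 : ℝ) : ℂ)
      = ((f * L - ‖∑ j ∈ Finset.range L, w j‖ ^ 2 : ℝ) : ℂ) := by
    push_cast
    simp_rw [← Complex.mul_conj']
    have h1 : ∀ x : ZMod f, (∑ j ∈ Finset.range L, w j * χ (x - (j : ZMod f))) *
        starRingEnd ℂ (∑ j ∈ Finset.range L, w j * χ (x - (j : ZMod f)))
        = ∑ i ∈ Finset.range L, ∑ j ∈ Finset.range L, (w i * starRingEnd ℂ (w j)) *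
          (χ (x - (i : ZMod f)) * starRingEnd ℂ (χ (x - (j : ZMod f)))) := by
      intro x
      rw [map_sum, Finset.sum_mul_sum]
      refine Finset.sum_congr rfl fun i _ => Finset.sum_congr rfl fun j _ => ?_
      rw [map_mul]; ring
    rw [Finset.sum_congr rfl fun x _ => h1 x, Finset.sum_comm]
    have h2 : ∀ i ∈ Finset.range L, ∑ x : ZMod f, ∑ j ∈ Finset.range L, (w i * starRingEnd ℂ (w j)) *
          (χ (x - (i : ZMod f)) * starRingEnd ℂ (χ (x - (j : ZMod f))))
          = f - ∑ j ∈ Finset.range L, w i * starRingEnd ℂ (w j) := by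
      intro i hi
      rw [Finset.sum_comm]
      have h3 : ∀ j ∈ Finset.range L, ∑ x : ZMod f, (w i * starRingEnd ℂ (w j)) *
          (χ (x - (i : ZMod f)) * starRingEnd ℂ (χ (x - (j : ZMod f))))
          = (if i = j then (f : ℂ) else 0) - w i * starRingEnd ℂ (w j) := by
        intro j hj
        rw [← Finset.mul_sum, e_corr f χ hχ]
        have h4 : ((i : ZMod f) = (j : ZMod f)) ↔ i = j := by
          constructor
          · intro h
            exact e_cast_inj f L hLf i j (Finset.mem_range.mp hi) (Finset.mem_range.mp hj) 0 (by simpa using h)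
          · rintro rfl; rfl
        simp only [h4]
        split_ifs with hij
        · subst hij
          rw [Complex.mul_conj', hw]; push_cast; ring
        · ring
      rw [Finset.sum_congr rfl h3, Finset.sum_sub_distrib, Finset.sum_ite_eq, if_pos hi]
    rw [Finset.sum_congr rfl h2, Finset.sum_sub_distrib, map_sum, Finset.sum_mul_sum]
    simp [mul_comm]
  exact_mod_cast key

theorem e_bilin (f : ℕ) [Fact f.Prime] (χ : MulChar (ZMod f) ℂ) (hχ : orderOf χ = 3) (L : ℕ)
    (hLf : L ≤ f) (c : ℂ) (hc : ‖c‖ = 1) (s : ℤ) :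
    ‖∑ i ∈ Finset.range L, ∑ j ∈ Finset.range L, c ^ ((i : ℤ) - (j : ℤ)) *
        χ (((i : ℤ) - (j : ℤ) + s : ℤ) : ZMod f)‖ ^ 2
      ≤ L * (f * L - ‖∑ j ∈ Finset.range L, c ^ (-(j : ℤ))‖ ^ 2) := by
  have hc0 : c ≠ 0 := by intro h; rw [h] at hc; simp at hc
  set β : ZMod f → ℂ := fun x => ∑ j ∈ Finset.range L, c ^ (-(j : ℤ)) * χ (x - (j : ZMod f)) with hβ
  have h1 : ∑ i ∈ Finset.range L, ∑ j ∈ Finset.range L, c ^ ((i : ℤ) - (j : ℤ)) *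
        χ (((i : ℤ) - (j : ℤ) + s : ℤ) : ZMod f)
        = ∑ i ∈ Finset.range L, c ^ (i : ℤ) * β ((i : ZMod f) + (s : ZMod f)) := by
    refine Finset.sum_congr rfl fun i _ => ?_
    rw [hβ, Finset.mul_sum]
    refine Finset.sum_congr rfl fun j _ => ?_
    rw [sub_eq_add_neg, zpow_add₀ hc0, mul_assoc]
    congr 3
    push_cast; ring
  rw [h1]
  have h2 : ‖∑ i ∈ Finset.range L, c ^ (i : ℤ) * β ((i : ZMod f) + (s : ZMod f))‖
      ≤ ∑ i ∈ Finset.range L, ‖β ((i : ZMod f) + (s : ZMod f))‖ := by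
    refine (norm_sum_le _ _).trans (Finset.sum_le_sum fun i _ => ?_)
    rw [norm_mul, norm_zpow, hc]; simp
  have h3 : (∑ i ∈ Finset.range L, ‖β ((i : ZMod f) + (s : ZMod f))‖) ^ 2
      ≤ L * ∑ i ∈ Finset.range L, ‖β ((i : ZMod f) + (s : ZMod f))‖ ^ 2 := by
    have := sq_sum_le_card_mul_sum_sq (s := Finset.range L)
      (f := fun i => ‖β ((i : ZMod f) + (s : ZMod f))‖)
    simpa using this
  have h4 : ∑ i ∈ Finset.range L, ‖β ((i : ZMod f) + (s : ZMod f))‖ ^ 2 ≤ ∑ x : ZMod f, ‖β x‖ ^ 2 := by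
    have hinj : Set.InjOn (fun i : ℕ => (i : ZMod f) + (s : ZMod f)) (Finset.range L) := by
      intro i hi j hj hij
      exact e_cast_inj f L hLf i j (by simpa using hi) (by simpa using hj) _ hij
    rw [← Finset.sum_image (f := fun x => ‖β x‖ ^ 2) hinj]
    exact Finset.sum_le_sum_of_subset_of_nonneg (Finset.subset_univ _) fun _ _ _ => by positivity
  have h5 := e_L2 f χ hχ L hLf (fun j => c ^ (-(j : ℤ))) (fun j => by rw [norm_zpow, hc]; simp)
  calc _ ≤ (∑ i ∈ Finset.range L, ‖β ((i : ZMod f) + (s : ZMod f))‖) ^ 2 := by gcongr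
    _ ≤ _ := h3
    _ ≤ L * ∑ x : ZMod f, ‖β x‖ ^ 2 := by gcongr
    _ = _ := by rw [← h5]

end PartE1

section PartE2
noncomputable def eS (f : ℕ) (χ : MulChar (ZMod f) ℂ) (L : ℕ) (P : Finset ℕ) (c : ℂ) (s : ℤ) : ℂ :=
  ∑ i ∈ Finset.range L, ∑ j ∈ Finset.range L,
    (if ∀ p ∈ P, ¬ ((p : ℤ) ∣ ((i : ℤ) - (j : ℤ))) then (1 : ℂ) else 0) * (c ^ ((i : ℤ) - (j : ℤ)) *
        χ (((i : ℤ) - (j : ℤ) + s : ℤ) : ZMod f))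

theorem e_root_ind (p : ℕ) (hp : 0 < p) : ∃ ζ : ℂ, ‖ζ‖ = 1 ∧ ∀ m : ℤ,
    (if ¬ ((p : ℤ) ∣ m) then (1 : ℂ) else 0)
      = 1 - (1 / (p : ℂ)) * ∑ b ∈ Finset.range p, (ζ ^ b) ^ m := by
  have hp0 : p ≠ 0 := by omega
  have hpc : (p : ℂ) ≠ 0 := by exact_mod_cast hp0
  have hζ := Complex.isPrimitiveRoot_exp p hp0
  set ζ := Complex.exp (2 * Real.pi * Complex.I / p) with hz
  refine ⟨ζ, IsPrimitiveRoot.norm'_eq_one hζ hp0, fun m => ?_⟩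
  have h1 : ∀ b ∈ Finset.range p, (ζ ^ b) ^ m = (ζ ^ m) ^ b := by
    intro b _
    rw [← zpow_natCast, ← zpow_natCast, ← zpow_mul, ← zpow_mul, mul_comm]
  rw [Finset.sum_congr rfl h1]
  by_cases h : (p : ℤ) ∣ m
  · rw [if_neg (not_not.mpr h), (hζ.zpow_eq_one_iff_dvd m).mpr h]
    simp [hpc]
  · rw [if_pos h]
    have h2 : ζ ^ m ≠ 1 := fun h' => h ((hζ.zpow_eq_one_iff_dvd m).mp h')
    rw [geom_sum_eq h2]
    have : (ζ ^ m) ^ p = 1 := by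
      rw [← zpow_natCast, ← zpow_mul, mul_comm, zpow_mul, zpow_natCast, hζ.pow_eq_one, one_zpow]
    rw [this]; simp

theorem eS_bound (f : ℕ) [Fact f.Prime] (χ : MulChar (ZMod f) ℂ) (hχ : orderOf χ = 3) (L : ℕ)
    (hLf : L ≤ f) (s : ℤ) (P : Finset ℕ) (hP : ∀ p ∈ P, p.Prime) : ∀ (c : ℂ) (_ : ‖c‖ = 1),
    ‖eS f χ L P c s‖ ≤ (∏ p ∈ P, (2 * (1 - 1 / (p : ℝ)))) * (L * Real.sqrt f) := by
  induction P using Finset.induction_on with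
  | empty =>
    intro c hc
    have h := e_bilin f χ hχ L hLf c hc s
    have h2 : eS f χ L ∅ c s = ∑ i ∈ Finset.range L, ∑ j ∈ Finset.range L, c ^ ((i : ℤ) - (j : ℤ)) *
        χ (((i : ℤ) - (j : ℤ) + s : ℤ) : ZMod f) := by
      simp [eS]
    rw [← h2] at h
    rw [Finset.prod_empty, one_mul]
    apply le_of_sq_le_sq _ (by positivity)
    rw [mul_pow, Real.sq_sqrt (by positivity)]
    have : (0 : ℝ) ≤ L * ‖∑ j ∈ Finset.range L, c ^ (-(j : ℤ))‖ ^ 2 := by positivity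
    nlinarith
  | insert p P hpP ih =>
    intro c hc
    have hp : p.Prime := hP p (Finset.mem_insert_self _ _)
    have ih' := ih (fun q hq => hP q (Finset.mem_insert_of_mem hq))
    obtain ⟨ζ, hζ, hind⟩ := e_root_ind p hp.pos
    have hc0 : c ≠ 0 := by intro h; rw [h] at hc; simp at hc
    have hζ0 : ζ ≠ 0 := by intro h; rw [h] at hζ; simp at hζ
    have hexp : eS f χ L (insert p P) c s
        = eS f χ L P c s - (1 / (p : ℂ)) * ∑ b ∈ Finset.range p, eS f χ L P (c * ζ ^ b) s := by
      unfold eS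
      rw [Finset.sum_comm (s := Finset.range p), Finset.mul_sum, ← Finset.sum_sub_distrib]
      refine Finset.sum_congr rfl fun i _ => ?_
      rw [Finset.sum_comm (s := Finset.range p), Finset.mul_sum, ← Finset.sum_sub_distrib]
      refine Finset.sum_congr rfl fun j _ => ?_
      have h1 : (if ∀ q ∈ insert p P, ¬ ((q : ℤ) ∣ ((i : ℤ) - (j : ℤ))) then (1 : ℂ) else 0)
          = (if ¬ ((p : ℤ) ∣ ((i : ℤ) - (j : ℤ))) then (1 : ℂ) else 0) *
            (if ∀ q ∈ P, ¬ ((q : ℤ) ∣ ((i : ℤ) - (j : ℤ))) then (1 : ℂ) else 0) := by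
        simp only [Finset.forall_mem_insert]
        by_cases ha : ((p : ℤ) ∣ ((i : ℤ) - (j : ℤ)))
        · simp [ha]
        · simp only [ha, not_false_eq_true, true_and, if_true, one_mul]
      rw [h1, hind]
      simp_rw [mul_zpow]
      rw [sub_mul, sub_mul, one_mul]
      congr 1
      rw [mul_assoc, mul_assoc, Finset.sum_mul]
      congr 1
      refine Finset.sum_congr rfl fun b _ => ?_
      ring
    obtain ⟨q, rfl⟩ : ∃ q, p = q + 1 := ⟨p - 1, by have := hp.pos; omega⟩
    rw [Finset.sum_range_succ'] at hexp
    simp only [pow_zero, mul_one] at hexp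
    set T := (∏ p ∈ P, (2 * (1 - 1 / (p : ℝ)))) * (L * Real.sqrt f) with hT
    have hpr : (0 : ℝ) < ((q + 1 : ℕ) : ℝ) := by positivity
    have hpc : (((q + 1 : ℕ) : ℂ)) ≠ 0 := by exact_mod_cast (Nat.succ_ne_zero q)
    have e2 : eS f χ L (insert (q + 1) P) c s
        = (1 / ((q + 1 : ℕ) : ℂ)) * ((q : ℂ) * eS f χ L P c s
          - ∑ b ∈ Finset.range q, eS f χ L P (c * ζ ^ (b + 1)) s) := by
      rw [hexp]; field_simp; push_cast; ring
    rw [e2, norm_mul, Finset.prod_insert hpP, mul_assoc, ← hT]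
    have h3 : ‖∑ b ∈ Finset.range q, eS f χ L P (c * ζ ^ (b + 1)) s‖ ≤ q * T := by
      refine (norm_sum_le _ _).trans ?_
      refine (Finset.sum_le_card_nsmul _ _ T fun b _ => ?_).trans (by simp)
      apply ih'
      rw [norm_mul, norm_pow, hc, hζ]; simp
    have h4 : ‖(q : ℂ) * eS f χ L P c s‖ ≤ q * T := by
      rw [norm_mul, Complex.norm_natCast]
      gcongr
      exact ih' c hc
    have h5 := norm_sub_le ((q : ℂ) * eS f χ L P c s)
      (∑ b ∈ Finset.range q, eS f χ L P (c * ζ ^ (b + 1)) s)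
    have h6 : ‖(1 / ((q + 1 : ℕ) : ℂ))‖ = 1 / ((q + 1 : ℕ) : ℝ) := by
      rw [norm_div, Complex.norm_natCast]; simp
    rw [h6]
    calc _ ≤ 1 / ((q + 1 : ℕ) : ℝ) * (q * T + q * T) := by gcongr; linarith
      _ = _ := by field_simp; push_cast; ring

end PartE2

section PartE3
theorem e_cop_iff (u : ℕ) (hu : 0 < u) (m : ℤ) :
    (∀ p ∈ u.primeFactors, ¬ ((p : ℤ) ∣ m)) ↔ IsCoprime m (u : ℤ) := by
  rw [Int.isCoprime_iff_gcd_eq_one, Int.gcd_eq_natAbs, Int.natAbs_natCast]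
  constructor
  · intro h
    apply Nat.coprime_of_dvd
    intro p hp h1 h2
    exact h p (Nat.mem_primeFactors.mpr ⟨hp, h2, by omega⟩) (Int.natCast_dvd.mpr h1)
  · intro h p hp h1
    have h2 := Nat.mem_primeFactors.mp hp
    exact Nat.not_coprime_of_dvd_of_dvd h2.1.one_lt (Int.natCast_dvd.mp h1) h2.2.1 h

theorem e_count_Ico (u n q : ℕ) :
    ∑ x ∈ Finset.Ico n (n + u * q), (if u.Coprime x then (1 : ℝ) else 0) = q * (Nat.totient u : ℝ) := by
  induction q with
  | zero => simp
  | succ q ih =>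
    have h1 : n ≤ n + u * q := by omega
    have h2 : n + u * q ≤ n + u * (q + 1) := by rw [mul_add]; omega
    rw [← Finset.sum_Ico_consecutive _ h1 h2, ih]
    have h3 := Nat.filter_coprime_Ico_eq_totient u (n + u * q)
    have h4 : n + u * (q + 1) = n + u * q + u := by ring
    rw [h4, Finset.sum_boole, h3]
    push_cast; ring

theorem e_count (u L : ℕ) (hu : 0 < u) (huL : u ∣ L) :
    ∑ i ∈ Finset.range L, ∑ j ∈ Finset.range L,
      (if ∀ p ∈ u.primeFactors, ¬ ((p : ℤ) ∣ ((i : ℤ) - (j : ℤ))) then (1 : ℝ) else 0)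
      = L * (L * ((Nat.totient u : ℝ) / u)) := by
  obtain ⟨q, rfl⟩ := huL
  rw [Finset.sum_comm]
  have : ∀ j ∈ Finset.range (u * q), ∑ i ∈ Finset.range (u * q),
      (if ∀ p ∈ u.primeFactors, ¬ ((p : ℤ) ∣ ((i : ℤ) - (j : ℤ))) then (1 : ℝ) else 0)
      = q * (Nat.totient u : ℝ) := by
    intro j _
    rw [← e_count_Ico u ((u - 1) * j) q, Finset.sum_Ico_eq_sum_range, Nat.add_sub_cancel_left]
    refine Finset.sum_congr rfl fun i _ => ?_
    have h1 : (∀ p ∈ u.primeFactors, ¬ ((p : ℤ) ∣ ((i : ℤ) - (j : ℤ)))) ↔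
        u.Coprime ((u - 1) * j + i) := by
      rw [e_cop_iff u hu, ← Nat.isCoprime_iff_coprime]
      have h2 : (((u - 1) * j + i : ℕ) : ℤ) = ((i : ℤ) - j) + u * j := by
        push_cast [Nat.cast_sub hu]; ring
      rw [h2, isCoprime_comm]
      exact IsCoprime.add_mul_left_right_iff.symm
    simp only [h1]
  rw [Finset.sum_congr rfl this, Finset.sum_const, Finset.card_range, nsmul_eq_mul]
  have : (u : ℝ) ≠ 0 := by positivity
  push_cast
  field_simp

theorem e_main (f : ℕ) [Fact f.Prime] (χ : MulChar (ZMod f) ℂ) (hχ : orderOf χ = 3)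
    (ω : ℂ) (hω : ω ^ 3 = 1) (h u v : ℕ) (hu : 0 < u) (hv : 0 < v) (huSq : Squarefree u)
    (hvP : ∀ p : ℕ, p.Prime → p ∣ v → h ≤ p) (h3 : 3 * v.primeFactors.card < h)
    (H : ℝ) (hHf : H < f)
    (hno : ∀ m : ℕ, 0 < m → (m : ℝ) ≤ H → Nat.Coprime m (u * v) → χ (m : ZMod f) ≠ ω)
    (L : ℕ) (huL : u ∣ L) (hL0 : 0 < L) (hLf : L ≤ f)
    (hLH : (L : ℝ) - 1 + u * ((h / 2 : ℕ) : ℝ) ≤ H) :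
    (L : ℝ) ≤ 2 ^ u.primeFactors.card *
      ((2 * h : ℝ) / ((h : ℝ) - 3 * (v.primeFactors.card : ℝ))) * Real.sqrt f := by
  classical
  set ℓ := v.primeFactors.card with hℓ
  have hD : (0 : ℝ) < (h : ℝ) - 3 * (ℓ : ℝ) := by
    have : ((3 * ℓ : ℕ) : ℝ) < h := by exact_mod_cast h3
    push_cast at this; linarith
  have hhR : (0 : ℝ) < h := by
    have : (0 : ℝ) ≤ ℓ := by positivity
    linarith
  have huR : (0 : ℝ) < u := by exact_mod_cast hu
  have hLR : (0 : ℝ) < L := by exact_mod_cast hL0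
  have hφ : (0 : ℝ) < (Nat.totient u : ℝ) := by exact_mod_cast Nat.totient_pos.mpr hu
  have hω1 : ‖ω‖ = 1 := by
    have h := congrArg norm hω
    rw [norm_pow, norm_one] at h
    exact (pow_eq_one_iff_of_nonneg (norm_nonneg _) (by norm_num)).mp h
  set P := u.primeFactors with hP
  set sh : ℕ → ℤ := fun t => (u : ℤ) * ((t : ℤ) - ((h / 2 : ℕ) : ℤ)) with hsh
  set T : ℂ := ∑ t ∈ Finset.range h, eS f χ L P 1 (sh t) with hT
  set g : ℕ → ℕ → ℝ := fun i j =>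
    (if ∀ p ∈ P, ¬ ((p : ℤ) ∣ ((i : ℤ) - (j : ℤ))) then (1 : ℝ) else 0) with hg
  have hTe : T = ∑ i ∈ Finset.range L, ∑ j ∈ Finset.range L, (g i j : ℂ) *
      ∑ t ∈ Finset.range h,
        χ (((i : ℤ) - (j : ℤ) - u * ((h / 2 : ℕ) : ℤ) + u * (t : ℕ) : ℤ) : ZMod f) := by
    rw [hT]
    unfold eS
    rw [Finset.sum_comm]
    refine Finset.sum_congr rfl fun i _ => ?_
    rw [Finset.sum_comm]
    refine Finset.sum_congr rfl fun j _ => ?_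
    rw [Finset.mul_sum]
    refine Finset.sum_congr rfl fun t _ => ?_
    have e1 : (i : ℤ) - (j : ℤ) + sh t
        = (i : ℤ) - (j : ℤ) - u * ((h / 2 : ℕ) : ℤ) + u * (t : ℕ) := by
      simp only [hsh]; ring
    rw [e1, one_zpow, one_mul]
    congr 1
    simp only [hg]
    split_ifs <;> simp
  set z : ℕ → ℕ → ℝ := fun i j => ∑ t ∈ Finset.range h,
    (if (i : ℤ) - (j : ℤ) - u * ((h / 2 : ℕ) : ℤ) + u * (t : ℕ) = 0 then (1 : ℝ) else 0) with hz
  have hupper : (starRingEnd ℂ ω * T).re ≤ ∑ i ∈ Finset.range L, ∑ j ∈ Finset.range L,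
      g i j * (-((h : ℝ) - 3 * (ℓ : ℝ)) / 2 + 1 / 2 * z i j) := by
    rw [hTe, Finset.mul_sum, Complex.re_sum]
    refine Finset.sum_le_sum fun i hi => ?_
    rw [Finset.mul_sum, Complex.re_sum]
    refine Finset.sum_le_sum fun j hj => ?_
    have hi' := Finset.mem_range.mp hi
    have hj' := Finset.mem_range.mp hj
    rw [mul_left_comm, Complex.re_ofReal_mul]
    by_cases hc : ∀ p ∈ P, ¬ ((p : ℤ) ∣ ((i : ℤ) - (j : ℤ)))
    · have hg1 : g i j = 1 := if_pos hc
      rw [hg1, one_mul, one_mul]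
      have hcop := (e_cop_iff u hu _).mp hc
      refine block_lemma f χ hχ ω hω h u v hv hvP H hHf hno
        ((i : ℤ) - (j : ℤ) - u * ((h / 2 : ℕ) : ℤ)) u dvd_rfl ?_ ?_
      · have := (IsCoprime.add_mul_left_left_iff (x := (i : ℤ) - j) (y := (u : ℤ))
          (z := -((h / 2 : ℕ) : ℤ))).mpr hcop
        have e1 : (i : ℤ) - (j : ℤ) - u * ((h / 2 : ℕ) : ℤ)
            = (i : ℤ) - j + u * (-((h / 2 : ℕ) : ℤ)) := by ring
        rw [e1]
        exact this
      · intro t ht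
        have h1 : |(i : ℤ) - (j : ℤ) - u * ((h / 2 : ℕ) : ℤ) + u * (t : ℕ)|
            ≤ (L : ℤ) - 1 + u * ((h / 2 : ℕ) : ℤ) := by
          have e1 : (i : ℤ) - (j : ℤ) - u * ((h / 2 : ℕ) : ℤ) + u * (t : ℕ)
            = ((i : ℤ) - (j : ℤ)) + u * ((t : ℤ) - ((h / 2 : ℕ) : ℤ)) := by ring
          rw [e1]
          refine (abs_add_le _ _).trans ?_
          rw [abs_mul, Nat.abs_cast]
          have a1 : |(i : ℤ) - (j : ℤ)| ≤ (L : ℤ) - 1 := by rw [abs_le]; omega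
          have a2 : |(t : ℤ) - ((h / 2 : ℕ) : ℤ)| ≤ ((h / 2 : ℕ) : ℤ) := by rw [abs_le]; omega
          have a3 : (u : ℤ) * |(t : ℤ) - ((h / 2 : ℕ) : ℤ)| ≤ u * ((h / 2 : ℕ) : ℤ) := by gcongr
          linarith
        refine le_trans ?_ hLH
        rw [← Int.cast_abs]
        have h2 : ((|(i : ℤ) - (j : ℤ) - u * ((h / 2 : ℕ) : ℤ) + u * (t : ℕ)| : ℤ) : ℝ)
            ≤ (((L : ℤ) - 1 + u * ((h / 2 : ℕ) : ℤ) : ℤ) : ℝ) := Int.cast_le.mpr h1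
        refine h2.trans (le_of_eq ?_)
        rw [Int.cast_add, Int.cast_sub, Int.cast_mul, Int.cast_natCast, Int.cast_natCast,
          Int.cast_natCast, Int.cast_one]
    · have hg0 : g i j = 0 := if_neg hc
      rw [hg0]; simp
  have hN : ∑ i ∈ Finset.range L, ∑ j ∈ Finset.range L, g i j
      = L * (L * ((Nat.totient u : ℝ) / u)) := e_count u L hu huL
  have hsplit : ∑ i ∈ Finset.range L, ∑ j ∈ Finset.range L,
      g i j * (-((h : ℝ) - 3 * (ℓ : ℝ)) / 2 + 1 / 2 * z i j)
      = -((h : ℝ) - 3 * (ℓ : ℝ)) / 2 * (L * (L * ((Nat.totient u : ℝ) / u)))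
        + 1 / 2 * ∑ i ∈ Finset.range L, ∑ j ∈ Finset.range L, g i j * z i j := by
    rw [← hN, Finset.mul_sum, Finset.mul_sum, ← Finset.sum_add_distrib]
    refine Finset.sum_congr rfl fun i _ => ?_
    rw [Finset.mul_sum, Finset.mul_sum, ← Finset.sum_add_distrib]
    refine Finset.sum_congr rfl fun j _ => ?_
    ring
  rw [hsplit] at hupper
  have hlow : -‖T‖ ≤ (starRingEnd ℂ ω * T).re := by
    have h1 := Complex.abs_re_le_norm (starRingEnd ℂ ω * T)
    rw [norm_mul, Complex.norm_conj, hω1, one_mul] at h1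
    exact (abs_le.mp h1).1
  by_cases hu1 : u = 1
  · -- no sieving
    have hP0 : P = ∅ := by rw [hP, hu1]; simp
    have hLf' : (L : ℝ) ≤ f := by exact_mod_cast hLf
    have hTb : ‖T‖ ≤ h * (L * Real.sqrt (f - L)) := by
      rw [hT]
      refine (norm_sum_le _ _).trans ?_
      refine (Finset.sum_le_card_nsmul _ _ (L * Real.sqrt (f - L)) fun t _ => ?_).trans (by simp)
      have hb := e_bilin f χ hχ L hLf 1 (by simp) (sh t)
      have h2 : eS f χ L P 1 (sh t) = ∑ i ∈ Finset.range L, ∑ j ∈ Finset.range L,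
        (1 : ℂ) ^ ((i : ℤ) - (j : ℤ)) * χ (((i : ℤ) - (j : ℤ) + sh t : ℤ) : ZMod f) := by
        rw [hP0]; simp [eS]
      rw [← h2] at hb
      apply le_of_sq_le_sq _ (by positivity)
      rw [mul_pow, Real.sq_sqrt (by linarith)]
      refine hb.trans (le_of_eq ?_)
      simp
      ring
    have hZ : ∑ i ∈ Finset.range L, ∑ j ∈ Finset.range L, g i j * z i j ≤ h * L := by
      have h1 : ∑ i ∈ Finset.range L, ∑ j ∈ Finset.range L, g i j * z i j
          ≤ ∑ i ∈ Finset.range L, (h : ℝ) := by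
        refine Finset.sum_le_sum fun i _ => ?_
        have h2 : ∑ j ∈ Finset.range L, g i j * z i j ≤ ∑ j ∈ Finset.range L, z i j := by
          refine Finset.sum_le_sum fun j _ => ?_
          have hz0 : 0 ≤ z i j := by
            simp only [hz]
            exact Finset.sum_nonneg fun t _ => by split_ifs <;> norm_num
          have hg1 : g i j ≤ 1 := by simp only [hg]; split_ifs <;> norm_num
          nlinarith
        refine h2.trans ?_
        simp only [hz]
        rw [Finset.sum_comm]
        refine (Finset.sum_le_card_nsmul _ _ (1 : ℝ) fun t _ => ?_).trans (by simp)
        rw [Finset.sum_boole]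
        have : (Finset.filter (fun j : ℕ => (i : ℤ) - (j : ℤ) - u * ((h / 2 : ℕ) : ℤ) + u * (t : ℕ) = 0)
            (Finset.range L)).card ≤ 1 := by
          rw [Finset.card_le_one]
          intro a ha b hb
          have ha' := (Finset.mem_filter.mp ha).2
          have hb' := (Finset.mem_filter.mp hb).2
          omega
        exact_mod_cast this
      refine h1.trans (le_of_eq ?_)
      simp [mul_comm]
    have hkey : (L : ℝ) * ((h : ℝ) - 3 * (ℓ : ℝ)) ≤ 2 * h * (Real.sqrt (f - L) + 1 / 2) := by
      have e1 : ((Nat.totient u : ℝ) / u) = 1 := by rw [hu1]; simp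
      rw [e1] at hupper
      have : (L : ℝ) * (L * ((h : ℝ) - 3 * (ℓ : ℝ))) ≤ L * (2 * h * (Real.sqrt (f - L) + 1 / 2)) := by
        nlinarith
      exact le_of_mul_le_mul_left this hLR
    by_contra hcon
    push Not at hcon
    rw [hP0] at hcon
    simp only [Finset.card_empty, pow_zero, one_mul] at hcon
    have hf1 : (1 : ℝ) ≤ Real.sqrt f := by
      rw [Real.one_le_sqrt]
      exact_mod_cast (Fact.out : f.Prime).one_le
    have hA2 : (2 : ℝ) ≤ (2 * h : ℝ) / ((h : ℝ) - 3 * (ℓ : ℝ)) := by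
      rw [le_div_iff₀ hD]
      have : (0 : ℝ) ≤ ℓ := by positivity
      linarith
    have hL2 : 2 * Real.sqrt f < L := by
      refine lt_of_le_of_lt ?_ hcon
      gcongr
    have h5 : Real.sqrt f < Real.sqrt (f - L) + 1 / 2 := by
      rw [div_mul_eq_mul_div, div_lt_iff₀ hD] at hcon
      have := hcon.trans_le hkey
      exact lt_of_mul_lt_mul_left this (by positivity)
    have h6 := Real.sq_sqrt (show (0 : ℝ) ≤ f by positivity)
    have h7 := Real.sq_sqrt (show (0 : ℝ) ≤ (f : ℝ) - L by linarith)
    have h8 := Real.sqrt_nonneg ((f : ℝ) - L)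
    nlinarith
  · have hZ : ∑ i ∈ Finset.range L, ∑ j ∈ Finset.range L, g i j * z i j = 0 := by
      refine Finset.sum_eq_zero fun i _ => Finset.sum_eq_zero fun j _ => ?_
      by_cases hc : ∀ p ∈ P, ¬ ((p : ℤ) ∣ ((i : ℤ) - (j : ℤ)))
      · have : z i j = 0 := by
          simp only [hz]
          refine Finset.sum_eq_zero fun t _ => if_neg ?_
          intro h0
          obtain ⟨p, hp, hpu⟩ := Nat.exists_prime_and_dvd hu1
          apply hc p (Nat.mem_primeFactors.mpr ⟨hp, hpu, by omega⟩)
          refine (Int.natCast_dvd_natCast.mpr hpu).trans ⟨((h / 2 : ℕ) : ℤ) - t, ?_⟩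
          linarith
        rw [this, mul_zero]
      · have : g i j = 0 := if_neg hc
        rw [this, zero_mul]
    rw [hZ] at hupper
    have hprod : ∏ p ∈ P, (2 * (1 - 1 / (p : ℝ))) = 2 ^ P.card * ((Nat.totient u : ℝ) / u) := by
      rw [Finset.prod_mul_distrib, Finset.prod_const]
      congr 1
      have e1 := c_totient_prod u huSq
      have e2 := c_self_prod u huSq
      have e3 : ((Nat.totient u : ℝ) / u) = (∏ p ∈ P, ((p : ℝ) - 1)) / ∏ p ∈ P, (p : ℝ) := by
        rw [← e1, ← e2]
      rw [e3, ← Finset.prod_div_distrib]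
      refine Finset.prod_congr rfl fun p hp => ?_
      have : (p : ℝ) ≠ 0 := by
        exact_mod_cast (Nat.prime_of_mem_primeFactors hp).ne_zero
      field_simp
    have hTb : ‖T‖ ≤ h * (2 ^ P.card * ((Nat.totient u : ℝ) / u) * (L * Real.sqrt f)) := by
      rw [hT]
      refine (norm_sum_le _ _).trans ?_
      refine (Finset.sum_le_card_nsmul _ _ (2 ^ P.card * ((Nat.totient u : ℝ) / u) * (L * Real.sqrt f))
        fun t _ => ?_).trans (by simp)
      rw [← hprod]
      exact eS_bound f χ hχ L hLf (sh t) P (fun p hp => Nat.prime_of_mem_primeFactors hp) 1 (by simp)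
    have hpos : (0 : ℝ) < L * ((Nat.totient u : ℝ) / u) := by positivity
    have hkey : (L * ((Nat.totient u : ℝ) / u)) * (L * ((h : ℝ) - 3 * (ℓ : ℝ)))
        ≤ (L * ((Nat.totient u : ℝ) / u)) * (2 ^ P.card * (2 * h) * Real.sqrt f) := by
      nlinarith
    have := le_of_mul_le_mul_left hkey hpos
    rw [mul_div_assoc', div_mul_eq_mul_div, le_div_iff₀ hD]
    exact this

end PartE3

section PartF1
theorem f_rho (u : ℕ) (hu : Squarefree u) :
    (if 2 ∣ u then (1 / 2 : ℝ) else 1) * (if 3 ∣ u then (3 / 4 : ℝ) else 1)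
      ≤ (u : ℝ) / 4 ^ u.primeFactors.card := by
  have hu0 : u ≠ 0 := hu.ne_zero
  have h1 : (u : ℝ) / 4 ^ u.primeFactors.card = ∏ p ∈ u.primeFactors, ((p : ℝ) / 4) := by
    rw [Finset.prod_div_distrib, Finset.prod_const, ← c_self_prod u hu]
  have h2 : (if 2 ∣ u then (1 / 2 : ℝ) else 1) * (if 3 ∣ u then (3 / 4 : ℝ) else 1)
      = ∏ p ∈ u.primeFactors, ((if p = 2 then (1 / 2 : ℝ) else 1) * (if p = 3 then (3 / 4 : ℝ) else 1)) := by
    rw [Finset.prod_mul_distrib, Finset.prod_ite_eq', Finset.prod_ite_eq']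
    have a2 : 2 ∈ u.primeFactors ↔ 2 ∣ u := by
      simp [Nat.mem_primeFactors, Nat.prime_two, hu0]
    have a3 : 3 ∈ u.primeFactors ↔ 3 ∣ u := by
      simp [Nat.mem_primeFactors, Nat.prime_three, hu0]
    simp only [a2, a3]
  rw [h1, h2]
  refine Finset.prod_le_prod (fun p _ => by split_ifs <;> norm_num) fun p hp => ?_
  have hpp := Nat.prime_of_mem_primeFactors hp
  have hp2 := hpp.two_le
  by_cases e2 : p = 2
  · subst e2; norm_num
  by_cases e3 : p = 3
  · subst e3; norm_num
  have : 4 ≤ p := by omega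
  have : (4 : ℝ) ≤ p := by exact_mod_cast this
  simp [e2, e3]
  linarith

theorem f_b (u : ℕ) (hu : Squarefree u) :
    6 ^ u.primeFactors.card * (Nat.totient u : ℝ) ≤ u * ((∑ d ∈ u.divisors, d : ℕ) : ℝ) := by
  rw [c_totient_prod u hu, c_sigma_prod u hu]
  rw [c_self_prod u hu]
  rw [← Finset.prod_const, ← Finset.prod_mul_distrib, ← Finset.prod_mul_distrib]
  have key : ∀ p ∈ u.primeFactors, (2 : ℝ) ≤ p ∧ (0 : ℝ) ≤ ((p : ℝ) - 2) * (p - 3) := by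
    intro p hp
    have hp2 := (Nat.prime_of_mem_primeFactors hp).two_le
    have h2 : (2 : ℝ) ≤ p := by exact_mod_cast hp2
    refine ⟨h2, ?_⟩
    by_cases e2 : p = 2
    · subst e2; norm_num
    have : 3 ≤ p := by omega
    have : (3 : ℝ) ≤ p := by exact_mod_cast this
    apply mul_nonneg <;> linarith
  refine Finset.prod_le_prod (fun p hp => ?_) fun p hp => ?_
  · have := (key p hp).1; nlinarith
  · have := (key p hp).2; nlinarith

theorem f_tele (N : ℕ) (hN : 1 ≤ N) :
    ∏ n ∈ Finset.Icc 2 N, (1 - 1 / (n : ℝ) ^ 2) = ((N : ℝ) + 1) / (2 * N) := by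
  induction N, hN using Nat.le_induction with
  | base => simp
  | succ n hn ih =>
    rw [Finset.prod_Icc_succ_top (by omega), ih]
    have : (n : ℝ) ≠ 0 := by positivity
    push_cast
    have : (n : ℝ) + 1 ≠ 0 := by positivity
    field_simp
    ring

theorem f_half (u : ℕ) (hu : Squarefree u) :
    (u : ℝ) ^ 2 ≤ 2 * ((Nat.totient u : ℝ) * ((∑ d ∈ u.divisors, d : ℕ) : ℝ)) := by
  have hu0 : 0 < u := Nat.pos_of_ne_zero hu.ne_zero
  have huR : (0 : ℝ) < u := by exact_mod_cast hu0
  have hsub : u.primeFactors ⊆ Finset.Icc 2 u := by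
    intro p hp
    have := Nat.mem_primeFactors.mp hp
    exact Finset.mem_Icc.mpr ⟨this.1.two_le, Nat.le_of_dvd hu0 this.2.1⟩
  have h1 : ∏ p ∈ u.primeFactors, (1 - 1 / (p : ℝ) ^ 2)
      = (Nat.totient u : ℝ) * ((∑ d ∈ u.divisors, d : ℕ) : ℝ) / u ^ 2 := by
    rw [c_totient_prod u hu, c_sigma_prod u hu, c_self_prod u hu, ← Finset.prod_mul_distrib,
      ← Finset.prod_pow, ← Finset.prod_div_distrib]
    refine Finset.prod_congr rfl fun p hp => ?_
    have : (p : ℝ) ≠ 0 := by exact_mod_cast (Nat.prime_of_mem_primeFactors hp).ne_zero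
    field_simp
    ring
  have hn0 : ∀ n ∈ Finset.Icc 2 u, (0 : ℝ) ≤ 1 - 1 / (n : ℝ) ^ 2 ∧ 1 - 1 / (n : ℝ) ^ 2 ≤ 1 := by
    intro n hn
    have h2 : (2 : ℝ) ≤ n := by exact_mod_cast (Finset.mem_Icc.mp hn).1
    constructor
    · rw [sub_nonneg, div_le_one (by positivity)]; nlinarith
    · have : (0 : ℝ) ≤ 1 / (n : ℝ) ^ 2 := by positivity
      linarith
  have h2 := f_tele u hu0
  rw [← Finset.prod_sdiff hsub, h1] at h2
  have h3 : ∏ n ∈ Finset.Icc 2 u \ u.primeFactors, (1 - 1 / (n : ℝ) ^ 2) ≤ 1 :=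
    Finset.prod_le_one (fun n hn => (hn0 n (Finset.mem_sdiff.mp hn).1).1)
      fun n hn => (hn0 n (Finset.mem_sdiff.mp hn).1).2
  have h4 : (0 : ℝ) ≤ (Nat.totient u : ℝ) * ((∑ d ∈ u.divisors, d : ℕ) : ℝ) / u ^ 2 := by positivity
  have h5 : (1 : ℝ) / 2 ≤ ((u : ℝ) + 1) / (2 * u) := by
    rw [div_le_div_iff₀ (by norm_num) (by positivity)]; linarith
  have h6 : (1 : ℝ) / 2 ≤ (Nat.totient u : ℝ) * ((∑ d ∈ u.divisors, d : ℕ) : ℝ) / u ^ 2 := by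
    nlinarith
  rw [le_div_iff₀ (by positivity)] at h6
  linarith

theorem f_sig (u : ℕ) (hu : 1 < u) : u + 1 ≤ ∑ d ∈ u.divisors, d := by
  have h : ({u, 1} : Finset ℕ) ⊆ u.divisors := by
    intro x hx
    simp only [Finset.mem_insert, Finset.mem_singleton] at hx
    rcases hx with rfl | rfl
    · simp; omega
    · simp; omega
  calc u + 1 = ∑ d ∈ ({u, 1} : Finset ℕ), d := by rw [Finset.sum_pair (by omega)]
    _ ≤ _ := Finset.sum_le_sum_of_subset h

theorem f_fac (r : ℕ) (hr : 0 < r) (y : ℝ) :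
    (1 / 2 ≤ y → 1 ≤ (r.factorial : ℝ) * y ^ (r - 1)) ∧
    (1 / 3 ≤ y → 2 / 3 ≤ (r.factorial : ℝ) * y ^ (r - 1)) ∧
    (1 / 4 ≤ y → 3 / 8 ≤ (r.factorial : ℝ) * y ^ (r - 1)) ∧
    (1 / 5 ≤ y → 24 / 125 ≤ (r.factorial : ℝ) * y ^ (r - 1)) := by
  obtain ⟨n, rfl⟩ : ∃ n, r = n + 1 := ⟨r - 1, by omega⟩
  rw [Nat.add_sub_cancel]
  have step : ∀ (c m : ℝ) (N : ℕ), 0 ≤ c → 0 ≤ m → 1 ≤ (N + 2 : ℝ) * c →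
      m ≤ ((N + 1).factorial : ℝ) * c ^ N → ∀ k, N ≤ k → m ≤ ((k + 1).factorial : ℝ) * c ^ k := by
    intro c m N hc hm h1 h2 k hk
    induction k, hk using Nat.le_induction with
    | base => exact h2
    | succ k hk ih =>
      have e : ((k + 1 + 1).factorial : ℝ) * c ^ (k + 1)
          = (((k : ℝ) + 2) * c) * (((k + 1).factorial : ℝ) * c ^ k) := by
        rw [Nat.factorial_succ (k + 1), pow_succ]; push_cast; ring
      have : (N : ℝ) ≤ k := by exact_mod_cast hk
      have h3 : 1 ≤ ((k : ℝ) + 2) * c := by nlinarith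
      rw [e]
      nlinarith
  have mono : ∀ (c m : ℝ), 0 ≤ c → (m ≤ ((n + 1).factorial : ℝ) * c ^ n) → c ≤ y →
      m ≤ ((n + 1).factorial : ℝ) * y ^ n := by
    intro c m hc h1 h2
    refine h1.trans ?_
    gcongr
  refine ⟨fun h => mono _ _ (by norm_num) ?_ h, fun h => mono _ _ (by norm_num) ?_ h,
    fun h => mono _ _ (by norm_num) ?_ h, fun h => mono _ _ (by norm_num) ?_ h⟩
  · exact step (1 / 2) 1 0 (by norm_num) (by norm_num) (by norm_num) (by norm_num) n (by omega)
  · rcases Nat.lt_or_ge n 1 with h0 | h0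
    · interval_cases n <;> norm_num
    · exact step (1 / 3) (2 / 3) 1 (by norm_num) (by norm_num) (by norm_num)
        (by norm_num [Nat.factorial]) n h0
  · rcases Nat.lt_or_ge n 2 with h0 | h0
    · interval_cases n <;> norm_num
    · exact step (1 / 4) (3 / 8) 2 (by norm_num) (by norm_num) (by norm_num)
        (by norm_num [Nat.factorial]) n h0
  · rcases Nat.lt_or_ge n 3 with h0 | h0
    · interval_cases n <;> norm_num [Nat.factorial]
    · exact step (1 / 5) (24 / 125) 3 (by norm_num) (by norm_num) (by norm_num)
        (by norm_num [Nat.factorial]) n h0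

end PartF1

section PartF2
theorem f_core (h r : ℕ) (hr : 0 < r) (hh : 0 < h) (b ρ e s κ Y : ℝ) (hs0 : 0 < s)
    (hes : e * s < 1) (hY1 : 4 ≤ Y * h) (hY2 : κ ^ 2 * ρ * h ≤ Y * (h + 1))
    (hlt : b * κ ^ 2 * ((r.factorial : ℝ) * Y ^ (r - 1)) < 1 - e * s)
    (hcase : (1 - s / 2 ≤ κ ∧ 2.05 ≤ e ∧ 1.64 ≤ b ∧ 1 ≤ ρ) ∨
      (1 - s * (1 / 2 + 1 / h) ≤ κ ∧ 3 ≤ h ∧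
        ((1 ≤ ρ ∧ 3.2 ≤ e ∧ 1.64 ≤ b) ∨ (3 / 4 ≤ ρ ∧ 2.87 ≤ e ∧ 2.46 ≤ b) ∨
         (1 / 2 ≤ ρ ∧ 2.66 ≤ e ∧ 2.46 ≤ b) ∨ (3 / 8 ≤ ρ ∧ 4.1 ≤ e ∧ 3.69 ≤ b)))) : False := by
  obtain ⟨m1, m2, m3, m4⟩ := f_fac r hr Y
  have hhR : (0 : ℝ) < h := by exact_mod_cast hh
  set M := (r.factorial : ℝ) * Y ^ (r - 1) with hM
  have hse : ∀ e0 : ℝ, e0 ≤ e → e0 * s ≤ e * s := fun e0 he0 => mul_le_mul_of_nonneg_right he0 hs0.le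
  have hK0 : 0 ≤ κ ^ 2 := sq_nonneg _
  -- finishing step
  have fin : ∀ (m b0 α : ℝ), 0 ≤ m → 0 ≤ b0 → b0 ≤ b → m ≤ M → 1 - α * s ≤ κ → 0 ≤ 1 - α * s →
      1 - e * s ≤ b0 * m * (1 - 2 * α * s) → False := by
    intro m b0 α hm hb0 hb hmM hκ hα hfin
    have k1 : 1 - 2 * α * s ≤ κ ^ 2 := by nlinarith [sq_nonneg (α * s)]
    have k2 : b0 * m * (1 - 2 * α * s) ≤ b0 * m * κ ^ 2 := by gcongr
    have k3 : b0 * m * κ ^ 2 ≤ b * κ ^ 2 * M := by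
      calc b0 * m * κ ^ 2 = b0 * κ ^ 2 * m := by ring
        _ ≤ b * κ ^ 2 * M := by
          have hb1 : 0 ≤ b := hb0.trans hb
          have hb2 : 0 ≤ b * κ ^ 2 := mul_nonneg hb1 hK0
          gcongr
    linarith
  have big : 9 ≤ h → ∀ ρ0 k0 : ℝ, 0 ≤ ρ0 → ρ0 ≤ ρ → 0 ≤ k0 → k0 ≤ κ → 0.9 * (k0 ^ 2 * ρ0) ≤ Y := by
    intro h9 ρ0 k0 hρ0 hρ hk0 hk
    have h9R : (9 : ℝ) ≤ h := by exact_mod_cast h9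
    have a1 : k0 ^ 2 * ρ0 ≤ κ ^ 2 * ρ := by gcongr
    have a2 : 0 ≤ k0 ^ 2 * ρ0 := by positivity
    have a3 : 0.9 * (k0 ^ 2 * ρ0) * (h + 1) ≤ Y * (h + 1) := by
      refine le_trans ?_ hY2
      calc 0.9 * (k0 ^ 2 * ρ0) * (h + 1) ≤ (k0 ^ 2 * ρ0) * h := by nlinarith
        _ ≤ _ := by gcongr
    exact le_of_mul_le_mul_right a3 (by positivity)
  have small : h ≤ 8 → 1 / 2 ≤ Y := by
    intro h8
    have h8R : (h : ℝ) ≤ 8 := by exact_mod_cast h8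
    by_contra hc
    push Not at hc
    nlinarith
  rcases hcase with ⟨hκ, he, hb, hρ⟩ | ⟨hκ, h3, hc⟩
  · have hs : s < 0.488 := by linarith [hse _ he]
    have hYh : 1 / 2 ≤ Y := by
      rcases Nat.lt_or_ge h 9 with h9 | h9
      · exact small (by omega)
      · have := big h9 1 0.756 (by norm_num) hρ (by norm_num) (by linarith)
        norm_num at this ⊢
        linarith
    exact fin 1 1.64 (1 / 2) (by norm_num) (by norm_num) hb (m1 hYh) (by linarith) (by linarith)
      (by linarith [hse _ he])
  · have h3R : (3 : ℝ) ≤ h := by exact_mod_cast h3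
    have hinv : 1 / (h : ℝ) ≤ 1 / 3 := by gcongr
    rcases Nat.lt_or_ge h 9 with h9 | h9
    · have hYh := small (by omega)
      have hκ' : 1 - 5 / 6 * s ≤ κ := by nlinarith
      have hbe : 1.64 ≤ b ∧ 2.66 ≤ e := by
        rcases hc with hc | hc | hc | hc <;> constructor <;> linarith [hc.2.1, hc.2.2]
      have hs : s < 0.376 := by linarith [hse _ hbe.2]
      exact fin 1 1.64 (5 / 6) (by norm_num) (by norm_num) hbe.1 (m1 hYh) (by linarith) (by linarith)
        (by linarith [hse _ hbe.2])
    · have h9R : (9 : ℝ) ≤ h := by exact_mod_cast h9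
      have hinv : 1 / (h : ℝ) ≤ 1 / 9 := by gcongr
      have hκ' : 1 - 11 / 18 * s ≤ κ := by nlinarith
      rcases hc with ⟨hρ, he, hb⟩ | ⟨hρ, he, hb⟩ | ⟨hρ, he, hb⟩ | ⟨hρ, he, hb⟩
      · have hs : s < 0.313 := by linarith [hse _ he]
        have hY := big h9 1 0.808 (by norm_num) hρ (by norm_num) (by linarith)
        norm_num at hY
        exact fin 1 1.64 (11 / 18) (by norm_num) (by norm_num) hb (m1 (by linarith)) hκ'
          (by linarith) (by linarith [hse _ he])
      · have hs : s < 0.349 := by linarith [hse _ he]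
        have hY := big h9 (3 / 4) 0.786 (by norm_num) hρ (by norm_num) (by linarith)
        norm_num at hY
        exact fin (2 / 3) 2.46 (11 / 18) (by norm_num) (by norm_num) hb (m2 (by linarith)) hκ'
          (by linarith) (by linarith [hse _ he])
      · have hs : s < 0.376 := by linarith [hse _ he]
        rcases le_or_gt s 0.06 with hs6 | hs6
        · have hY := big h9 (1 / 2) 0.96 (by norm_num) hρ (by norm_num) (by linarith)
          norm_num at hY
          exact fin (2 / 3) 2.46 (11 / 18) (by norm_num) (by norm_num) hb (m2 (by linarith)) hκ'
            (by linarith) (by linarith [hse _ he])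
        · have hY := big h9 (1 / 2) 0.77 (by norm_num) hρ (by norm_num) (by linarith)
          norm_num at hY
          exact fin (3 / 8) 2.46 (11 / 18) (by norm_num) (by norm_num) hb (m3 (by linarith)) hκ'
            (by linarith) (by linarith [hse _ he])
      · have hs : s < 0.2441 := by linarith [hse _ he]
        rcases le_or_gt s 0.1 with hs6 | hs6
        · have hY := big h9 (3 / 8) 0.93 (by norm_num) hρ (by norm_num) (by linarith)
          norm_num at hY
          exact fin (3 / 8) 3.69 (11 / 18) (by norm_num) (by norm_num) hb (m3 (by linarith)) hκ'
            (by linarith) (by linarith [hse _ he])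
        · have hY := big h9 (3 / 8) 0.85 (by norm_num) hρ (by norm_num) (by linarith)
          norm_num at hY
          exact fin (24 / 125) 3.69 (11 / 18) (by norm_num) (by norm_num) hb (m4 (by linarith)) hκ'
            (by linarith) (by linarith [hse _ he])

end PartF2

section PartF3
theorem f_W (f h r : ℕ) (hr : 0 < r) (hh : 0 < h) :
    Real.sqrt f / (h : ℝ) ^ r * (r.factorial : ℝ) ≤ WFun f h r := by
  have hhR : (0 : ℝ) < h := by exact_mod_cast hh
  have hd : 1 ≤ dFun r h := by
    unfold dFun
    rw [Finset.sum_range_succ']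
    have h1 : 0 ≤ ∑ n ∈ Finset.range (r / 3), ((r.factorial : ℝ) / (((n + 1).factorial : ℝ) * 6 ^ (n + 1))) ^ 2 *
        (h : ℝ) ^ (r - (n + 1)) / ((r - 3 * (n + 1)).factorial : ℝ) :=
      Finset.sum_nonneg fun n _ => by positivity
    have hrf : (0 : ℝ) < r.factorial := by positivity
    have h2 : (1 / ((r.factorial : ℝ) * (h : ℝ) ^ r)) * (((r.factorial : ℝ) / ((Nat.factorial 0 : ℝ) * 6 ^ 0)) ^ 2 *
        (h : ℝ) ^ (r - 0) / ((r - 3 * 0).factorial : ℝ)) = 1 := by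
      simp; field_simp
    rw [mul_add, h2]
    have : 0 ≤ (1 / ((r.factorial : ℝ) * (h : ℝ) ^ r)) := by positivity
    have := mul_nonneg this h1
    linarith
  have h1 : (1 : ℝ) ≤ r := by exact_mod_cast hr
  have h2 : 0 ≤ Real.sqrt f / (h : ℝ) ^ r * (r.factorial : ℝ) := by positivity
  unfold WFun
  nlinarith

theorem f_pi : 1.644 ≤ Real.pi ^ 2 / 6 := by
  have := Real.pi_gt_d4
  nlinarith

set_option maxHeartbeats 1600000 in
theorem pv_case (f : ℕ) [Fact f.Prime] (χ : MulChar (ZMod f) ℂ) (hχ : orderOf χ = 3)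
    (ω : ℂ) (hω : ω ^ 3 = 1) (r h u v : ℕ) (hr : 0 < r) (hh : 0 < h) (hu : 0 < u) (hv : 0 < v)
    (huSq : Squarefree u) (huP : ∀ p : ℕ, p.Prime → p ∣ u → p < h)
    (hvP : ∀ p : ℕ, p.Prime → p ∣ v → h ≤ p)
    (h3 : 3 * v.primeFactors.card < h) (H X : ℝ) (hXH : H = h * X) (hHf : H < f)
    (hXu : 1 ≤ X / u) (hE : EFun u X > 0)
    (hno : ∀ m : ℕ, 0 < m → (m : ℝ) ≤ H → Nat.Coprime m (u * v) → χ (m : ZMod f) ≠ ω)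
    (hcase : f * u ≤ ((h : ℝ) + 1) * X ^ 2)
    (hmain : (1 / EFun u X) * (Real.pi ^ 2 / 6) * ((sigmaFun u : ℝ) / (Nat.totient u : ℝ)) *
      u * h * Real.sqrt f * ((2 * h : ℝ) / ((h : ℝ) - 3 * (v.primeFactors.card : ℕ))) ^ (2 * r) *
        WFun f h r / H ^ 2 < 1) : False := by
  have huR : (0 : ℝ) < u := by exact_mod_cast hu
  have hu1R : (1 : ℝ) ≤ u := by exact_mod_cast hu
  have hhR : (0 : ℝ) < h := by exact_mod_cast hh
  have hh1R : (1 : ℝ) ≤ h := by exact_mod_cast hh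
  have hXu' : (u : ℝ) ≤ X := by rwa [le_div_iff₀ huR, one_mul] at hXu
  have hX0 : 0 < X := by linarith
  have hH0 : 0 < H := by rw [hXH]; positivity
  have hHuh : (u : ℝ) * h ≤ H := by rw [hXH, mul_comm]; gcongr
  have hfR : (0 : ℝ) < f := hH0.trans hHf
  -- choice of L
  set y : ℝ := (H + 1 - u * ((h / 2 : ℕ) : ℝ)) / u with hy
  set q : ℕ := ⌊y⌋₊ with hq
  have hh2 : ((h / 2 : ℕ) : ℝ) + 1 ≤ h + (if h = 0 then 1 else 0) := by
    rw [if_neg hh.ne']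
    have : h / 2 + 1 ≤ h := by omega
    have : (((h / 2 + 1 : ℕ)) : ℝ) ≤ h := by exact_mod_cast this
    push_cast at this; linarith
  rw [if_neg hh.ne', add_zero] at hh2
  have hh2' : ((h / 2 : ℕ) : ℝ) ≤ h / 2 := Nat.cast_div_le
  have hy1 : 1 ≤ y := by
    rw [hy, le_div_iff₀ huR]; nlinarith
  have hq1 : 1 ≤ q := Nat.le_floor (by simpa using hy1)
  have hqy : (q : ℝ) ≤ y := Nat.floor_le (by linarith)
  have hyq : y < q + 1 := Nat.lt_floor_add_one y
  have hyu : y * u = H + 1 - u * ((h / 2 : ℕ) : ℝ) := by rw [hy]; field_simp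
  set L : ℕ := u * q with hL
  have hLup : (L : ℝ) ≤ H + 1 - u * ((h / 2 : ℕ) : ℝ) := by
    rw [← hyu, hL]; push_cast; nlinarith
  have hLlow : H + 1 - u * ((h / 2 : ℕ) : ℝ) - u ≤ L := by
    rw [← hyu, hL]; push_cast; nlinarith
  have hL0 : 0 < L := Nat.mul_pos hu hq1
  have hLf : L ≤ f := by
    rcases Nat.lt_or_ge h 2 with h2 | h2
    · have : (L : ℝ) < f + 1 := by
        have : (0 : ℝ) ≤ u * ((h / 2 : ℕ) : ℝ) := by positivity
        linarith
      have : L < f + 1 := by exact_mod_cast this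
      omega
    · have h21 : 1 ≤ h / 2 := by omega
      have : (1 : ℝ) ≤ ((h / 2 : ℕ) : ℝ) := by exact_mod_cast h21
      have : (L : ℝ) ≤ f := by nlinarith
      exact_mod_cast this
  have hem := e_main f χ hχ ω hω h u v hu hv huSq hvP h3 H hHf hno L (Dvd.intro _ rfl) hL0 hLf
    (by linarith)
  set D : ℝ := (h : ℝ) - 3 * (v.primeFactors.card : ℝ) with hDdef
  have hD : 0 < D := by
    have : (3 * v.primeFactors.card : ℝ) < h := by exact_mod_cast h3
    rw [hDdef]; linarith
  set A : ℝ := (2 * h : ℝ) / D with hA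
  have hA2 : 2 ≤ A := by
    rw [hA, le_div_iff₀ hD]
    have : (0 : ℝ) ≤ (v.primeFactors.card : ℝ) := by positivity
    rw [hDdef]; linarith
  set k := u.primeFactors.card with hk
  have hL2 : (L : ℝ) ^ 2 ≤ 4 ^ k * (A ^ 2 * f) := by
    calc (L : ℝ) ^ 2 ≤ (2 ^ k * A * Real.sqrt f) ^ 2 := by gcongr
      _ = 4 ^ k * (A ^ 2 * f) := by
        rw [mul_pow, mul_pow, Real.sq_sqrt hfR.le, ← pow_mul, mul_comm k 2, pow_mul]; norm_num; ring
  have hσe : (sigmaFun u : ℝ) = ((∑ d ∈ u.divisors, d : ℕ) : ℝ) := rfl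
  have hfb := f_b u huSq
  have hfh := f_half u huSq
  rw [← hσe, ← hk] at hfb
  rw [← hσe] at hfh
  have hEe : EFun u X = 1 - (Real.pi ^ 2 / 6) * (sigmaFun u : ℝ) *
    ((sigmaFun u : ℝ) / 4 + (Nat.totient u : ℝ) / u + (Nat.totient u : ℝ) / X) / X := rfl
  set E := EFun u X with hEd
  set σ : ℝ := (sigmaFun u : ℝ) with hσ
  set φ : ℝ := (Nat.totient u : ℝ) with hφ
  have hφ0 : 0 < φ := by rw [hφ]; exact_mod_cast Nat.totient_pos.2 hu
  have hσ0 : (0 : ℝ) < σ := by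
    rw [hσe, c_sigma_prod u huSq]
    exact Finset.prod_pos fun p _ => by positivity
  have hpi := Real.pi_pos
  set g : ℝ := Real.pi ^ 2 / 6 with hg
  have hg1 : 1.644 ≤ g := by
    exact f_pi
  have hg0 : 0 < g := by linarith
  set e : ℝ := g * (σ ^ 2 / (4 * u) + φ * σ / u ^ 2) with he
  set s : ℝ := u / X with hs
  have hs0 : 0 < s := by positivity
  have hEs : E ≤ 1 - e * s := by
    rw [hEe]
    have h1 : e * s = g * σ * (σ / 4 + φ / u) / X := by
      rw [he, hs]; field_simp
    have h2 : g * σ * (σ / 4 + φ / u + φ / X) / X = g * σ * (σ / 4 + φ / u) / X + g * σ * (φ / X) / X := by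
      ring
    rw [h1, h2]
    have : 0 ≤ g * σ * (φ / X) / X := by positivity
    linarith
  set Y : ℝ := A ^ 2 / h with hY
  set κ : ℝ := L / H with hκ
  have hfour : (0 : ℝ) < 4 ^ k := by positivity
  -- consequence of the main hypothesis
  have hm2 : g * (σ / φ) * u * (A ^ 2 * f) * ((r.factorial : ℝ) * Y ^ (r - 1)) < E * H ^ 2 := by
    rw [div_lt_one (by positivity)] at hmain
    have h1 := f_W f h r hr hh
    have h2 : (1 / E) * g * (σ / φ) * u * h * Real.sqrt f * A ^ (2 * r) *
        (Real.sqrt f / (h : ℝ) ^ r * (r.factorial : ℝ)) < H ^ 2 := by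
      refine lt_of_le_of_lt ?_ hmain
      gcongr
    have h3 : (1 / E) * g * (σ / φ) * u * h * Real.sqrt f * A ^ (2 * r) *
        (Real.sqrt f / (h : ℝ) ^ r * (r.factorial : ℝ))
        = (g * (σ / φ) * u * (A ^ 2 * f) * ((r.factorial : ℝ) * Y ^ (r - 1))) / E := by
      obtain ⟨n, rfl⟩ : ∃ n, r = n + 1 := ⟨r - 1, by omega⟩
      have hs : Real.sqrt f ^ 2 = f := Real.sq_sqrt hfR.le
      rw [Nat.add_sub_cancel, hY, div_pow (A ^ 2)]
      have e1 : A ^ (2 * (n + 1)) = A ^ 2 * (A ^ 2) ^ n := by rw [pow_mul, pow_succ]; ring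
      have e2 : (h : ℝ) ^ (n + 1) = h ^ n * h := pow_succ _ _
      rw [e1, e2]
      field_simp
      rw [hs]
    rw [h3, div_lt_iff₀ hE] at h2
    linarith
  have hM0 : 0 ≤ (r.factorial : ℝ) * Y ^ (r - 1) := by positivity
  set M := (r.factorial : ℝ) * Y ^ (r - 1) with hM
  set ρ : ℝ := u / 4 ^ k with hρ
  set b : ℝ := g * (u * σ / φ) / 4 ^ k with hb
  have hlt : b * κ ^ 2 * M < 1 - e * s := by
    refine lt_of_lt_of_le ?_ hEs
    have h1 : b * κ ^ 2 * M ≤ (g * (σ / φ) * u * (A ^ 2 * f) * M) / H ^ 2 := by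
      calc b * κ ^ 2 * M = (g * (σ / φ) * u * M / (4 ^ k * H ^ 2)) * L ^ 2 := by
            rw [hb, hκ]; field_simp
        _ ≤ (g * (σ / φ) * u * M / (4 ^ k * H ^ 2)) * (4 ^ k * (A ^ 2 * f)) := by gcongr
        _ = _ := by field_simp
    refine lt_of_le_of_lt h1 ?_
    rw [div_lt_iff₀ (by positivity)]
    exact hm2
  have hY2 : κ ^ 2 * ρ * h ≤ Y * (h + 1) := by
    calc κ ^ 2 * ρ * h = (u * h / (4 ^ k * H ^ 2)) * L ^ 2 := by rw [hκ, hρ]; field_simp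
      _ ≤ (u * h / (4 ^ k * H ^ 2)) * (4 ^ k * (A ^ 2 * f)) := by gcongr
      _ = (A ^ 2 * h / H ^ 2) * (f * u) := by field_simp
      _ ≤ (A ^ 2 * h / H ^ 2) * (((h : ℝ) + 1) * X ^ 2) := by gcongr
      _ = Y * (h + 1) := by rw [hY, hXH]; field_simp
  have hY1 : 4 ≤ Y * h := by
    have : Y * h = A ^ 2 := by rw [hY]; field_simp
    rw [this]; nlinarith
  have hes : e * s < 1 := by linarith
  have hsH : s * H = u * h := by rw [hs, hXH]; field_simp
  refine f_core h r hr hh b ρ e s κ Y hs0 hes hY1 hY2 hlt ?_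
  have hrho := f_rho u huSq
  rw [← hk, ← hρ] at hrho
  by_cases hu1 : u = 1
  · left
    have hσ1 : σ = 1 := by rw [hσe, hu1]; simp
    have hφ1 : φ = 1 := by rw [hφ, hu1]; simp
    have hk0 : k = 0 := by rw [hk, hu1]; simp
    have huR1 : (u : ℝ) = 1 := by rw [hu1]; simp
    refine ⟨?_, ?_, ?_, ?_⟩
    · rw [hκ, le_div_iff₀ hH0]
      rw [huR1] at hLlow hsH
      nlinarith
    · rw [he, hσ1, hφ1, huR1]; norm_num; linarith
    · rw [hb, hσ1, hφ1, huR1, hk0]; norm_num; linarith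
    · rw [hρ, huR1, hk0]; norm_num
  · right
    have hu2 : 2 ≤ u := by omega
    have hh3 : 3 ≤ h := by
      obtain ⟨p, hp, hpu⟩ := Nat.exists_prime_and_dvd hu1
      have := huP p hp hpu
      have := hp.two_le
      omega
    have hσu : (u : ℝ) + 1 ≤ σ := by
      rw [hσe]; exact_mod_cast f_sig u (by omega)
    have he1 : g * (((u : ℝ) + 2) / 4 + 1 / (4 * u) + 1 / 2) ≤ e := by
      rw [he]
      have a1 : ((u : ℝ) + 2) / 4 + 1 / (4 * u) ≤ σ ^ 2 / (4 * u) := by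
        have : ((u : ℝ) + 2) / 4 + 1 / (4 * u) = ((u : ℝ) + 1) ^ 2 / (4 * u) := by
          field_simp; ring
        rw [this]
        gcongr
      have a2 : 1 / 2 ≤ φ * σ / u ^ 2 := by
        rw [le_div_iff₀ (by positivity)]; linarith
      gcongr
    have heN : ∀ c : ℝ, 0 ≤ c → c ≤ ((u : ℝ) + 2) / 4 + 1 / (4 * u) + 1 / 2 → 1.644 * c ≤ e := by
      intro c hc0 hc
      exact (mul_le_mul hg1 hc hc0 hg0.le).trans he1
    have hb1 : 1.644 * (3 / 2) ^ k ≤ b := by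
      have a1 : (6 : ℝ) ^ k ≤ u * σ / φ := by rw [le_div_iff₀ hφ0]; exact hfb
      rw [hb, le_div_iff₀ hfour]
      have a2 : (6 : ℝ) ^ k = (3 / 2) ^ k * 4 ^ k := by rw [← mul_pow]; norm_num
      calc (1.644 : ℝ) * (3 / 2) ^ k * 4 ^ k = 1.644 * 6 ^ k := by rw [a2]; ring
        _ ≤ _ := by gcongr
    have hk1 : 1 ≤ k := by
      rw [hk, Nat.one_le_iff_ne_zero, Ne, Finset.card_eq_zero]
      intro h0
      rcases Nat.primeFactors_eq_empty.mp h0 with h0 | h0 <;> omega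
    have hb2 : 2.46 ≤ b := by
      have : (3 / 2 : ℝ) ^ 1 ≤ (3 / 2) ^ k := by gcongr; norm_num
      linarith
    have hu2R : (2 : ℝ) ≤ u := by exact_mod_cast hu2
    have hinv0 : 0 < 1 / (4 * (u : ℝ)) := by positivity
    refine ⟨?_, hh3, ?_⟩
    · rw [hκ, le_div_iff₀ hH0]
      have : (1 - s * (1 / 2 + 1 / h)) * H = H - u * (h / 2) - u := by
        have : (1 - s * (1 / 2 + 1 / h)) * H = H - (s * H) * (1 / 2 + 1 / h) := by ring
        rw [this, hsH]; field_simp; ring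
      rw [this]
      have e5 : (u : ℝ) * ((h / 2 : ℕ) : ℝ) ≤ u * (h / 2) := by gcongr
      linarith
    · by_cases d2 : 2 ∣ u
      · by_cases d3 : 3 ∣ u
        · right; right; right
          have h6 : 6 ≤ u := Nat.le_of_dvd hu (by omega)
          have h6R : (6 : ℝ) ≤ u := by exact_mod_cast h6
          rw [if_pos d2, if_pos d3] at hrho
          refine ⟨by linarith, by linarith [heN 2.5 (by norm_num) (by linarith)], ?_⟩
          have hk2 : 2 ≤ k := by
            have : ({2, 3} : Finset ℕ) ⊆ u.primeFactors := by
              intro x hx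
              simp only [Finset.mem_insert, Finset.mem_singleton] at hx
              rcases hx with rfl | rfl
              · exact Nat.mem_primeFactors.mpr ⟨Nat.prime_two, d2, hu.ne'⟩
              · exact Nat.mem_primeFactors.mpr ⟨Nat.prime_three, d3, hu.ne'⟩
            exact Finset.card_le_card this
          have : (3 / 2 : ℝ) ^ 2 ≤ (3 / 2) ^ k := by gcongr; norm_num
          linarith
        · right; right; left
          rw [if_pos d2, if_neg d3] at hrho
          refine ⟨by linarith, ?_, hb2⟩
          have : 9 / 8 ≤ ((u : ℝ) + 2) / 4 + 1 / (4 * u) := by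
            have e1 : ((u : ℝ) + 2) / 4 + 1 / (4 * u) = ((u : ℝ) + 1) ^ 2 / (4 * u) := by
              field_simp; ring
            rw [e1, le_div_iff₀ (by positivity)]
            have e2 : 0 ≤ ((u : ℝ) - 2) * (u - 1 / 2) := mul_nonneg (by linarith) (by linarith)
            linarith
          linarith [heN (13 / 8) (by norm_num) (by linarith)]
      · by_cases d3 : 3 ∣ u
        · right; left
          have h3' : 3 ≤ u := Nat.le_of_dvd hu d3
          have h3R : (3 : ℝ) ≤ u := by exact_mod_cast h3'
          rw [if_neg d2, if_pos d3] at hrho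
          exact ⟨by linarith, by linarith [heN 1.75 (by norm_num) (by linarith)], hb2⟩
        · left
          have h5' : 5 ≤ u := by omega
          have h5R : (5 : ℝ) ≤ u := by exact_mod_cast h5'
          rw [if_neg d2, if_neg d3] at hrho
          exact ⟨by linarith, by linarith [heN 2.25 (by norm_num) (by linarith)], by linarith⟩

end PartF3

/-- Theorem on the existence of a small cubic non-residue `m ≤ H`, coprime to `uv`,
with `χ(m) = ω`. -/
theorem exists_nonresidue (f : ℕ) (hf : f.Prime) (χ : DirichletCharacter ℂ f)
    (hχ : orderOf χ = 3)
    (ω : ℂ) (hω : ω ^ 3 = 1) (hω1 : ω ≠ 1)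
    (r h u v : ℕ) (hr : 0 < r) (hh : 0 < h) (hu : 0 < u) (hv : 0 < v)
    (huSq : Squarefree u) (huP : ∀ p : ℕ, p.Prime → p ∣ u → p < h)
    (hvSq : Squarefree v) (hvP : ∀ p : ℕ, p.Prime → p ∣ v → h ≤ p ∧ p < f)
    (ℓ : ℕ) (hℓ : ℓ = v.primeFactors.card)
    (H : ℝ) (hH0 : 0 < H) (hHf : H < f)
    (X : ℝ) (hX : X = H / h)
    (hr9 : r ≤ 9 * h) (h3ℓ : 3 * ℓ < h) (hXu : X / u ≥ 1)
    (hE : EFun u X > 0)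
    (hmain : (1 / EFun u X) * (Real.pi ^ 2 / 6) * ((sigmaFun u : ℝ) / (Nat.totient u : ℝ)) *
      u * h * Real.sqrt f * ((2 * h : ℝ) / ((h : ℝ) - 3 * ℓ)) ^ (2 * r) * WFun f h r / H ^ 2
        < 1) :
    ∃ m : ℕ, 0 < m ∧ (m : ℝ) ≤ H ∧ Nat.Coprime m (u * v) ∧ χ (m : ZMod f) = ω := by
  haveI : Fact f.Prime := ⟨hf⟩
  by_contra hcon
  have hno : ∀ m : ℕ, 0 < m → (m : ℝ) ≤ H → Nat.Coprime m (u * v) → χ (m : ZMod f) ≠ ω :=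
    fun m h1 h2 h3 h4 => hcon ⟨m, h1, h2, h3, h4⟩
  subst hℓ
  have hhR : (h : ℝ) ≠ 0 := by exact_mod_cast hh.ne'
  have hXH : H = h * X := by rw [hX]; field_simp
  have hvP1 : ∀ p : ℕ, p.Prime → p ∣ v → h ≤ p := fun p hp hpv => (hvP p hp hpv).1
  rcases lt_or_ge (((h : ℝ) + 1) * X ^ 2) ((f : ℝ) * u) with hc | hc
  · exact burgess_case f χ hχ ω hω r h u v hr hh hu hv huSq hvP1 h3ℓ H X hXH hHf hXu hE hno hc hmain
  · exact pv_case f χ hχ ω hω r h u v hr hh hu hv huSq huP hvP1 h3ℓ H X hXH hHf hXu hE hno hc hmain
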